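/- For every dimension n ≥ 2 there exist constants ε₀ ∈ (0,1/2) and c₁ > 0, depending only on n, with the following property. Let E ⊆ ℝⁿ be an open bounded set with |E| = |B| and bar(E) = 0 whose boundary is ∂E = {(1+u(x))x : x ∈ ∂B} for a Lipschitz function u : ∂B → ℝ with ‖u‖_{W^{1,∞}(∂B)} < ε₀. Then for every s ∈ (0,1): δ_s(E) ≥ c₁·s·λ₀(E)²; explicitly one can take c₁ = ω_n·ε₀²·c₀/(n·((1+ε₀)ⁿ − 1)²) with c₀ the constant from the fractional Fuglede inequality. -/

import Mathlib

open MeasureTheory Metric Bornology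
open scoped ENNReal symmDiff

/-- The fractional `s`-perimeter of a set `E ⊆ ℝⁿ`:
`P_s(E) = ∫_E ∫_{Eᶜ} |x - y|^{-(n+s)} dx dy`. -/
noncomputable def fracPer (n : ℕ) (s : ℝ) (E : Set (EuclideanSpace ℝ (Fin n))) : ℝ≥0∞ :=
  ∫⁻ x in E, ∫⁻ y in Eᶜ, ENNReal.ofReal (‖x - y‖ ^ (-((n : ℝ) + s)))

/-- The radius of the ball centered at the origin with the same volume as `E`. -/
noncomputable def matchRad (n : ℕ) (E : Set (EuclideanSpace ℝ (Fin n))) : ℝ :=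
  ((volume E).toReal / (volume (ball (0 : EuclideanSpace ℝ (Fin n)) 1)).toReal) ^ ((1 : ℝ) / n)

/-- The `s`-isoperimetric deficit `δ_s(E) = (P_s(E) - P_s(B(m)))/P_s(B(m))`, where `B(m)` is the
ball centered at the origin with `|B(m)| = |E|`. -/
noncomputable def sDeficit (n : ℕ) (s : ℝ) (E : Set (EuclideanSpace ℝ (Fin n))) : ℝ :=
  ((fracPer n s E).toReal
      - (fracPer n s (ball (0 : EuclideanSpace ℝ (Fin n)) (matchRad n E))).toReal)
    / (fracPer n s (ball (0 : EuclideanSpace ℝ (Fin n)) (matchRad n E))).toReal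

/-- The barycenter `bar(E) = (1/|E|) ∫_E x dx`. -/
noncomputable def barycenter (n : ℕ) (E : Set (EuclideanSpace ℝ (Fin n))) :
    EuclideanSpace ℝ (Fin n) :=
  ((volume E).toReal)⁻¹ • ∫ x in E, x

/-- The barycentric asymmetry `λ₀(E) = |E ∆ (bar(E) + B(m))| / |E|`. -/
noncomputable def barAsym (n : ℕ) (E : Set (EuclideanSpace ℝ (Fin n))) : ℝ :=
  (volume (E ∆ ball (barycenter n E) (matchRad n E))).toReal / (volume E).toReal

section Polar

variable {V : Type*} [NormedAddCommGroup V] [NormedSpace ℝ V] [MeasurableSpace V] [BorelSpace V]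
  [Nontrivial V] [FiniteDimensional ℝ V]

theorem lintegral_volumeIoiPow (d : ℕ) {f : ℝ → ℝ≥0∞} (hf : Measurable f) :
    ∫⁻ r : Set.Ioi (0 : ℝ), f r ∂Measure.volumeIoiPow d
      = ∫⁻ r in Set.Ioi (0 : ℝ), ENNReal.ofReal (r ^ d) * f r := by
  rw [Measure.volumeIoiPow, lintegral_withDensity_eq_lintegral_mul _ (by fun_prop) (by fun_prop)]
  exact lintegral_subtype_comap measurableSet_Ioi fun r : ℝ => ENNReal.ofReal (r ^ d) * f r

/-- Integration in polar coordinates. -/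
theorem lintegral_polar (μ : Measure V) [μ.IsAddHaarMeasure] {f : V → ℝ≥0∞} (hf : Measurable f) :
    ∫⁻ x, f x ∂μ = ∫⁻ ω : sphere (0 : V) 1, (∫⁻ r in Set.Ioi (0 : ℝ),
      ENNReal.ofReal (r ^ (Module.finrank ℝ V - 1)) * f (r • (ω : V))) ∂μ.toSphere := by
  have h1 : ∫⁻ x, f x ∂μ = ∫⁻ x : ({(0)}ᶜ : Set V), f x ∂(μ.comap (↑)) := by
    rw [lintegral_subtype_comap (measurableSet_singleton _).compl f, restrict_compl_singleton]
  have h2 := μ.measurePreserving_homeomorphUnitSphereProd.lintegral_comp_emb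
    (Homeomorph.measurableEmbedding _) (fun p => f ((p.2 : ℝ) • (p.1 : V)))
  have h3 : ∀ x : ({(0)}ᶜ : Set V), f (((homeomorphUnitSphereProd V x).2 : ℝ) •
      ((homeomorphUnitSphereProd V x).1 : V)) = f x := by
    intro x
    have hx : (x : V) ≠ 0 := x.2
    congr 1
    simp [smul_smul, hx]
  simp only [h3] at h2
  rw [h1, h2, lintegral_prod _ (by fun_prop)]
  refine lintegral_congr fun ω => ?_
  exact lintegral_volumeIoiPow _ (f := fun r => f (r • (ω : V))) (by fun_prop)

theorem integral_polar {F : Type*} [NormedAddCommGroup F] [NormedSpace ℝ F] (μ : Measure V)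
    [μ.IsAddHaarMeasure] {f : V → F} (hf : Integrable f μ) :
    ∫ x, f x ∂μ = ∫ ω : sphere (0 : V) 1, (∫ r in Set.Ioi (0 : ℝ),
      r ^ (Module.finrank ℝ V - 1) • f (r • (ω : V))) ∂μ.toSphere := by
  have h1 : ∫ x, f x ∂μ = ∫ x : ({(0)}ᶜ : Set V), f x ∂(μ.comap (↑)) := by
    rw [integral_subtype_comap (measurableSet_singleton _).compl f, restrict_compl_singleton]
  have hmp := μ.measurePreserving_homeomorphUnitSphereProd
  have h2 := hmp.integral_comp
    (Homeomorph.measurableEmbedding _) (fun p => f ((p.2 : ℝ) • (p.1 : V)))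
  have h3 : ∀ x : ({(0)}ᶜ : Set V), f (((homeomorphUnitSphereProd V x).2 : ℝ) •
      ((homeomorphUnitSphereProd V x).1 : V)) = f x := by
    intro x
    have hx : (x : V) ≠ 0 := x.2
    congr 1
    simp [smul_smul, hx]
  have h4 := hmp.integrable_comp_emb (Homeomorph.measurableEmbedding _)
    (g := (fun p => f ((p.2 : ℝ) • (p.1 : V))))
  simp only [h3, Function.comp_def] at h2 h4
  have h5 : Integrable (fun x : ({(0)}ᶜ : Set V) => f x) (μ.comap (↑)) := by
    have := (MeasurableEmbedding.subtype_coe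
      (measurableSet_singleton (0 : V)).compl).integrable_map_iff (μ := μ.comap (↑)) (g := f)
    rw [Function.comp_def] at this
    rw [← this, map_comap_subtype_coe (measurableSet_singleton (0 : V)).compl,
      restrict_compl_singleton]
    exact hf
  rw [h1, h2, integral_prod _ (h4.1 h5)]
  congr 1
  ext ω
  simp only [Measure.volumeIoiPow, ENNReal.ofReal]
  rw [integral_withDensity_eq_integral_smul,
    integral_subtype_comap measurableSet_Ioi
      fun a => Real.toNNReal (a ^ (Module.finrank ℝ V - 1)) • f (a • (ω : V)),
    setIntegral_congr_fun measurableSet_Ioi fun x hx => ?_]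
  · rw [NNReal.smul_def, Real.coe_toNNReal _ (pow_nonneg hx.out.le _)]
  · exact (measurable_subtype_coe.pow_const _).real_toNNReal

theorem setLIntegral_Ioo_pow (d : ℕ) {a : ℝ} (ha : 0 ≤ a) :
    ∫⁻ r in Set.Ioo 0 a, ENNReal.ofReal (r ^ d) = ENNReal.ofReal (a ^ (d + 1) / (d + 1)) := by
  rw [Measure.restrict_congr_set Ioo_ae_eq_Ioc,
    ← ofReal_integral_eq_lintegral_ofReal (intervalIntegral.intervalIntegrable_pow _).1,
    ← intervalIntegral.integral_of_le ha]
  · simp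
  · filter_upwards [ae_restrict_mem measurableSet_Ioc] with y hy
    exact pow_nonneg hy.1.le _

theorem lintegral_sphere_eq_ball (μ : Measure V) [μ.IsAddHaarMeasure]
    {f : sphere (0 : V) 1 → ℝ≥0∞} (g : V → ℝ≥0∞) (hg : Measurable g)
    (hgf : ∀ (ω : sphere (0 : V) 1) (r : ℝ), 0 < r → g (r • (ω : V)) = f ω) :
    ∫⁻ ω, f ω ∂μ.toSphere
      = (Module.finrank ℝ V : ℝ≥0∞) * ∫⁻ x in ball (0 : V) 1, g x ∂μ := by
  have hd : 0 < Module.finrank ℝ V := Module.finrank_pos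
  rw [← lintegral_indicator measurableSet_ball, lintegral_polar μ
    (hg.indicator measurableSet_ball)]
  have key : ∀ ω : sphere (0 : V) 1, ∫⁻ r in Set.Ioi (0 : ℝ),
      ENNReal.ofReal (r ^ (Module.finrank ℝ V - 1)) * (ball (0 : V) 1).indicator g (r • (ω : V))
      = ENNReal.ofReal ((Module.finrank ℝ V : ℝ)⁻¹) * f ω := by
    intro ω
    have hω : ‖(ω : V)‖ = 1 := by simp
    have : ∫⁻ r in Set.Ioi (0 : ℝ),
      ENNReal.ofReal (r ^ (Module.finrank ℝ V - 1)) * (ball (0 : V) 1).indicator g (r • (ω : V))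
      = ∫⁻ r in Set.Ioi (0 : ℝ), (Set.Iio 1).indicator
        (fun r : ℝ => ENNReal.ofReal (r ^ (Module.finrank ℝ V - 1)) * f ω) r := by
      refine setLIntegral_congr_fun measurableSet_Ioi fun r hr => ?_
      have hr' : (0 : ℝ) < r := hr
      by_cases h : r < 1
      · rw [Set.indicator_of_mem (by simpa [norm_smul, hω, abs_of_pos hr'] using h),
          Set.indicator_of_mem (by simpa using h), hgf ω r hr']
      · rw [Set.indicator_of_notMem (by simpa [norm_smul, hω, abs_of_pos hr'] using h),
          Set.indicator_of_notMem (by simpa using h), mul_zero]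
    rw [this, setLIntegral_indicator measurableSet_Iio, lintegral_mul_const _ (by fun_prop)]
    have h4 : ((Module.finrank ℝ V - 1 : ℕ) : ℝ) + 1 = Module.finrank ℝ V := by
      rw [Nat.cast_sub hd]; simp
    rw [Set.inter_comm, Set.Ioi_inter_Iio, setLIntegral_Ioo_pow _ zero_le_one, h4]
    simp
  simp_rw [key]
  rw [lintegral_const_mul' _ _ (by simp), ← mul_assoc, ← ENNReal.ofReal_natCast,
    ← ENNReal.ofReal_mul (by positivity), mul_inv_cancel₀ (by positivity)]
  simp

end Polar

section Rotation

open scoped Pointwise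

variable {V : Type*} [NormedAddCommGroup V] [InnerProductSpace ℝ V]

/-- The action of a linear isometry on the unit sphere. -/
def sphereMap (T : V ≃ₗᵢ[ℝ] V) (ω : sphere (0 : V) 1) : sphere (0 : V) 1 :=
  ⟨T ω, by simp⟩

@[simp] theorem coe_sphereMap (T : V ≃ₗᵢ[ℝ] V) (ω : sphere (0 : V) 1) :
    (sphereMap T ω : V) = T ω := rfl

theorem continuous_sphereMap (T : V ≃ₗᵢ[ℝ] V) : Continuous (sphereMap T) := by
  unfold sphereMap; fun_prop

variable [MeasurableSpace V] [BorelSpace V] [FiniteDimensional ℝ V]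

theorem measurePreserving_sphereMap (T : V ≃ₗᵢ[ℝ] V) :
    MeasurePreserving (sphereMap T) (volume : Measure V).toSphere
      (volume : Measure V).toSphere := by
  refine ⟨(continuous_sphereMap T).measurable, ?_⟩
  ext s hs
  rw [Measure.map_apply (continuous_sphereMap T).measurable hs, Measure.toSphere_apply' _ hs,
    Measure.toSphere_apply' _ ((continuous_sphereMap T).measurable hs)]
  congr 1
  have h : Set.Ioo (0 : ℝ) 1 • ((↑) '' (sphereMap T ⁻¹' s) : Set V)
      = T ⁻¹' (Set.Ioo (0 : ℝ) 1 • ((↑) '' s : Set V)) := by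
    ext x
    simp only [Set.mem_smul, Set.mem_preimage, Set.mem_image]
    constructor
    · rintro ⟨r, hr, _, ⟨ω, hω, rfl⟩, rfl⟩
      exact ⟨r, hr, _, ⟨_, hω, rfl⟩, by simp⟩
    · rintro ⟨r, hr, _, ⟨ω, hω, rfl⟩, hx⟩
      refine ⟨r, hr, _, ⟨sphereMap T.symm ω, ?_, rfl⟩, ?_⟩
      · have : sphereMap T (sphereMap T.symm ω) = ω := by ext; simp
        simpa [this] using hω
      · rw [coe_sphereMap, ← T.symm.map_smul, hx]; simp
  rw [h]
  exact T.measurePreserving.measure_preimage_equiv (f := T.toMeasurableEquiv) _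

end Rotation

section Zonal

open scoped Pointwise

theorem lintegral_euclidean_succ (N : ℕ) {f : EuclideanSpace ℝ (Fin (N + 1)) → ℝ≥0∞}
    (hf : Measurable f) :
    ∫⁻ x, f x = ∫⁻ a : ℝ, ∫⁻ y : EuclideanSpace ℝ (Fin N),
        f (WithLp.toLp 2 (Fin.cons a y.ofLp)) := by
  have e1 := (EuclideanSpace.volume_preserving_symm_measurableEquiv_toLp (Fin (N + 1))).symm
  have e2 := (volume_preserving_piFinSuccAbove (fun _ : Fin (N + 1) => ℝ) 0).symm
  have e3 := (EuclideanSpace.volume_preserving_symm_measurableEquiv_toLp (Fin N))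
  rw [← e1.lintegral_comp hf, ← e2.lintegral_comp (by fun_prop), Measure.volume_eq_prod,
    lintegral_prod _ (by fun_prop)]
  refine lintegral_congr fun a => ?_
  rw [← e3.lintegral_comp (by fun_prop)]
  refine lintegral_congr fun y => ?_
  congr 1
  simp [MeasurableEquiv.piFinSuccAbove]
  rfl

theorem lintegral_norm_radial {V : Type*} [NormedAddCommGroup V] [InnerProductSpace ℝ V]
    [MeasurableSpace V] [BorelSpace V] [Nontrivial V] [FiniteDimensional ℝ V]
    {f : ℝ → ℝ≥0∞} (hf : Measurable f) :
    ∫⁻ y : V, f ‖y‖ = (volume : Measure V).toSphere Set.univ *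
      ∫⁻ t in Set.Ioi (0 : ℝ), ENNReal.ofReal (t ^ (Module.finrank ℝ V - 1)) * f t := by
  rw [lintegral_polar volume (by fun_prop), mul_comm, ← lintegral_const]
  refine lintegral_congr fun ω => ?_
  refine setLIntegral_congr_fun measurableSet_Ioi fun r hr => ?_
  simp [norm_smul, abs_of_pos (show (0 : ℝ) < r from hr)]

/-- The area of the unit sphere of `ℝ^(N+1)`. -/
noncomputable def sphereArea (N : ℕ) : ℝ≥0∞ :=
  (volume : Measure (EuclideanSpace ℝ (Fin (N + 1)))).toSphere Set.univ

theorem lintegral_axial (N : ℕ) {f : ℝ → ℝ → ℝ≥0∞} (hf : Measurable f.uncurry) :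
    ∫⁻ x : EuclideanSpace ℝ (Fin (N + 2)), f (x 0)
        ‖(WithLp.toLp 2 (Fin.tail x.ofLp) : EuclideanSpace ℝ (Fin (N + 1)))‖
      = sphereArea N * ∫⁻ a : ℝ, ∫⁻ t in Set.Ioi (0 : ℝ), ENNReal.ofReal (t ^ N) * f a t := by
  have hm : Measurable fun p : ℝ × ℝ => f p.1 p.2 := hf
  rw [lintegral_euclidean_succ (N + 1), ← lintegral_const_mul]
  · refine lintegral_congr fun a => ?_
    have := lintegral_norm_radial (V := EuclideanSpace ℝ (Fin (N + 1))) (f := f a)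
      (hm.comp (by fun_prop : Measurable fun t : ℝ => (a, t)))
    simpa [sphereArea] using this
  · apply Measurable.lintegral_prod_right
    exact ((by fun_prop : Measurable fun p : ℝ × ℝ => ENNReal.ofReal (p.2 ^ N))).mul hm
  · refine hm.comp (f := fun x : EuclideanSpace ℝ (Fin (N + 2)) =>
      (x 0, ‖(WithLp.toLp 2 (Fin.tail x.ofLp) : EuclideanSpace ℝ (Fin (N + 1)))‖)) ?_
    have : Continuous fun x : EuclideanSpace ℝ (Fin (N + 2)) =>
      (x 0, ‖(WithLp.toLp 2 (Fin.tail x.ofLp) : EuclideanSpace ℝ (Fin (N + 1)))‖) := by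
      unfold Fin.tail; fun_prop
    exact this.measurable

theorem lintegral_zonal (N : ℕ) {ψ : ℝ → ℝ≥0∞} (hψ : Measurable ψ) :
    ∫⁻ ω : sphere (0 : EuclideanSpace ℝ (Fin (N + 2))) 1, ψ ((ω : EuclideanSpace ℝ (Fin (N + 2))) 0)
        ∂(volume : Measure (EuclideanSpace ℝ (Fin (N + 2)))).toSphere
      = sphereArea N * ∫⁻ θ in Set.Ioo 0 Real.pi,
          ENNReal.ofReal (Real.sin θ ^ N) * ψ (Real.cos θ) := by
  have h0 : Measurable fun x : EuclideanSpace ℝ (Fin (N + 2)) => x 0 := by fun_prop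
  rw [lintegral_sphere_eq_ball volume (fun x => ψ (x 0 / ‖x‖)) (by fun_prop)]
  swap
  · intro ω r hr
    have : ‖(ω : EuclideanSpace ℝ (Fin (N + 2)))‖ = 1 := by simp
    congr 1
    simp [norm_smul, abs_of_pos hr]
    field_simp
  have hm : MeasurableSet {p : ℝ × ℝ | p.1 ^ 2 + p.2 ^ 2 < 1} :=
    measurableSet_lt (by fun_prop) (by fun_prop)
  have h1 : Measurable (Function.uncurry fun a t : ℝ =>
      {p : ℝ × ℝ | p.1 ^ 2 + p.2 ^ 2 < 1}.indicator
        (fun p => ψ (p.1 / √(p.1 ^ 2 + p.2 ^ 2))) (a, t)) := by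
    refine Measurable.indicator ?_ hm
    fun_prop
  have h2 := lintegral_axial N h1
  have h3 : ∀ x : EuclideanSpace ℝ (Fin (N + 2)), ‖x‖ ^ 2 = x 0 ^ 2 +
      ‖(WithLp.toLp 2 (Fin.tail x.ofLp) : EuclideanSpace ℝ (Fin (N + 1)))‖ ^ 2 := by
    intro x
    simp [EuclideanSpace.norm_sq_eq, Fin.sum_univ_succ, Fin.tail]
  have h4 : ∀ x : EuclideanSpace ℝ (Fin (N + 2)),
      {p : ℝ × ℝ | p.1 ^ 2 + p.2 ^ 2 < 1}.indicator
        (fun p => ψ (p.1 / √(p.1 ^ 2 + p.2 ^ 2)))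
        (x 0, ‖(WithLp.toLp 2 (Fin.tail x.ofLp) : EuclideanSpace ℝ (Fin (N + 1)))‖)
      = (ball (0 : EuclideanSpace ℝ (Fin (N + 2))) 1).indicator (fun x => ψ (x 0 / ‖x‖)) x := by
    intro x
    simp only [Set.indicator, Set.mem_ofPred_eq, ← h3, mem_ball_zero_iff,
      Real.sqrt_sq (norm_nonneg x),
      sq_lt_one_iff₀ (norm_nonneg x)]
  simp only [h4] at h2
  rw [lintegral_indicator measurableSet_ball] at h2
  rw [h2, mul_left_comm]
  congr 1
  have h5 : ∫⁻ a : ℝ, ∫⁻ t in Set.Ioi (0 : ℝ), ENNReal.ofReal (t ^ N) *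
      {p : ℝ × ℝ | p.1 ^ 2 + p.2 ^ 2 < 1}.indicator
        (fun p => ψ (p.1 / √(p.1 ^ 2 + p.2 ^ 2))) (a, t)
      = ∫⁻ p : ℝ × ℝ, (Set.univ ×ˢ Set.Ioi (0 : ℝ)).indicator (fun p => ENNReal.ofReal (p.2 ^ N) *
      {p : ℝ × ℝ | p.1 ^ 2 + p.2 ^ 2 < 1}.indicator
        (fun p => ψ (p.1 / √(p.1 ^ 2 + p.2 ^ 2))) p) p := by
    rw [Measure.volume_eq_prod, lintegral_prod]
    · refine lintegral_congr fun a => ?_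
      rw [← lintegral_indicator measurableSet_Ioi]
      refine lintegral_congr fun t => ?_
      simp [Set.indicator]
    · exact (Measurable.indicator ((by fun_prop : Measurable fun p : ℝ × ℝ =>
        ENNReal.ofReal (p.2 ^ N)).mul h1)
        (MeasurableSet.univ.prod measurableSet_Ioi)).aemeasurable
  have h6 : polarCoord.target = Set.Ioi (0 : ℝ) ×ˢ Set.Ioo (-Real.pi) Real.pi := rfl
  have h7 : Measurable fun r : ℝ => (Set.Ioo (0 : ℝ) 1).indicator
      (fun r => ENNReal.ofReal (r ^ (N + 1))) r :=
    Measurable.indicator (by fun_prop) measurableSet_Ioo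
  have h8 : Measurable fun θ : ℝ => (Set.Ioo 0 Real.pi).indicator
      (fun θ => ENNReal.ofReal (Real.sin θ ^ N) * ψ (Real.cos θ)) θ :=
    Measurable.indicator (by fun_prop) measurableSet_Ioo
  rw [h5, ← lintegral_comp_polarCoord_symm, h6]
  rw [setLIntegral_congr_fun (g := fun p : ℝ × ℝ =>
      (Set.Ioo (0 : ℝ) 1).indicator (fun r => ENNReal.ofReal (r ^ (N + 1))) p.1 *
      (Set.Ioo 0 Real.pi).indicator
        (fun θ => ENNReal.ofReal (Real.sin θ ^ N) * ψ (Real.cos θ)) p.2)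
      (measurableSet_Ioi.prod measurableSet_Ioo)]
  · rw [Measure.volume_eq_prod, ← Measure.prod_restrict,
      lintegral_prod_mul h7.aemeasurable h8.aemeasurable,
      setLIntegral_indicator measurableSet_Ioo, setLIntegral_indicator measurableSet_Ioo,
      Set.inter_eq_left.2 Set.Ioo_subset_Ioi_self,
      Set.inter_eq_left.2 (Set.Ioo_subset_Ioo_left (by linarith [Real.pi_pos])),
      setLIntegral_Ioo_pow _ zero_le_one, ← mul_assoc]
    simp only [finrank_euclideanSpace, Fintype.card_fin, one_pow]
    rw [← ENNReal.ofReal_natCast, ← ENNReal.ofReal_mul (by positivity)]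
    have : ((N + 2 : ℕ) : ℝ) * (1 / ((N + 1 : ℕ) + 1)) = 1 := by
      push_cast; field_simp; ring
    rw [this]; simp
  · rintro ⟨r, θ⟩ ⟨hr, hθ⟩
    replace hr : 0 < r := hr
    replace hθ : -Real.pi < θ ∧ θ < Real.pi := hθ
    have e1 : (r * Real.cos θ) ^ 2 + (r * Real.sin θ) ^ 2 = r ^ 2 := by
      linear_combination r ^ 2 * Real.sin_sq_add_cos_sq θ
    have e2 : (0 < r * Real.sin θ) ↔ 0 < θ := by
      rw [mul_pos_iff_of_pos_left hr]
      constructor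
      · intro h
        by_contra! h'
        exact absurd h (not_lt.2 (Real.sin_nonpos_of_nonpos_of_neg_pi_le h' hθ.1.le))
      · intro h
        exact Real.sin_pos_of_pos_of_lt_pi h hθ.2
    simp only [polarCoord_symm_apply, Set.indicator, Set.mem_prod, Set.mem_univ, true_and,
      Set.mem_Ioi, Set.mem_ofPred_eq, e1, e2, Set.mem_Ioo, hr, hθ.2, and_true,
      sq_lt_one_iff₀ hr.le, Real.sqrt_sq hr.le, smul_eq_mul, mul_div_cancel_left₀ _ hr.ne']
    split_ifs with ha hb
    · have := (Real.sin_pos_of_pos_of_lt_pi ha hθ.2).le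
      rw [← mul_assoc, ← mul_assoc, ← ENNReal.ofReal_mul hr.le,
        ← ENNReal.ofReal_mul (by positivity)]
      congr 2; ring
    all_goals simp

end Zonal

section Averaging

open scoped Pointwise RealInnerProductSpace

theorem exists_linearIsometryEquiv_map_pair {V : Type*} [NormedAddCommGroup V]
    [InnerProductSpace ℝ V] {x y x' y' : V} (hx : ‖x‖ = ‖x'‖) (hy : ‖y‖ = ‖y'‖)
    (h : ⟪x, y⟫ = ⟪x', y'⟫) : ∃ T : V ≃ₗᵢ[ℝ] V, T x = x' ∧ T y = y' := by
  let T₁ : V ≃ₗᵢ[ℝ] V := (ℝ ∙ (x - x'))ᗮ.reflection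
  have h₁ : T₁ x = x' := Submodule.reflection_sub hx
  have h₂ : ‖T₁ y‖ = ‖y'‖ := by simp [hy]
  let T₂ : V ≃ₗᵢ[ℝ] V := (ℝ ∙ (T₁ y - y'))ᗮ.reflection
  have h₃ : T₂ (T₁ y) = y' := Submodule.reflection_sub h₂
  have h₄ : T₂ x' = x' := by
    refine Submodule.reflection_mem_subspace_eq_self ?_
    rw [Submodule.mem_orthogonal_singleton_iff_inner_left, inner_sub_right, ← h, ← h₁,
      T₁.inner_map_map, sub_self]
  exact ⟨T₁.trans T₂, by simp [h₁, h₄], by simp [h₃]⟩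

theorem isCompact_unitary_continuousLinearMap (V : Type*) [NormedAddCommGroup V]
    [InnerProductSpace ℝ V] [FiniteDimensional ℝ V] :
    IsCompact (unitary (V →L[ℝ] V) : Set (V →L[ℝ] V)) := by
  have : ProperSpace (V →L[ℝ] V) := FiniteDimensional.proper ℝ _
  refine Metric.isCompact_of_isClosed_isBounded isClosed_unitary ?_
  refine isBounded_iff_forall_norm_le.2 ⟨1, fun T hT => ?_⟩
  refine T.opNorm_le_bound zero_le_one fun x => ?_
  rw [T.norm_map_of_mem_unitary hT, one_mul]

/-- The orthogonal group of a finite-dimensional space carries a probability measure that is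
invariant under right translations. -/
theorem exists_isMulRightInvariant_unitary (V : Type*) [NormedAddCommGroup V]
    [InnerProductSpace ℝ V] [FiniteDimensional ℝ V] [MeasurableSpace (unitary (V →L[ℝ] V))]
    [BorelSpace (unitary (V →L[ℝ] V))] :
    ∃ μ : Measure (unitary (V →L[ℝ] V)), IsProbabilityMeasure μ ∧ μ.IsMulRightInvariant := by
  have : CompactSpace (unitary (V →L[ℝ] V)) :=
    isCompact_iff_compactSpace.1 (isCompact_unitary_continuousLinearMap V)
  let K : TopologicalSpace.PositiveCompacts (unitary (V →L[ℝ] V)) := ⊤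
  let ν := Measure.haarMeasure K
  have hν : ν Set.univ = 1 := Measure.haarMeasure_self (K₀ := K)
  refine ⟨ν.inv, ⟨?_⟩, inferInstance⟩
  rw [Measure.inv_apply, Set.inv_univ, hν]

/-- The unit circle in the plane of the first two coordinates. -/
noncomputable def planeCircle (N : ℕ) (φ : ℝ) : EuclideanSpace ℝ (Fin (N + 2)) :=
  Real.cos φ • EuclideanSpace.single 0 1 + Real.sin φ • EuclideanSpace.single 1 1

theorem inner_planeCircle (N : ℕ) (a b : ℝ) :
    ⟪planeCircle N a, planeCircle N b⟫ = Real.cos (a - b) := by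
  simp [planeCircle, inner_add_left, inner_add_right, inner_smul_left, inner_smul_right,
    Real.cos_sub, EuclideanSpace.inner_single_left, mul_comm]

theorem norm_planeCircle (N : ℕ) (a : ℝ) : ‖planeCircle N a‖ = 1 := by
  rw [norm_eq_sqrt_real_inner, inner_planeCircle]; simp

theorem continuous_planeCircle (N : ℕ) : Continuous (planeCircle N) := by
  unfold planeCircle; fun_prop

/-- Double integrals over the sphere as averages over great circles. -/
theorem exists_circle_average (N : ℕ) :
    ∃ (G : Type) (_ : MeasurableSpace G) (μ : Measure G)
      (γ : G → ℝ → sphere (0 : EuclideanSpace ℝ (Fin (N + 2))) 1),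
      IsProbabilityMeasure μ ∧ Measurable γ.uncurry ∧ (∀ g, Continuous (γ g)) ∧
      (∀ g a, γ g (a + 2 * Real.pi) = γ g a) ∧
      (∀ g a b, ⟪(γ g a : EuclideanSpace ℝ (Fin (N + 2))), (γ g b : EuclideanSpace ℝ (Fin (N + 2)))⟫
        = Real.cos (a - b)) ∧
      ∀ F : sphere (0 : EuclideanSpace ℝ (Fin (N + 2))) 1 →
          sphere (0 : EuclideanSpace ℝ (Fin (N + 2))) 1 → ℝ≥0∞, Measurable F.uncurry →
        ∫⁻ x, ∫⁻ y, F x y ∂(volume : Measure (EuclideanSpace ℝ (Fin (N + 2)))).toSphere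
            ∂(volume : Measure (EuclideanSpace ℝ (Fin (N + 2)))).toSphere
          = (volume : Measure (EuclideanSpace ℝ (Fin (N + 2)))).toSphere Set.univ *
            (sphereArea N * ∫⁻ θ in Set.Ioo 0 Real.pi, ENNReal.ofReal (Real.sin θ ^ N) *
              ∫⁻ g, ENNReal.ofReal (1 / (2 * Real.pi)) *
                (∫⁻ φ in Set.Ioc 0 (2 * Real.pi), F (γ g φ) (γ g (φ + θ))) ∂μ) := by
  set V := EuclideanSpace ℝ (Fin (N + 2))
  set σ := (volume : Measure V).toSphere
  let G := unitary (V →L[ℝ] V)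
  let : MeasurableSpace G := borel G
  have : BorelSpace G := ⟨rfl⟩
  obtain ⟨μ, hμ, hr⟩ := exists_isMulRightInvariant_unitary V
  have hsf : SFinite μ := inferInstance
  let A : G → V ≃ₗᵢ[ℝ] V := fun g => Unitary.linearIsometryEquiv g
  have hA : ∀ (g : G) (x : V), A g x = (g : V →L[ℝ] V) x := fun g x => rfl
  let act : G → sphere (0 : V) 1 → sphere (0 : V) 1 := fun g => sphereMap (A g)
  have : CompactSpace G := isCompact_iff_compactSpace.1 (isCompact_unitary_continuousLinearMap V)
  have : SecondCountableTopology (V →L[ℝ] V) := by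
    have : ProperSpace (V →L[ℝ] V) := FiniteDimensional.proper ℝ _
    infer_instance
  have hact : Continuous fun p : G × sphere (0 : V) 1 => act p.1 p.2 := by
    refine Continuous.subtype_mk ?_ _
    simp only [hA]
    fun_prop
  let γ₀ : ℝ → sphere (0 : V) 1 := fun φ => ⟨planeCircle N φ, mem_sphere_zero_iff_norm.2
    (norm_planeCircle N φ)⟩
  have hγ₀ : Continuous γ₀ := (continuous_planeCircle N).subtype_mk _
  have hact_mul : ∀ g h x, act (g * h) x = act g (act h x) := fun g h x => rfl
  have hpair : ∀ x y x' y' : sphere (0 : V) 1, ⟪(x : V), (y : V)⟫ = ⟪(x' : V), (y' : V)⟫ →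
      ∃ h : G, act h x = x' ∧ act h y = y' := by
    intro x y x' y' h
    obtain ⟨T, hT, hT'⟩ := exists_linearIsometryEquiv_map_pair
      (x := (x : V)) (y := (y : V)) (x' := (x' : V)) (y' := (y' : V)) (by simp) (by simp) h
    refine ⟨Unitary.linearIsometryEquiv.symm T, ?_, ?_⟩ <;> ext1 <;> simp [act, A, hT, hT']
  have hmp : ∀ g, MeasurePreserving (act g) σ σ := fun g => measurePreserving_sphereMap (A g)
  have hγ₀i : ∀ a b, ⟪(γ₀ a : V), (γ₀ b : V)⟫ = Real.cos (a - b) := inner_planeCircle N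
  refine ⟨G, borel G, μ, fun g φ => act g (γ₀ φ), hμ, ?_, ?_, ?_, ?_, ?_⟩
  · exact (hact.comp (continuous_fst.prodMk (hγ₀.comp continuous_snd))).measurable
  · exact fun g => hact.comp (continuous_const.prodMk hγ₀)
  · intro g a
    have : γ₀ (a + 2 * Real.pi) = γ₀ a := by
      ext1
      simp [γ₀, planeCircle]
    simp only [this]
  · intro g a b
    rw [← hγ₀i a b]
    exact (A g).inner_map_map _ _
  intro F hF
  have hF' : Measurable fun p : sphere (0 : V) 1 × sphere (0 : V) 1 => F p.1 p.2 := hF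
  have hact' := hact.measurable
  have hγm := hγ₀.measurable
  let H : sphere (0 : V) 1 → sphere (0 : V) 1 → ℝ≥0∞ := fun x y => ∫⁻ g, F (act g x) (act g y) ∂μ
  have hFa : Measurable fun p : (sphere (0 : V) 1 × sphere (0 : V) 1) × G =>
      F (act p.2 p.1.1) (act p.2 p.1.2) :=
    hF'.comp ((hact'.comp (by fun_prop : Measurable fun p :
      (sphere (0 : V) 1 × sphere (0 : V) 1) × G => (p.2, p.1.1))).prodMk
      (hact'.comp (by fun_prop : Measurable fun p : (sphere (0 : V) 1 × sphere (0 : V) 1) × G =>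
        (p.2, p.1.2))))
  have hH : Measurable fun p : sphere (0 : V) 1 × sphere (0 : V) 1 => H p.1 p.2 :=
    hFa.lintegral_prod_right'
  have hHinv : ∀ h x y, H (act h x) (act h y) = H x y := by
    intro h x y
    simp only [H, ← hact_mul]
    exact lintegral_mul_right_eq_self (μ := μ) (fun g => F (act g x) (act g y)) h
  have e1 : ∀ g, ∫⁻ x, ∫⁻ y, F x y ∂σ ∂σ = ∫⁻ x, ∫⁻ y, F (act g x) (act g y) ∂σ ∂σ := by
    intro g
    rw [← (hmp g).lintegral_comp hF'.lintegral_prod_right']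
    refine lintegral_congr fun x => ?_
    exact ((hmp g).lintegral_comp (f := fun y => F (act g x) y)
      (hF'.comp measurable_prodMk_left)).symm
  have e2 : ∫⁻ x, ∫⁻ y, F x y ∂σ ∂σ = ∫⁻ x, ∫⁻ y, H x y ∂σ ∂σ := by
    calc ∫⁻ x, ∫⁻ y, F x y ∂σ ∂σ = ∫⁻ g, ∫⁻ x, ∫⁻ y, F x y ∂σ ∂σ ∂μ := by simp
      _ = ∫⁻ g, ∫⁻ x, ∫⁻ y, F (act g x) (act g y) ∂σ ∂σ ∂μ := lintegral_congr e1
      _ = ∫⁻ x, ∫⁻ g, ∫⁻ y, F (act g x) (act g y) ∂σ ∂μ ∂σ := by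
        rw [lintegral_lintegral_swap]
        refine Measurable.aemeasurable ?_
        refine Measurable.lintegral_prod_right' (f := fun p : (G × sphere (0 : V) 1) ×
          sphere (0 : V) 1 => F (act p.1.1 p.1.2) (act p.1.1 p.2)) ?_
        exact hFa.comp (by fun_prop :
          Measurable fun p : (G × sphere (0 : V) 1) × sphere (0 : V) 1 => ((p.1.2, p.2), p.1.1))
      _ = _ := by
        refine lintegral_congr fun x => ?_
        rw [lintegral_lintegral_swap]
        exact (hFa.comp (by fun_prop : Measurable fun p : G × sphere (0 : V) 1 =>
          ((x, p.2), p.1))).aemeasurable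
  have e3 : ∀ x, ∫⁻ y, H x y ∂σ = ∫⁻ y, H (γ₀ 0) y ∂σ := by
    intro x
    obtain ⟨h, hh, -⟩ := hpair x x (γ₀ 0) (γ₀ 0) (by simp)
    rw [← (hmp h).lintegral_comp (f := fun y => H (γ₀ 0) y) (hH.comp measurable_prodMk_left)]
    refine lintegral_congr fun y => ?_
    rw [← hh, hHinv]
  have e4 : ∀ y : sphere (0 : V) 1, H (γ₀ 0) y = H (γ₀ 0) (γ₀ (Real.arccos ((y : V) 0))) := by
    intro y
    have hy : ⟪(γ₀ 0 : V), (y : V)⟫ = (y : V) 0 := by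
      change ⟪planeCircle N 0, (y : V)⟫ = _
      simp [planeCircle, EuclideanSpace.inner_single_left]
    have hy1 : |(y : V) 0| ≤ 1 := by
      rw [← hy]
      exact (abs_real_inner_le_norm _ _).trans (by simp)
    obtain ⟨h, hh, hh'⟩ := hpair (γ₀ 0) y (γ₀ 0) (γ₀ (Real.arccos ((y : V) 0))) (by
      rw [hγ₀i, hy, zero_sub, Real.cos_neg, Real.cos_arccos (neg_le_of_abs_le hy1)
        (le_of_abs_le hy1)])
    rw [← hHinv h, hh, hh']
  have e5 : ∀ θ φ, H (γ₀ 0) (γ₀ θ) = H (γ₀ φ) (γ₀ (φ + θ)) := by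
    intro θ φ
    obtain ⟨h, hh, hh'⟩ := hpair (γ₀ 0) (γ₀ θ) (γ₀ φ) (γ₀ (φ + θ)) (by
      rw [hγ₀i, hγ₀i]; congr 1; ring)
    rw [← hHinv h, hh, hh']
  rw [e2]
  simp only [e3]
  rw [lintegral_const, mul_comm]
  congr 1
  rw [lintegral_congr e4]
  rw [lintegral_zonal N (ψ := fun t => H (γ₀ 0) (γ₀ (Real.arccos t)))
    (hH.comp (measurable_const.prodMk (hγm.comp Real.measurable_arccos)))]
  congr 1
  refine setLIntegral_congr_fun measurableSet_Ioo fun θ hθ => ?_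
  rw [Real.arccos_cos hθ.1.le hθ.2.le]
  congr 1
  rw [lintegral_const_mul, lintegral_lintegral_swap]
  · change _ = _ * ∫⁻ φ in _, H (γ₀ φ) (γ₀ (φ + θ))
    simp only [← e5 θ]
    rw [lintegral_const, mul_left_comm]
    simp only [Measure.restrict_apply MeasurableSet.univ, Set.univ_inter, Real.volume_Ioc]
    rw [← ENNReal.ofReal_mul (by positivity)]
    have : 1 / (2 * Real.pi) * (2 * Real.pi - 0) = 1 := by
      rw [sub_zero]; field_simp
    rw [this]; simp
  · exact (hFa.comp ((((hγm.comp measurable_snd).prodMk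
      (hγm.comp (measurable_snd.add_const θ)))).prodMk measurable_fst)).aemeasurable
  · refine Measurable.lintegral_prod_right' (f := fun p : G × ℝ => F (act p.1 (γ₀ p.2))
      (act p.1 (γ₀ (p.2 + θ)))) ?_
    exact (hFa.comp ((((hγm.comp measurable_snd).prodMk
      (hγm.comp (measurable_snd.add_const θ)))).prodMk measurable_fst))

end Averaging

section FejerJackson

open Real Finset

/-- The partial sums of the Fourier series of the sawtooth function. -/
noncomputable def sawtoothSum (m : ℕ) (θ : ℝ) : ℝ :=
  ∑ j ∈ range m, sin ((j + 1) * θ) / (j + 1)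

/-- The derivative of `sawtoothSum m`. -/
noncomputable def cosSum (m : ℕ) (θ : ℝ) : ℝ := ∑ j ∈ range m, cos ((j + 1) * θ)

theorem hasDerivAt_sawtoothSum (m : ℕ) (θ : ℝ) :
    HasDerivAt (sawtoothSum m) (cosSum m θ) θ := by
  unfold sawtoothSum cosSum
  refine HasDerivAt.fun_sum fun j _ => ?_
  have h : (j : ℝ) + 1 ≠ 0 := by positivity
  have h' := (((hasDerivAt_id' θ).const_mul ((j : ℝ) + 1)).sin).div_const ((j : ℝ) + 1)
  exact h'.congr_deriv (by field_simp)

theorem two_sin_half_mul_cosSum (m : ℕ) (θ : ℝ) :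
    2 * sin (θ / 2) * cosSum m θ = sin ((m + 1 / 2) * θ) - sin (θ / 2) := by
  induction m with
  | zero => simp [cosSum]; ring_nf
  | succ m ih =>
    have h1 : cosSum (m + 1) θ = cosSum m θ + cos ((m + 1) * θ) := by
      simp [cosSum, sum_range_succ]
    have h2 : sin (((m : ℝ) + 1) * θ + θ / 2) = _ := sin_add _ _
    have h3 : sin (((m : ℝ) + 1) * θ - θ / 2) = _ := sin_sub _ _
    have h4 : (((m + 1 : ℕ) : ℝ) + 1 / 2) * θ = ((m : ℝ) + 1) * θ + θ / 2 := by push_cast; ring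
    have h5 : ((m : ℝ) + 1 / 2) * θ = ((m : ℝ) + 1) * θ - θ / 2 := by ring
    rw [h1, mul_add, ih, h4, h5, h2, h3]; ring

theorem sawtoothSum_zero_right (m : ℕ) : sawtoothSum m 0 = 0 := by simp [sawtoothSum]

theorem sawtoothSum_pi (m : ℕ) : sawtoothSum m π = 0 := by
  refine sum_eq_zero fun j _ => ?_
  have := sin_nat_mul_pi (j + 1)
  push_cast at this
  rw [this, zero_div]

/-- The Fejér–Jackson inequality. -/
theorem sawtoothSum_nonneg (m : ℕ) : ∀ θ ∈ Set.Icc 0 π, 0 ≤ sawtoothSum m θ := by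
  induction m with
  | zero => simp [sawtoothSum]
  | succ m ih =>
    obtain ⟨t, ht, hmin⟩ := isCompact_Icc.exists_isMinOn (Set.nonempty_Icc.2 pi_pos.le)
      (fun θ _ => (hasDerivAt_sawtoothSum (m + 1) θ).continuousAt.continuousWithinAt)
    refine fun θ hθ => le_trans ?_ (hmin hθ)
    by_contra! hneg
    have h0 : t ≠ 0 := by rintro rfl; simp [sawtoothSum_zero_right] at hneg
    have hpi : t ≠ π := by rintro rfl; simp [sawtoothSum_pi] at hneg
    have ht' : t ∈ Set.Ioo 0 π := ⟨lt_of_le_of_ne ht.1 h0.symm, lt_of_le_of_ne ht.2 hpi⟩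
    have hd : cosSum (m + 1) t = 0 :=
      (hmin.isLocalMin (Icc_mem_nhds ht'.1 ht'.2)).hasDerivAt_eq_zero
        (hasDerivAt_sawtoothSum (m + 1) t)
    have h1 := two_sin_half_mul_cosSum (m + 1) t
    rw [hd, mul_zero] at h1
    set b : ℝ := (((m + 1 : ℕ) : ℝ) + 1 / 2) * t with hb
    have hs : sin b = sin (t / 2) := by linarith
    have h2 : ((m : ℝ) + 1) * t = b - t / 2 := by rw [hb]; push_cast; ring
    have hc : 0 ≤ cos (t / 2) := cos_nonneg_of_mem_Icc
      ⟨by linarith [ht.1, pi_pos], by linarith [ht.2]⟩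
    have hsn : 0 ≤ sin (t / 2) := sin_nonneg_of_nonneg_of_le_pi (by linarith [ht.1])
      (by linarith [ht.2, pi_pos])
    have hcb : cos b ≤ cos (t / 2) := by
      refine le_of_sq_le_sq ?_ hc
      nlinarith [sin_sq_add_cos_sq b, sin_sq_add_cos_sq (t / 2)]
    have h3 : 0 ≤ sin ((m + 1) * t) := by
      rw [h2, sin_sub, hs]
      nlinarith
    have h4 : sawtoothSum (m + 1) t = sawtoothSum m t + sin ((m + 1) * t) / (m + 1) := by
      simp [sawtoothSum, sum_range_succ]
    rw [h4] at hneg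
    have := ih t ht
    have : 0 ≤ sin ((m + 1) * t) / (m + 1) := by positivity
    linarith

/-- The Dirichlet kernel. -/
noncomputable def dirichletSum (m : ℕ) (θ : ℝ) : ℝ := 1 + 2 * cosSum m θ

theorem one_sub_cos_nat_mul (m : ℕ) (θ : ℝ) :
    1 - cos (m * θ) = (1 - cos θ) * ∑ i ∈ range m, dirichletSum i θ := by
  have key : ∀ m : ℕ, (1 - cos θ) * dirichletSum m θ = cos (m * θ) - cos ((m + 1) * θ) := by
    intro m
    have h := two_sin_half_mul_cosSum m θ
    have h1 : 1 - cos θ = 2 * sin (θ / 2) ^ 2 := by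
      have := cos_sq_add_sin_sq (θ / 2)
      have h2 := cos_two_mul (θ / 2)
      rw [mul_div_cancel₀ _ two_ne_zero] at h2
      linarith
    have h2 : (m : ℝ) * θ = (m + 1 / 2) * θ - θ / 2 := by ring
    have h3 : ((m : ℝ) + 1) * θ = (m + 1 / 2) * θ + θ / 2 := by ring
    rw [h1, dirichletSum, h2, h3, cos_sub, cos_add]
    linear_combination 2 * sin (θ / 2) * h
  induction m with
  | zero => simp
  | succ m ih =>
    rw [sum_range_succ, mul_add, ← ih, key]
    push_cast; ring

end FejerJackson

section ChordKernel

open Real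

variable {N : ℕ} {s : ℝ}

/-- The kernel `|x - y|^(2 - n - s) sin^(n-2) θ` in terms of the angle `θ` between `x` and `y`
on the unit sphere of `ℝⁿ`, `n = N + 2`, up to a constant factor. -/
noncomputable def chordKernel (N : ℕ) (s θ : ℝ) : ℝ :=
  (2 * sin (θ / 2)) ^ (-s) * cos (θ / 2) ^ N

theorem sin_half_pos {θ : ℝ} (h : θ ∈ Set.Ioo 0 π) : 0 < sin (θ / 2) :=
  sin_pos_of_pos_of_lt_pi (by linarith [h.1]) (by linarith [h.2, pi_pos])

theorem cos_half_pos {θ : ℝ} (h : θ ∈ Set.Ioo 0 π) : 0 < cos (θ / 2) :=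
  cos_pos_of_mem_Ioo ⟨by linarith [h.1, pi_pos], by linarith [h.2]⟩

theorem chordKernel_pos {θ : ℝ} (h : θ ∈ Set.Ioo 0 π) : 0 < chordKernel N s θ := by
  have := sin_half_pos h
  have := cos_half_pos h
  unfold chordKernel; positivity

theorem two_sub_two_cos (θ : ℝ) : 2 - 2 * cos θ = (2 * sin (θ / 2)) ^ 2 := by
  have h1 := cos_sq_add_sin_sq (θ / 2)
  have h2 := cos_two_mul (θ / 2)
  rw [mul_div_cancel₀ _ two_ne_zero] at h2
  linear_combination -2 * h2 - 4 * h1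

theorem sin_eq_two_mul_half (θ : ℝ) : sin θ = 2 * sin (θ / 2) * cos (θ / 2) := by
  rw [← sin_two_mul, mul_div_cancel₀ _ two_ne_zero]

theorem sin_pow_mul_chord_rpow {θ : ℝ} (h : θ ∈ Set.Ioo 0 π) :
    sin θ ^ N * (2 * sin (θ / 2)) ^ (-(((N + 2 : ℕ) : ℝ) + s)) * (2 - 2 * cos θ)
      = chordKernel N s θ := by
  have h1 := sin_half_pos h
  have h2 : 0 < 2 * sin (θ / 2) := by positivity
  rw [two_sub_two_cos, chordKernel, sin_eq_two_mul_half θ, ← rpow_natCast (2 * sin (θ / 2)) 2]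
  rw [mul_pow, ← rpow_natCast (2 * sin (θ / 2)) N]
  have : (2 * sin (θ / 2)) ^ (-s) = (2 * sin (θ / 2)) ^ (N : ℝ)
      * (2 * sin (θ / 2)) ^ (-(((N + 2 : ℕ) : ℝ) + s)) * (2 * sin (θ / 2)) ^ ((2 : ℕ) : ℝ) := by
    rw [← rpow_add h2, ← rpow_add h2]
    congr 1; push_cast; ring
  rw [this]; ring

theorem chordKernel_le {θ : ℝ} (hs : 0 ≤ s) (h : θ ∈ Set.Ioo 0 π) :
    chordKernel N s θ ≤ (2 / π) ^ (-s) * θ ^ (-s) := by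
  have h1 : θ / π ≤ sin (θ / 2) := by
    have := mul_le_sin (x := θ / 2) (by linarith [h.1]) (by linarith [h.2])
    refine le_of_eq_of_le ?_ this
    field_simp
  have hpos : 0 < θ / π := div_pos h.1 pi_pos
  have hc := cos_half_pos h
  calc chordKernel N s θ ≤ (2 * sin (θ / 2)) ^ (-s) * 1 := by
        unfold chordKernel
        gcongr
        · have := sin_half_pos h; positivity
        · exact pow_le_one₀ hc.le (cos_le_one _)
    _ ≤ (2 * (θ / π)) ^ (-s) := by
        rw [mul_one]
        exact rpow_le_rpow_of_nonpos (by positivity) (by linarith) (by linarith)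
    _ = (2 / π) ^ (-s) * θ ^ (-s) := by
        rw [← mul_rpow (by positivity) h.1.le]; congr 1; ring

theorem measurable_chordKernel : Measurable (chordKernel N s) := by
  unfold chordKernel; fun_prop

theorem intervalIntegrable_chordKernel (hs : s ∈ Set.Ioo 0 1) :
    IntervalIntegrable (chordKernel N s) volume 0 π := by
  have h : IntervalIntegrable (fun θ : ℝ => (2 / π) ^ (-s) * θ ^ (-s)) volume 0 π :=
    (intervalIntegral.intervalIntegrable_rpow' (by linarith [hs.2])).const_mul _
  refine h.mono_fun' measurable_chordKernel.aestronglyMeasurable ?_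
  rw [Set.uIoc_of_le pi_pos.le, ← restrict_Ioo_eq_restrict_Ioc]
  refine (ae_restrict_iff' measurableSet_Ioo).2 (.of_forall fun θ hθ => ?_)
  dsimp only
  rw [norm_of_nonneg (chordKernel_pos hθ).le]
  exact chordKernel_le hs.1.le hθ

theorem integral_chordKernel_pos (hs : s ∈ Set.Ioo 0 1) :
    0 < ∫ θ in 0..π, chordKernel N s θ :=
  intervalIntegral.intervalIntegral_pos_of_pos_on (intervalIntegrable_chordKernel hs)
    (fun _ h => chordKernel_pos h) pi_pos

theorem intervalIntegrable_chordKernel_mul (hs : s ∈ Set.Ioo 0 1) {f : ℝ → ℝ}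
    (hf : Continuous f) : IntervalIntegrable (fun θ => chordKernel N s θ * f θ) volume 0 π :=
  (intervalIntegrable_chordKernel hs).mul_continuousOn hf.continuousOn

theorem hasDerivAt_chordKernel {θ : ℝ} (h : θ ∈ Set.Ioo 0 π) :
    HasDerivAt (chordKernel N s)
      (cos (θ / 2) * (-s) * (2 * sin (θ / 2)) ^ (-s - 1) * cos (θ / 2) ^ N +
        (2 * sin (θ / 2)) ^ (-s) * (N * cos (θ / 2) ^ (N - 1) * (-sin (θ / 2) * (1 / 2)))) θ := by
  have h0 : HasDerivAt (fun θ : ℝ => θ / 2) (1 / 2) θ := (hasDerivAt_id' θ).div_const 2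
  have h1 : HasDerivAt (fun θ : ℝ => 2 * sin (θ / 2)) (cos (θ / 2)) θ :=
    (h0.sin.const_mul 2).congr_deriv (by ring)
  have h2 := h1.rpow_const (p := -s) (Or.inl (by have := sin_half_pos h; positivity))
  exact h2.mul (h0.cos.pow N)

theorem continuous_cosSum (m : ℕ) : Continuous (cosSum m) := by
  unfold cosSum; fun_prop

theorem continuous_sawtoothSum (m : ℕ) : Continuous (sawtoothSum m) := by
  unfold sawtoothSum; fun_prop

theorem abs_sawtoothSum_le (m : ℕ) (θ : ℝ) (hθ : 0 ≤ θ) : |sawtoothSum m θ| ≤ m * θ := by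
  refine (Finset.abs_sum_le_sum_abs _ _).trans ?_
  have : ∀ j ∈ Finset.range m, |sin ((j + 1) * θ) / (j + 1)| ≤ θ := by
    intro j _
    have hj : (0 : ℝ) < j + 1 := by positivity
    rw [abs_div, abs_of_pos hj, div_le_iff₀ hj]
    calc |sin ((j + 1) * θ)| ≤ |(j + 1) * θ| := abs_sin_le_abs
      _ = θ * (j + 1) := by rw [abs_of_nonneg (by positivity), mul_comm]
  refine (Finset.sum_le_sum this).trans ?_
  simp

theorem integral_chordKernel_mul_cosSum_nonneg (hs : s ∈ Set.Ioo 0 1) (m : ℕ) :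
    0 ≤ ∫ θ in 0..π, chordKernel N s θ * cosSum m θ := by
  have hcont : ContinuousOn (fun θ => chordKernel N s θ * sawtoothSum m θ) (Set.Icc 0 π) := by
    intro θ hθ
    rcases eq_or_lt_of_le hθ.1 with rfl | h0
    · have hlim : Filter.Tendsto (fun θ : ℝ => (2 / π) ^ (-s) * m * θ ^ (1 - s))
          (nhdsWithin 0 (Set.Icc 0 π)) (nhds 0) := by
        have : Continuous fun θ : ℝ => (2 / π) ^ (-s) * m * θ ^ (1 - s) :=
          continuous_const.mul (continuous_id.rpow_const fun _ => Or.inr (by linarith [hs.2]))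
        have h := this.tendsto 0
        rw [zero_rpow (by linarith [hs.2]), mul_zero] at h
        exact h.mono_left nhdsWithin_le_nhds
      rw [ContinuousWithinAt, sawtoothSum_zero_right, mul_zero]
      refine squeeze_zero_norm' ?_ hlim
      have hlt : Set.Iio π ∈ nhds (0 : ℝ) := Iio_mem_nhds pi_pos
      filter_upwards [self_mem_nhdsWithin, mem_nhdsWithin_of_mem_nhds hlt] with θ hθ hθ'
      rcases eq_or_lt_of_le hθ.1 with rfl | h0
      · simp [sawtoothSum_zero_right]
        positivity
      · rw [norm_mul, norm_of_nonneg (chordKernel_pos ⟨h0, hθ'⟩).le]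
        calc chordKernel N s θ * ‖sawtoothSum m θ‖
            ≤ ((2 / π) ^ (-s) * θ ^ (-s)) * (m * θ) := by
              gcongr
              · exact chordKernel_le hs.1.le ⟨h0, hθ'⟩
              · exact abs_sawtoothSum_le m θ h0.le
          _ = (2 / π) ^ (-s) * m * θ ^ (1 - s) := by
              rw [show 1 - s = -s + 1 by ring, rpow_add_one h0.ne']; ring
    · refine ContinuousAt.continuousWithinAt ?_
      refine ContinuousAt.mul ?_ (continuous_sawtoothSum m).continuousAt
      unfold chordKernel
      refine ContinuousAt.mul (ContinuousAt.rpow_const (by fun_prop) (Or.inl ?_)) (by fun_prop)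
      have : 0 < sin (θ / 2) := sin_pos_of_pos_of_lt_pi (by linarith) (by linarith [hθ.2, pi_pos])
      positivity
  have hder : ∀ θ ∈ Set.Ioo 0 π, HasDerivWithinAt (fun θ => chordKernel N s θ * sawtoothSum m θ) _
      (Set.Ioi θ) θ := fun θ hθ =>
    ((hasDerivAt_chordKernel (N := N) (s := s) hθ).mul
      (hasDerivAt_sawtoothSum m θ)).hasDerivWithinAt
  have := intervalIntegral.sub_le_integral_of_hasDeriv_right_of_le pi_pos.le hcont hder
    (φ := fun θ => chordKernel N s θ * cosSum m θ) ?_ ?_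
  · simpa [sawtoothSum_zero_right, sawtoothSum_pi] using this
  · rw [integrableOn_Icc_iff_integrableOn_Ioc]
    exact (intervalIntegrable_iff_integrableOn_Ioc_of_le pi_pos.le).1
      (intervalIntegrable_chordKernel_mul hs (continuous_cosSum m))
  · intro θ hθ
    have h1 := sin_half_pos hθ
    have h2 := cos_half_pos hθ
    have h3 := sawtoothSum_nonneg m θ ⟨hθ.1.le, hθ.2.le⟩
    have h4 : cos (θ / 2) * (-s) * (2 * sin (θ / 2)) ^ (-s - 1) * cos (θ / 2) ^ N +
        (2 * sin (θ / 2)) ^ (-s) * (N * cos (θ / 2) ^ (N - 1) * (-sin (θ / 2) * (1 / 2))) ≤ 0 := by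
      have a1 : 0 ≤ cos (θ / 2) * s * (2 * sin (θ / 2)) ^ (-s - 1) * cos (θ / 2) ^ N := by
        have := hs.1; positivity
      have a2 : 0 ≤ (2 * sin (θ / 2)) ^ (-s) * (N * cos (θ / 2) ^ (N - 1) *
        (sin (θ / 2) * (1 / 2))) := by
        positivity
      linarith
    nlinarith [mul_nonneg (neg_nonneg.2 h4) h3]

theorem le_integral_chordKernel_mul_sum_dirichletSum (hs : s ∈ Set.Ioo 0 1) (m : ℕ) :
    m * ∫ θ in 0..π, chordKernel N s θ
      ≤ ∫ θ in 0..π, chordKernel N s θ * ∑ i ∈ Finset.range m, dirichletSum i θ := by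
  have hc : ∀ i, Continuous (dirichletSum i) := fun i => by
    unfold dirichletSum; exact continuous_const.add (continuous_const.mul (continuous_cosSum i))
  simp only [Finset.mul_sum]
  rw [intervalIntegral.integral_finsetSum fun i _ => intervalIntegrable_chordKernel_mul hs (hc i)]
  rw [← nsmul_eq_mul, ← Finset.card_range m, ← Finset.sum_const, Finset.card_range]
  refine Finset.sum_le_sum fun i _ => ?_
  have h := integral_chordKernel_mul_cosSum_nonneg (N := N) hs i
  have e : (fun θ => chordKernel N s θ * dirichletSum i θ)
      = fun θ => chordKernel N s θ + 2 * (chordKernel N s θ * cosSum i θ) := by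
    ext θ; rw [dirichletSum]; ring
  rw [e, intervalIntegral.integral_add (intervalIntegrable_chordKernel hs)
    ((intervalIntegrable_chordKernel_mul hs (continuous_cosSum i)).const_mul 2),
    intervalIntegral.integral_const_mul]
  linarith

end ChordKernel

section Multiplier

open Real

/-- The cosine moments of `sin ^ N`. -/
noncomputable def cosMoment (N m : ℕ) : ℝ := ∫ θ in 0..π, cos (m * θ) * sin θ ^ N

variable {N : ℕ} {s : ℝ}

theorem cosMoment_zero_pos : 0 < cosMoment N 0 := by
  simpa [cosMoment] using integral_sin_pow_pos (n := N)

theorem cosMoment_one : cosMoment N 1 = 0 := by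
  have h : ∀ θ ∈ Set.uIcc 0 π, HasDerivAt (fun θ => sin θ ^ (N + 1) / (N + 1))
      (cos θ * sin θ ^ N) θ := by
    intro θ _
    refine (((hasDerivAt_sin θ).pow (N + 1)).div_const _).congr_deriv ?_
    push_cast
    field_simp
  have := intervalIntegral.integral_eq_sub_of_hasDerivAt h
    (Continuous.intervalIntegrable (by fun_prop) _ _)
  simpa [cosMoment] using this

theorem cosMoment_add_two (m : ℕ) :
    (N + m + 2) * cosMoment N (m + 2) = (m - N) * cosMoment N m := by
  have h : ∀ θ ∈ Set.uIcc 0 π, HasDerivAt (fun θ => sin θ ^ (N + 1) * cos ((m + 1) * θ))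
      ((N + m + 2) / 2 * (cos ((m + 2 : ℕ) * θ) * sin θ ^ N)
        - (m - N) / 2 * (cos (m * θ) * sin θ ^ N)) θ := by
    intro θ _
    have h1 := ((hasDerivAt_id' θ).const_mul ((m : ℝ) + 1)).cos
    refine (((hasDerivAt_sin θ).pow (N + 1)).mul h1).congr_deriv ?_
    have e1 : ((m + 2 : ℕ) : ℝ) * θ = (m + 1) * θ + θ := by push_cast; ring
    have e2 : (m : ℝ) * θ = (m + 1) * θ - θ := by ring
    rw [e1, e2, cos_add, cos_sub, Nat.add_sub_cancel]
    push_cast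
    simp only [Pi.pow_apply]
    ring
  have := intervalIntegral.integral_eq_sub_of_hasDerivAt h
    (Continuous.intervalIntegrable (by fun_prop) _ _)
  rw [intervalIntegral.integral_sub (Continuous.intervalIntegrable (by fun_prop) _ _)
    (Continuous.intervalIntegrable (by fun_prop) _ _), intervalIntegral.integral_const_mul,
    intervalIntegral.integral_const_mul] at this
  simp only [sin_pi, sin_zero, ne_eq, Nat.add_eq_zero_iff, one_ne_zero, and_false,
    not_false_eq_true, zero_pow, zero_mul, sub_zero] at this
  simp only [cosMoment]
  linarith

theorem abs_cosMoment_le (m : ℕ) :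
    |cosMoment N (m + 2)| ≤ N / (N + 2) * cosMoment N 0 := by
  have hpos := cosMoment_zero_pos (N := N)
  induction m using Nat.twoStepInduction with
  | zero =>
    have h := cosMoment_add_two (N := N) 0
    have e : cosMoment N (0 + 2) = - (N / (N + 2) * cosMoment N 0) := by
      push_cast at h
      field_simp
      linarith
    rw [e, abs_neg, abs_of_nonneg (by positivity)]
  | one =>
    have h := cosMoment_add_two (N := N) 1
    rw [cosMoment_one, mul_zero] at h
    have e : cosMoment N (1 + 2) = 0 := by
      have : (N : ℝ) + (1 : ℕ) + 2 ≠ 0 := by positivity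
      exact (mul_eq_zero.1 h).resolve_left this
    rw [e, abs_zero]; positivity
  | more m ih _ =>
    have h := cosMoment_add_two (N := N) (m + 2)
    have h0 : (0 : ℝ) < N + (m + 2 : ℕ) + 2 := by positivity
    refine le_trans ?_ ih
    have h1 : |(((m + 2 : ℕ) : ℝ) - N)| ≤ N + (m + 2 : ℕ) + 2 := by
      rw [abs_le]; constructor <;> push_cast <;> linarith
        [(Nat.cast_nonneg N : (0 : ℝ) ≤ N), (Nat.cast_nonneg m : (0 : ℝ) ≤ m)]
    have h2 := congrArg abs h
    rw [abs_mul, abs_mul, abs_of_pos h0] at h2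
    refine le_of_mul_le_mul_left ?_ h0
    rw [h2]
    gcongr

/-- The cosine moments of `cos θ * sin θ ^ N`. -/
noncomputable def cosCosMoment (N m : ℕ) : ℝ := ∫ θ in 0..π, cos θ * cos (m * θ) * sin θ ^ N

theorem cosCosMoment_zero : cosCosMoment N 0 = 0 := by
  simpa [cosMoment, cosCosMoment] using cosMoment_one (N := N)

theorem cosCosMoment_one : cosCosMoment N 1 = cosMoment N 0 / (N + 2) := by
  have h := cosMoment_add_two (N := N) 0
  have h1 : cosCosMoment N 1 = (cosMoment N 2 + cosMoment N 0) / 2 := by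
    rw [cosMoment, cosMoment, ← intervalIntegral.integral_add
      (Continuous.intervalIntegrable (by fun_prop) _ _)
      (Continuous.intervalIntegrable (by fun_prop) _ _), ← intervalIntegral.integral_div]
    refine intervalIntegral.integral_congr fun θ _ => ?_
    simp [cos_two_mul]; ring
  rw [h1]
  push_cast at h
  simp only [add_zero, zero_sub] at h
  field_simp
  linarith

theorem abs_cosCosMoment_le (m : ℕ) : |cosCosMoment N m| ≤ cosMoment N 0 := by
  rw [← Real.norm_eq_abs, cosMoment]
  refine intervalIntegral.norm_integral_le_of_norm_le pi_pos.le ?_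
    (Continuous.intervalIntegrable (by fun_prop) _ _)
  refine .of_forall fun θ hθ => ?_
  have h := sin_nonneg_of_nonneg_of_le_pi hθ.1.le hθ.2
  rw [norm_mul, norm_mul, norm_of_nonneg (pow_nonneg h N)]
  simp only [Nat.cast_zero, zero_mul, cos_zero, norm_eq_abs]
  gcongr
  exact mul_le_one₀ (abs_cos_le_one _) (abs_nonneg _) (abs_cos_le_one _)

/-- The total mass of the chord kernel. -/
noncomputable def chordMass (N : ℕ) (s : ℝ) : ℝ := ∫ θ in 0..π, chordKernel N s θ

/-- The gain of the second eigenvalue over the first one used in the spectral inequality. -/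
noncomputable def spectralGain (N : ℕ) : ℝ := 1 / (2 * (N + 2) ^ 2)

/-- The kernel, as a function of `⟪x, y⟫`, that compensates for the spherical harmonics of
degree at most one. -/
noncomputable def lowKernel (N : ℕ) (s t : ℝ) : ℝ :=
  chordMass N s / (2 * cosMoment N 0) *
    (1 + spectralGain N + spectralGain N * (N + 2) * t)

theorem spectralGain_pos : 0 < spectralGain N := by unfold spectralGain; positivity

theorem spectralGain_mul_le : spectralGain N * (N + 2) ≤ 1 := by
  unfold spectralGain
  rw [div_mul_eq_mul_div, div_le_one (by positivity)]
  nlinarith [(Nat.cast_nonneg N : (0 : ℝ) ≤ N)]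

theorem chordMass_pos (hs : s ∈ Set.Ioo 0 1) : 0 < chordMass N s := integral_chordKernel_pos hs

theorem lowKernel_nonneg (hs : s ∈ Set.Ioo 0 1) {t : ℝ} (ht : -1 ≤ t) : 0 ≤ lowKernel N s t := by
  have h1 := chordMass_pos (N := N) hs
  have h2 := cosMoment_zero_pos (N := N)
  have h3 := spectralGain_pos (N := N)
  have h4 := spectralGain_mul_le (N := N)
  have h5 : 0 ≤ spectralGain N * (N + 2) * (t + 1) := by
    have : 0 ≤ t + 1 := by linarith
    positivity
  exact mul_nonneg (by positivity) (by linarith)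

theorem spectral_inequality_aux (hs : s ∈ Set.Ioo 0 1) (m : ℕ) :
    (1 + spectralGain N) * chordMass N s ≤
      (∫ θ in 0..π, chordKernel N s θ * ∑ i ∈ Finset.range m, dirichletSum i θ)
      + chordMass N s / cosMoment N 0 * ((1 + spectralGain N) * cosMoment N m
        + spectralGain N * (N + 2) * cosCosMoment N m) := by
  have h1 := chordMass_pos (N := N) hs
  have h2 := cosMoment_zero_pos (N := N)
  have h3 := spectralGain_pos (N := N)
  have h4 := le_integral_chordKernel_mul_sum_dirichletSum (N := N) hs m
  rw [← chordMass] at h4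
  have h5 : 0 < chordMass N s / cosMoment N 0 := by positivity
  match m with
  | 0 =>
    rw [cosCosMoment_zero]
    simp
    field_simp
    exact le_rfl
  | 1 =>
    rw [cosMoment_one, cosCosMoment_one]
    push_cast at h4
    have : chordMass N s / cosMoment N 0 * ((1 + spectralGain N) * 0 +
        spectralGain N * (N + 2) * (cosMoment N 0 / (N + 2))) = spectralGain N * chordMass N s := by
      field_simp; ring
    linarith
  | m + 2 =>
    have h6 := neg_le_of_abs_le (abs_cosMoment_le (N := N) m)
    have h7 := neg_le_of_abs_le (abs_cosCosMoment_le (N := N) (m + 2))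
    have h8 : 2 * chordMass N s ≤ ((m + 2 : ℕ) : ℝ) * chordMass N s := by
      gcongr; push_cast; linarith [(Nat.cast_nonneg m : (0 : ℝ) ≤ m)]
    have h9 : -((1 + spectralGain N) * (N / (N + 2)) + spectralGain N * (N + 2)) * cosMoment N 0
        ≤ (1 + spectralGain N) * cosMoment N (m + 2)
        + spectralGain N * (N + 2) * cosCosMoment N (m + 2) := by
      have a1 := mul_le_mul_of_nonneg_left h6 (by positivity : 0 ≤ 1 + spectralGain N)
      have a2 := mul_le_mul_of_nonneg_left h7 (by positivity : 0 ≤ spectralGain N * (N + 2))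
      linarith
    have h10 := mul_le_mul_of_nonneg_left h9 h5.le
    have h11 : chordMass N s / cosMoment N 0 *
        (-((1 + spectralGain N) * (N / (N + 2)) + spectralGain N * (N + 2)) * cosMoment N 0)
        = -((1 + spectralGain N) * (N / (N + 2)) + spectralGain N * (N + 2)) * chordMass N s := by
      field_simp
    have h12 : (1 + spectralGain N) * (N / (N + 2)) + spectralGain N * (N + 2)
        ≤ 1 - spectralGain N := by
      unfold spectralGain
      have : (0 : ℝ) ≤ N := Nat.cast_nonneg N
      field_simp
      nlinarith [pow_nonneg this 2, pow_nonneg this 3]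
    have h13 := mul_le_mul_of_nonneg_right h12 h1.le
    linarith

theorem measurable_lowKernel : Measurable (lowKernel N s) := by
  unfold lowKernel; fun_prop

theorem spectral_inequality (hs : s ∈ Set.Ioo 0 1) (m : ℕ) :
    ∫⁻ θ in Set.Ioo 0 π, ENNReal.ofReal (sin θ ^ N) *
        (ENNReal.ofReal (lowKernel N s (cos θ)) * ENNReal.ofReal (2 - 2 * cos (m * θ)))
    ≤ ∫⁻ θ in Set.Ioo 0 π, ENNReal.ofReal (sin θ ^ N) *
        (ENNReal.ofReal ((2 * sin (θ / 2)) ^ (-(((N + 2 : ℕ) : ℝ) + s)))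
          * ENNReal.ofReal (2 - 2 * cos (m * θ))) := by
  have hlow : Continuous (lowKernel N s) := by unfold lowKernel; fun_prop
  have hpi : (0 : ℝ) ≤ π := pi_pos.le
  have hc : ∀ i, Continuous (dirichletSum i) := fun i => by
    unfold dirichletSum; exact continuous_const.add (continuous_const.mul (continuous_cosSum i))
  have hcs : Continuous fun θ => ∑ i ∈ Finset.range m, dirichletSum i θ := by fun_prop
  have hnn : ∀ θ : ℝ, 0 ≤ 2 - 2 * cos (m * θ) := fun θ => by linarith [cos_le_one (m * θ)]
  have e1 : ∫⁻ θ in Set.Ioo 0 π, ENNReal.ofReal (sin θ ^ N) *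
        (ENNReal.ofReal (lowKernel N s (cos θ)) * ENNReal.ofReal (2 - 2 * cos (m * θ)))
      = ENNReal.ofReal (∫ θ in 0..π, sin θ ^ N * (lowKernel N s (cos θ) *
          (2 - 2 * cos (m * θ)))) := by
    rw [intervalIntegral.integral_of_le hpi, integral_Ioc_eq_integral_Ioo,
      ofReal_integral_eq_lintegral_ofReal]
    · refine setLIntegral_congr_fun measurableSet_Ioo fun θ hθ => ?_
      have a1 := (sin_pos_of_pos_of_lt_pi hθ.1 hθ.2).le
      have a2 := lowKernel_nonneg (N := N) hs (neg_one_le_cos θ)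
      rw [ENNReal.ofReal_mul (by positivity), ENNReal.ofReal_mul a2]
    · exact (Continuous.integrableOn_Icc (by fun_prop)).mono_set Set.Ioo_subset_Icc_self
    · refine (ae_restrict_iff' measurableSet_Ioo).2 (.of_forall fun θ hθ => ?_)
      have a1 := (sin_pos_of_pos_of_lt_pi hθ.1 hθ.2).le
      have a2 := lowKernel_nonneg (N := N) hs (neg_one_le_cos θ)
      have a3 := hnn θ
      simp only [Pi.zero_apply]
      positivity
  have e2 : ∫⁻ θ in Set.Ioo 0 π, ENNReal.ofReal (sin θ ^ N) *
        (ENNReal.ofReal ((2 * sin (θ / 2)) ^ (-(((N + 2 : ℕ) : ℝ) + s)))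
          * ENNReal.ofReal (2 - 2 * cos (m * θ)))
      = ENNReal.ofReal (∫ θ in 0..π, chordKernel N s θ *
          ∑ i ∈ Finset.range m, dirichletSum i θ) := by
    rw [intervalIntegral.integral_of_le hpi, integral_Ioc_eq_integral_Ioo,
      ofReal_integral_eq_lintegral_ofReal]
    · refine setLIntegral_congr_fun measurableSet_Ioo fun θ hθ => ?_
      have a1 := (sin_pos_of_pos_of_lt_pi hθ.1 hθ.2).le
      have a2 := sin_half_pos hθ
      rw [← ENNReal.ofReal_mul (by positivity), ← ENNReal.ofReal_mul (by positivity),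
        ← sin_pow_mul_chord_rpow hθ]
      congr 1
      linear_combination 2 * (sin θ ^ N * (2 * sin (θ / 2)) ^ (-(((N + 2 : ℕ) : ℝ) + s))) *
        one_sub_cos_nat_mul m θ
    · have := intervalIntegrable_chordKernel_mul (N := N) hs hcs
      exact ((intervalIntegrable_iff_integrableOn_Ioc_of_le hpi).1 this).mono_set
        Set.Ioo_subset_Ioc_self
    · refine (ae_restrict_iff' measurableSet_Ioo).2 (.of_forall fun θ hθ => ?_)
      have a1 : 0 < 2 - 2 * cos θ := by
        rw [two_sub_two_cos]; have := sin_half_pos hθ; positivity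
      have a2 := one_sub_cos_nat_mul m θ
      have a3 : 0 ≤ ∑ i ∈ Finset.range m, dirichletSum i θ := by
        refine le_of_mul_le_mul_left ?_ a1
        nlinarith [hnn θ]
      exact mul_nonneg (chordKernel_pos hθ).le a3
  have e3 : ∫ θ in 0..π, sin θ ^ N * (lowKernel N s (cos θ) * (2 - 2 * cos (m * θ)))
      = (1 + spectralGain N) * chordMass N s -
        chordMass N s / cosMoment N 0 * ((1 + spectralGain N) * cosMoment N m
        + spectralGain N * (N + 2) * cosCosMoment N m) := by
    have h2 := cosMoment_zero_pos (N := N)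
    have i0 : ∫ θ in 0..π, cos ((0 : ℕ) * θ) * sin θ ^ N = cosMoment N 0 := rfl
    have i1 : ∫ θ in 0..π, cos ((1 : ℕ) * θ) * sin θ ^ N = 0 := cosMoment_one
    have i2 : ∫ θ in 0..π, cos (m * θ) * sin θ ^ N = cosMoment N m := rfl
    have i3 : ∫ θ in 0..π, cos θ * cos (m * θ) * sin θ ^ N = cosCosMoment N m := rfl
    have : ∀ θ, sin θ ^ N * (lowKernel N s (cos θ) * (2 - 2 * cos (m * θ)))
      = chordMass N s / cosMoment N 0 * ((1 + spectralGain N) * (cos ((0 : ℕ) * θ) * sin θ ^ N)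
        + spectralGain N * (N + 2) * (cos ((1 : ℕ) * θ) * sin θ ^ N)
        - (1 + spectralGain N) * (cos (m * θ) * sin θ ^ N)
        - spectralGain N * (N + 2) * (cos θ * cos (m * θ) * sin θ ^ N)) := by
      intro θ
      simp only [lowKernel, Nat.cast_zero, zero_mul, cos_zero, Nat.cast_one, one_mul]
      field_simp
      ring
    simp only [this]
    have ii : ∀ {f : ℝ → ℝ}, Continuous f → IntervalIntegrable f volume 0 π :=
      fun hf => hf.intervalIntegrable _ _
    rw [intervalIntegral.integral_const_mul, intervalIntegral.integral_sub (ii (by fun_prop))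
      (ii (by fun_prop)),
      intervalIntegral.integral_sub (ii (by fun_prop)) (ii (by fun_prop)),
      intervalIntegral.integral_add (ii (by fun_prop)) (ii (by fun_prop)),
      intervalIntegral.integral_const_mul, intervalIntegral.integral_const_mul,
      intervalIntegral.integral_const_mul, intervalIntegral.integral_const_mul, i0, i1, i2, i3]
    field_simp
    ring
  have h := spectral_inequality_aux (N := N) hs m
  rw [e1, e2]
  refine ENNReal.ofReal_le_ofReal ?_
  rw [e3]
  linarith

end Multiplier

section CircleParseval

open Real

/-- The `m`-th Fourier coefficient of a `2π`-periodic function. -/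
noncomputable def circleCoeff (f : ℝ → ℝ) (m : ℤ) : ℂ :=
  (1 / (2 * π)) • ∫ x in (0 : ℝ)..2 * π, Complex.exp (-(m * x * Complex.I)) * f x

theorem hasSum_sq_circleCoeff {f : ℝ → ℝ} (hf : Continuous f) :
    HasSum (fun m : ℤ => ‖circleCoeff f m‖ ^ 2) ((2 * π)⁻¹ * ∫ x in (0 : ℝ)..2 * π, f x ^ 2) := by
  have h2 : (0 : ℝ) < 2 * π := by positivity
  have hc : Continuous fun x => (f x : ℂ) := by fun_prop
  have hL : MemLp (fun x => (f x : ℂ)) 2 (volume.restrict (Set.Ioc 0 (2 * π))) := by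
    have : Fact ((volume : Measure ℝ) (Set.Ioc 0 (2 * π)) < ⊤) := ⟨measure_Ioc_lt_top⟩
    obtain ⟨C, hC⟩ := isCompact_Icc.exists_bound_of_continuousOn
      (hc.continuousOn (s := Set.Icc 0 (2 * π)))
    refine MemLp.of_bound hc.aestronglyMeasurable C ?_
    filter_upwards [ae_restrict_mem measurableSet_Ioc] with x hx
    exact hC x (Set.Ioc_subset_Icc_self hx)
  have key := hasSum_sq_fourierCoeffOn h2 hL
  simp only [Complex.norm_real, sub_zero, norm_eq_abs, sq_abs, smul_eq_mul] at key
  convert key using 4 with m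
  rw [fourierCoeffOn_eq_integral, circleCoeff, sub_zero]
  congr 1
  refine intervalIntegral.integral_congr fun x _ => ?_
  simp only [smul_eq_mul, fourier_coe_apply]
  congr 2
  have : (π : ℂ) ≠ 0 := by exact_mod_cast pi_ne_zero
  push_cast
  field_simp

theorem circleCoeff_shift_sub {f : ℝ → ℝ} (hf : Continuous f) (hp : ∀ x, f (x + 2 * π) = f x)
    (m : ℤ) (θ : ℝ) :
    circleCoeff (fun x => f (x + θ) - f x) m
      = (Complex.exp (m * θ * Complex.I) - 1) * circleCoeff f m := by
  have h1 : ∫ x in (0 : ℝ)..2 * π, Complex.exp (-(m * x * Complex.I)) * f (x + θ)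
      = Complex.exp (m * θ * Complex.I) *
        ∫ x in (0 : ℝ)..2 * π, Complex.exp (-(m * x * Complex.I)) * f x := by
    have hper : Function.Periodic (fun x : ℝ => Complex.exp (-(m * x * Complex.I)) * (f x : ℂ))
        (2 * π) := by
      intro x
      have : Complex.exp (-(m * ((x + 2 * π : ℝ) : ℂ) * Complex.I))
          = Complex.exp (-(m * x * Complex.I)) := by
        rw [Complex.exp_eq_exp_iff_exists_int]
        exact ⟨-m, by push_cast; ring⟩
      simp only [this, hp]
    rw [← intervalIntegral.integral_const_mul]
    have h := hper.intervalIntegral_add_eq θ 0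
    rw [zero_add] at h
    rw [intervalIntegral.integral_const_mul, ← h, ← intervalIntegral.integral_const_mul]
    have h' := intervalIntegral.integral_comp_add_right (a := 0) (b := 2 * π)
      (fun x : ℝ => Complex.exp (m * θ * Complex.I) *
        (Complex.exp (-(m * x * Complex.I)) * (f x : ℂ))) θ
    rw [zero_add, add_comm (2 * π) θ] at h'
    rw [← h']
    refine intervalIntegral.integral_congr fun x _ => ?_
    simp only [← mul_assoc, ← Complex.exp_add]
    congr 2
    push_cast
    ring
  have hs : ∀ x : ℝ, Complex.exp (-(m * x * Complex.I)) * ((f (x + θ) - f x : ℝ) : ℂ)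
      = Complex.exp (-(m * x * Complex.I)) * f (x + θ)
        - Complex.exp (-(m * x * Complex.I)) * f x := fun x => by push_cast; ring
  simp only [circleCoeff, hs]
  rw [intervalIntegral.integral_sub, h1, ← sub_one_mul, mul_smul_comm]
  · exact Continuous.intervalIntegrable (by fun_prop) _ _
  · exact Continuous.intervalIntegrable (by fun_prop) _ _

theorem norm_exp_sub_one_sq (t : ℝ) : ‖Complex.exp (t * Complex.I) - 1‖ ^ 2 = 2 - 2 * cos t := by
  rw [← Complex.normSq_eq_norm_sq, Complex.normSq_apply]
  simp [Complex.exp_ofReal_mul_I_re, Complex.exp_ofReal_mul_I_im]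
  nlinarith [sin_sq_add_cos_sq t]

/-- Normalised squared `L²` norm over a period. -/
noncomputable def circleNormSq (f : ℝ → ℝ) : ℝ≥0∞ :=
  ENNReal.ofReal (1 / (2 * π)) * ∫⁻ φ in Set.Ioc 0 (2 * π), ENNReal.ofReal (f φ ^ 2)

theorem circleNormSq_eq_tsum {f : ℝ → ℝ} (hf : Continuous f) :
    circleNormSq f = ∑' m : ℤ, ENNReal.ofReal (‖circleCoeff f m‖ ^ 2) := by
  have key := hasSum_sq_circleCoeff hf
  have hi : IntegrableOn (fun x => f x ^ 2) (Set.Ioc 0 (2 * π)) :=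
    (intervalIntegrable_iff_integrableOn_Ioc_of_le (by positivity)).1
      ((hf.pow 2).intervalIntegrable _ _)
  rw [circleNormSq, ← ofReal_integral_eq_lintegral_ofReal hi (ae_of_all _ fun x => sq_nonneg _),
    ← ENNReal.ofReal_mul (by positivity), ← ENNReal.ofReal_tsum_of_nonneg
      (fun m => sq_nonneg _) key.summable, key.tsum_eq,
    intervalIntegral.integral_of_le (by positivity), one_div]

theorem circleNormSq_shift_sub_eq_tsum {f : ℝ → ℝ} (hf : Continuous f)
    (hp : ∀ x, f (x + 2 * π) = f x) (θ : ℝ) :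
    circleNormSq (fun x => f (x + θ) - f x)
      = ∑' m : ℤ, ENNReal.ofReal (‖circleCoeff f m‖ ^ 2)
          * ENNReal.ofReal (2 - 2 * cos (m.natAbs * θ)) := by
  rw [circleNormSq_eq_tsum (by fun_prop)]
  refine tsum_congr fun m => ?_
  rw [circleCoeff_shift_sub hf hp, norm_mul, mul_pow, ← ENNReal.ofReal_mul (by positivity),
    mul_comm]
  congr 2
  have := norm_exp_sub_one_sq (m * θ)
  push_cast at this
  rw [this]
  rcases Int.natAbs_eq m with h | h
  · nth_rewrite 1 [h]; simp
  · nth_rewrite 1 [h]; simp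

theorem circle_spectral_inequality {N : ℕ} {s : ℝ} (hs : s ∈ Set.Ioo 0 1) {f : ℝ → ℝ}
    (hf : Continuous f) (hp : ∀ x, f (x + 2 * π) = f x) :
    ∫⁻ θ in Set.Ioo 0 π, ENNReal.ofReal (sin θ ^ N) *
          (ENNReal.ofReal (lowKernel N s (cos θ)) * circleNormSq fun x => f (x + θ) - f x)
    ≤ ∫⁻ θ in Set.Ioo 0 π, ENNReal.ofReal (sin θ ^ N) *
          (ENNReal.ofReal ((2 * sin (θ / 2)) ^ (-(((N + 2 : ℕ) : ℝ) + s)))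
            * circleNormSq fun x => f (x + θ) - f x) := by
  have expand : ∀ w : ℝ → ℝ≥0∞, Measurable w →
      ∫⁻ θ in Set.Ioo 0 π, ENNReal.ofReal (sin θ ^ N) *
          (w θ * circleNormSq fun x => f (x + θ) - f x)
      = ∑' m : ℤ, ENNReal.ofReal (‖circleCoeff f m‖ ^ 2) *
          ∫⁻ θ in Set.Ioo 0 π, ENNReal.ofReal (sin θ ^ N) *
            (w θ * ENNReal.ofReal (2 - 2 * cos (m.natAbs * θ))) := by
    intro w hw
    have : ∀ m : ℤ, Measurable fun θ => ENNReal.ofReal (sin θ ^ N) *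
            (w θ * ENNReal.ofReal (2 - 2 * cos (m.natAbs * θ))) := fun m => by fun_prop
    simp_rw [← lintegral_const_mul _ (this _)]
    rw [← lintegral_tsum fun m => ((this m).const_mul _).aemeasurable]
    refine lintegral_congr fun θ => ?_
    rw [circleNormSq_shift_sub_eq_tsum hf hp, ← ENNReal.tsum_mul_left, ← ENNReal.tsum_mul_left]
    exact tsum_congr fun m => by ring
  rw [expand (fun θ => ENNReal.ofReal (lowKernel N s (cos θ)))
      (measurable_lowKernel.comp measurable_cos).ennreal_ofReal,
    expand (fun θ => ENNReal.ofReal ((2 * sin (θ / 2)) ^ (-(((N + 2 : ℕ) : ℝ) + s)))) (by fun_prop)]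
  exact ENNReal.tsum_le_tsum fun m => mul_le_mul_right (spectral_inequality hs m.natAbs) _

end CircleParseval

section SphereSpectral

open Real
open scoped RealInnerProductSpace

/-- The unit sphere of `ℝ^(N+2)`. -/
abbrev USphere (N : ℕ) : Type := sphere (0 : EuclideanSpace ℝ (Fin (N + 2))) 1

/-- The surface measure on the unit sphere of `ℝ^(N+2)`. -/
noncomputable abbrev surf (N : ℕ) : Measure (USphere N) :=
  (volume : Measure (EuclideanSpace ℝ (Fin (N + 2)))).toSphere

/-- The quadratic energy of `u` associated with the kernel `k`. -/
noncomputable def sphereEnergy {N : ℕ} (k : USphere N → USphere N → ℝ) (u : USphere N → ℝ) : ℝ≥0∞ :=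
  ∫⁻ x, ∫⁻ y, ENNReal.ofReal (k x y) * ENNReal.ofReal ((u y - u x) ^ 2) ∂(surf N) ∂(surf N)

/-- The kernel `|x - y|^(-(n+s))` on the sphere. -/
noncomputable def rieszKernel (N : ℕ) (s : ℝ) (x y : USphere N) : ℝ :=
  ‖x.1 - y.1‖ ^ (-(((N + 2 : ℕ) : ℝ) + s))

variable {N : ℕ} {s : ℝ}

theorem measurable_rieszKernel : Measurable (rieszKernel N s).uncurry := by
  unfold rieszKernel Function.uncurry; fun_prop

theorem norm_sub_of_inner_eq_cos {V : Type*} [NormedAddCommGroup V] [InnerProductSpace ℝ V]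
    {x y : V} (hx : ‖x‖ = 1) (hy : ‖y‖ = 1) {θ : ℝ} (hθ : θ ∈ Set.Ioo 0 π)
    (h : ⟪x, y⟫ = cos θ) : ‖x - y‖ = 2 * sin (θ / 2) := by
  have h1 := sin_half_pos hθ
  rw [← sq_eq_sq₀ (norm_nonneg _) (by positivity), ← two_sub_two_cos, norm_sub_sq_real, hx, hy, h]
  ring

/-- On the sphere, the Gagliardo energy dominates the energy with kernel `lowKernel`. -/
theorem sphere_spectral_inequality (hs : s ∈ Set.Ioo 0 1) {u : USphere N → ℝ}
    (hu : Continuous u) :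
    sphereEnergy (fun x y => lowKernel N s ⟪x.1, y.1⟫) u ≤ sphereEnergy (rieszKernel N s) u := by
  obtain ⟨G, _, μ, γ, _, hγm, hγc, hγp, hγi, hG⟩ := exists_circle_average N
  have hlow : Measurable (lowKernel N s) := measurable_lowKernel
  have hum := hu.measurable
  have key : ∀ (k : USphere N → USphere N → ℝ) (w : ℝ → ℝ), Measurable k.uncurry → Measurable w →
      (∀ θ ∈ Set.Ioo 0 π, ∀ g φ, k (γ g φ) (γ g (φ + θ)) = w θ) →
      sphereEnergy k u = surf N Set.univ * (sphereArea N * ∫⁻ g, (∫⁻ θ in Set.Ioo 0 π,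
          ENNReal.ofReal (sin θ ^ N) * (ENNReal.ofReal (w θ) *
            circleNormSq fun x => u (γ g (x + θ)) - u (γ g x))) ∂μ) := by
    intro k w hk hw hkw
    rw [sphereEnergy, hG (fun x y => ENNReal.ofReal (k x y) * ENNReal.ofReal ((u y - u x) ^ 2))
      (hk.ennreal_ofReal.mul (by fun_prop : Measurable fun p : USphere N × USphere N =>
        ENNReal.ofReal ((u p.2 - u p.1) ^ 2)))]
    have hγ' : Measurable fun p : (ℝ × G) × ℝ => γ p.1.2 (p.2 + p.1.1) :=
      hγm.comp (by fun_prop : Measurable fun p : (ℝ × G) × ℝ => (p.1.2, p.2 + p.1.1))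
    have hγ'' : Measurable fun p : (ℝ × G) × ℝ => γ p.1.2 p.2 :=
      hγm.comp (by fun_prop : Measurable fun p : (ℝ × G) × ℝ => (p.1.2, p.2))
    have hD : Measurable fun p : (ℝ × G) × ℝ =>
        ENNReal.ofReal ((u (γ p.1.2 (p.2 + p.1.1)) - u (γ p.1.2 p.2)) ^ 2) :=
      (((hum.comp hγ').sub (hum.comp hγ'')).pow_const 2).ennreal_ofReal
    have hmeas : Measurable fun p : ℝ × G =>
        circleNormSq fun x => u (γ p.2 (x + p.1)) - u (γ p.2 x) :=
      (Measurable.lintegral_prod_right hD).const_mul _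
    have hw' : Measurable fun p : ℝ × G => ENNReal.ofReal (w p.1) := by fun_prop
    have hs' : Measurable fun p : ℝ × G => ENNReal.ofReal (sin p.1 ^ N) := by fun_prop
    rw [← lintegral_lintegral_swap (hs'.mul (hw'.mul hmeas)).aemeasurable]
    congr 2
    refine setLIntegral_congr_fun measurableSet_Ioo fun θ hθ => ?_
    have hθm : Measurable fun g : G => ((θ, g) : ℝ × G) := by fun_prop
    have hm : Measurable fun g => ENNReal.ofReal (w θ) *
        circleNormSq fun x => u (γ g (x + θ)) - u (γ g x) := (hmeas.comp hθm).const_mul _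
    rw [lintegral_const_mul _ hm]
    congr 2 with g
    have hDg : Measurable fun φ => ENNReal.ofReal ((u (γ g (φ + θ)) - u (γ g φ)) ^ 2) :=
      hD.comp (by fun_prop : Measurable fun φ : ℝ => ((θ, g), φ))
    simp only [hkw θ hθ]
    rw [lintegral_const_mul _ hDg, circleNormSq]
    ring
  have hlow' : Measurable (Function.uncurry fun x y : USphere N => lowKernel N s ⟪x.1, y.1⟫) := by
    unfold lowKernel Function.uncurry
    fun_prop
  rw [key _ (fun θ => lowKernel N s (cos θ)) hlow',
    key _ (fun θ => (2 * sin (θ / 2)) ^ (-(((N + 2 : ℕ) : ℝ) + s))) measurable_rieszKernel]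
  · gcongr _ * (_ * ?_)
    refine lintegral_mono fun g => ?_
    exact circle_spectral_inequality (N := N) hs (f := fun x => u (γ g x)) (hu.comp (hγc g))
      fun x => by simp only [hγp]
  · fun_prop
  · intro θ hθ g φ
    rw [rieszKernel, norm_sub_of_inner_eq_cos (by simp) (by simp) hθ]
    rw [hγi, ← cos_neg]; congr 1; ring
  · fun_prop
  · intro θ hθ g φ
    simp only [hγi]
    rw [← cos_neg]; congr 2; ring

end SphereSpectral

section SphereExpansion

open Real
open scoped RealInnerProductSpace

variable {N : ℕ} {s : ℝ}

theorem integrable_surf {E : Type*} [NormedAddCommGroup E] {f : USphere N → E}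
    (hf : Continuous f) : Integrable f (surf N) :=
  hf.integrable_of_hasCompactSupport (HasCompactSupport.of_compactSpace f)

theorem integral_surf_coe : ∫ x : USphere N, x.1 ∂(surf N) = 0 := by
  have h : ∫ x : USphere N, x.1 ∂(surf N) = ∫ x : USphere N, -x.1 ∂(surf N) := by
    conv_lhs => rw [surf, ← (measurePreserving_sphereMap (LinearIsometryEquiv.neg ℝ :
      EuclideanSpace ℝ (Fin (N + 2)) ≃ₗᵢ[ℝ] EuclideanSpace ℝ (Fin (N + 2)))).map_eq]
    rw [integral_map (continuous_sphereMap _).aemeasurable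
      continuous_subtype_val.aestronglyMeasurable]
    rfl
  rw [integral_neg] at h
  have h2 := add_eq_zero_iff_eq_neg.2 h
  rw [← two_smul ℝ] at h2
  exact (smul_eq_zero.1 h2).resolve_left two_ne_zero

theorem integral_affine_kernel {u : USphere N → ℝ} (hu : Continuous u) (a b : ℝ) :
    ∫ x, ∫ y, (a + b * ⟪x.1, y.1⟫) * (u y - u x) ^ 2 ∂(surf N) ∂(surf N)
      = 2 * (a * ((surf N).real Set.univ * (∫ x, u x ^ 2 ∂(surf N)) - (∫ x, u x ∂(surf N)) ^ 2)
        - b * ‖∫ x, u x • x.1 ∂(surf N)‖ ^ 2) := by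
  have hI : ∀ {f : USphere N → ℝ}, Continuous f → Integrable f (surf N) := integrable_surf
  have hV : ∀ {f : USphere N → EuclideanSpace ℝ (Fin (N + 2))},
    Continuous f → Integrable f (surf N) := integrable_surf
  have inner_y : ∀ x : USphere N, ∫ y, (a + b * ⟪x.1, y.1⟫) * (u y - u x) ^ 2 ∂(surf N)
      = a * (∫ y, u y ^ 2 ∂(surf N)) - 2 * a * u x * (∫ y, u y ∂(surf N))
        + a * u x ^ 2 * (surf N).real Set.univ + b * ⟪x.1, ∫ y, u y ^ 2 • y.1 ∂(surf N)⟫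
        - 2 * b * ⟪u x • x.1, ∫ y, u y • y.1 ∂(surf N)⟫ := by
    intro x
    have e0 : ∫ y : USphere N, ⟪x.1, y.1⟫ ∂(surf N) = 0 := by
      rw [integral_inner (hV (by fun_prop)), integral_surf_coe, inner_zero_right]
    have e1 : ∫ y, ⟪x.1, u y • y.1⟫ ∂(surf N) = ⟪x.1, ∫ y, u y • y.1 ∂(surf N)⟫ :=
      integral_inner (hV (by fun_prop)) _
    have e2 : ∫ y, ⟪x.1, u y ^ 2 • y.1⟫ ∂(surf N) = ⟪x.1, ∫ y, u y ^ 2 • y.1 ∂(surf N)⟫ :=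
      integral_inner (hV (by fun_prop)) _
    have : ∀ y : USphere N, (a + b * ⟪x.1, y.1⟫) * (u y - u x) ^ 2
        = a * u y ^ 2 - 2 * a * u x * u y + a * u x ^ 2 + b * ⟪x.1, u y ^ 2 • y.1⟫
          - 2 * b * u x * ⟪x.1, u y • y.1⟫ + b * u x ^ 2 * ⟪x.1, y.1⟫ := by
      intro y
      simp only [inner_smul_right]
      ring
    simp only [this]
    rw [integral_add (hI (by fun_prop)) (hI (by fun_prop)),
      integral_sub (hI (by fun_prop)) (hI (by fun_prop)),
      integral_add (hI (by fun_prop)) (hI (by fun_prop)),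
      integral_add (hI (by fun_prop)) (hI (by fun_prop)),
      integral_sub (hI (by fun_prop)) (hI (by fun_prop))]
    simp only [integral_const_mul, e0, e1, e2, integral_const, smul_eq_mul]
    simp only [real_inner_smul_left]
    ring
  have e1 : ∀ v : EuclideanSpace ℝ (Fin (N + 2)), ∫ x, ⟪u x • x.1, v⟫ ∂(surf N)
      = ⟪∫ y, u y • y.1 ∂(surf N), v⟫ := fun v => by
    simp only [real_inner_comm v]
    exact integral_inner (hV (by fun_prop)) _
  have e2 : ∀ v : EuclideanSpace ℝ (Fin (N + 2)), ∫ x : USphere N, ⟪x.1, v⟫ ∂(surf N) = 0 :=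
    fun v => by
    simp only [real_inner_comm v]
    rw [integral_inner (hV (by fun_prop)), integral_surf_coe, inner_zero_right]
  simp only [inner_y]
  rw [integral_sub (hI (by fun_prop)) (hI (by fun_prop)),
      integral_add (hI (by fun_prop)) (hI (by fun_prop)),
      integral_add (hI (by fun_prop)) (hI (by fun_prop)),
      integral_sub (hI (by fun_prop)) (hI (by fun_prop))]
  simp only [integral_const_mul, integral_mul_const, e1, e2, integral_const, smul_eq_mul,
    real_inner_self_eq_norm_sq]
  ring

theorem le_sphereEnergy_rieszKernel (hs : s ∈ Set.Ioo 0 1) {u : USphere N → ℝ}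
    (hu : Continuous u) :
    ENNReal.ofReal (chordMass N s / cosMoment N 0 * ((1 + spectralGain N) *
      ((surf N).real Set.univ * (∫ x, u x ^ 2 ∂(surf N)) - (∫ x, u x ∂(surf N)) ^ 2)
        - spectralGain N * (N + 2) * ‖∫ x, u x • x.1 ∂(surf N)‖ ^ 2))
      ≤ sphereEnergy (rieszKernel N s) u := by
  refine le_trans (le_of_eq ?_) (sphere_spectral_inequality hs hu)
  have hlow : Continuous (lowKernel N s) := by unfold lowKernel; fun_prop
  have hnn : ∀ x y : USphere N, 0 ≤ lowKernel N s ⟪x.1, y.1⟫ := fun x y =>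
    lowKernel_nonneg hs (by
      have := abs_real_inner_le_norm x.1 y.1
      simp at this
      exact neg_le_of_abs_le this)
  have e : ∀ x, ∫⁻ y, ENNReal.ofReal (lowKernel N s ⟪x.1, y.1⟫) *
      ENNReal.ofReal ((u y - u x) ^ 2) ∂(surf N)
      = ENNReal.ofReal (∫ y, lowKernel N s ⟪x.1, y.1⟫ * (u y - u x) ^ 2 ∂(surf N)) := by
    intro x
    rw [ofReal_integral_eq_lintegral_ofReal (integrable_surf (by fun_prop))
      (ae_of_all _ fun y => mul_nonneg (hnn x y) (sq_nonneg _))]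
    exact lintegral_congr fun y => (ENNReal.ofReal_mul (hnn x y)).symm
  have h := integral_affine_kernel hu (1 + spectralGain N) (spectralGain N * (N + 2))
  have hi : ∀ x, ∫ y, lowKernel N s ⟪x.1, y.1⟫ * (u y - u x) ^ 2 ∂(surf N)
      = chordMass N s / (2 * cosMoment N 0) * ∫ y, ((1 + spectralGain N) +
        spectralGain N * (N + 2) * ⟪x.1, y.1⟫) * (u y - u x) ^ 2 ∂(surf N) := fun x => by
    rw [← integral_const_mul]
    simp only [lowKernel, mul_assoc]
  rw [sphereEnergy]
  simp only [e]
  rw [← ofReal_integral_eq_lintegral_ofReal]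
  · simp only [hi, integral_const_mul, h]
    congr 1
    have := cosMoment_zero_pos (N := N)
    field_simp
  · exact (Integrable.integral_prod_left (f := fun p : USphere N × USphere N =>
      lowKernel N s ⟪p.1.1, p.2.1⟫ * (u p.2 - u p.1) ^ 2)
      (Continuous.integrable_of_hasCompactSupport (by fun_prop)
        (HasCompactSupport.of_compactSpace _)))
  · exact ae_of_all _ fun x => integral_nonneg fun y => mul_nonneg (hnn x y) (sq_nonneg _)

end SphereExpansion

section BallPerimeter

open Real

variable {N : ℕ} {s : ℝ}

theorem surf_univ : surf N Set.univ = sphereArea N * ENNReal.ofReal (cosMoment N 0) := by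
  have h := lintegral_zonal N (ψ := fun _ => 1) measurable_const
  simp only [lintegral_one, mul_one] at h
  rw [surf, h, cosMoment, intervalIntegral.integral_of_le pi_pos.le, integral_Ioc_eq_integral_Ioo]
  simp only [Nat.cast_zero, zero_mul, cos_zero, one_mul]
  rw [ofReal_integral_eq_lintegral_ofReal]
  · exact (Continuous.integrableOn_Icc (by fun_prop)).mono_set Set.Ioo_subset_Icc_self
  · refine (ae_restrict_iff' measurableSet_Ioo).2 (.of_forall fun θ hθ => ?_)
    exact pow_nonneg (sin_pos_of_pos_of_lt_pi hθ.1 hθ.2).le _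

/-- The part of the unit ball that the translation by `z` moves out of the ball. -/
noncomputable def ballLoss (N : ℕ) (z : EuclideanSpace ℝ (Fin (N + 2))) : ℝ≥0∞ :=
  volume {x : EuclideanSpace ℝ (Fin (N + 2)) | ‖x‖ < 1 ∧ 1 ≤ ‖x + z‖}

theorem measurableSet_ballLoss :
    MeasurableSet {p : EuclideanSpace ℝ (Fin (N + 2)) × EuclideanSpace ℝ (Fin (N + 2)) |
      ‖p.1‖ < 1 ∧ 1 ≤ ‖p.1 + p.2‖} := by
  have h1 : MeasurableSet {p : EuclideanSpace ℝ (Fin (N + 2)) × EuclideanSpace ℝ (Fin (N + 2)) |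
    ‖p.1‖ < 1} := measurableSet_lt (by fun_prop) (by fun_prop)
  have h2 : MeasurableSet {p : EuclideanSpace ℝ (Fin (N + 2)) × EuclideanSpace ℝ (Fin (N + 2)) |
    1 ≤ ‖p.1 + p.2‖} := measurableSet_le (by fun_prop) (by fun_prop)
  exact h1.inter h2

theorem measurableSet_ballLoss_slice (z : EuclideanSpace ℝ (Fin (N + 2))) :
    MeasurableSet {x : EuclideanSpace ℝ (Fin (N + 2)) | ‖x‖ < 1 ∧ 1 ≤ ‖x + z‖} := by
  have hp : Measurable fun x : EuclideanSpace ℝ (Fin (N + 2)) => (x, z) := by fun_prop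
  exact hp measurableSet_ballLoss

theorem measurable_ballLoss : Measurable (ballLoss N) :=
  measurable_measure_prodMk_right measurableSet_ballLoss

theorem ballLoss_map (T : EuclideanSpace ℝ (Fin (N + 2)) ≃ₗᵢ[ℝ] EuclideanSpace ℝ (Fin (N + 2)))
    (z : EuclideanSpace ℝ (Fin (N + 2))) : ballLoss N (T z) = ballLoss N z := by
  rw [ballLoss, ← T.measurePreserving.measure_preimage
    (measurableSet_ballLoss_slice (T z)).nullMeasurableSet, ballLoss]
  simp only [Set.preimage_ofPred_eq, T.norm_map, ← map_add]

theorem fracPer_ball_eq_ballLoss : fracPer (N + 2) s (ball 0 1) =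
    ∫⁻ z : EuclideanSpace ℝ (Fin (N + 2)), ENNReal.ofReal (‖z‖ ^ (-(((N + 2 : ℕ) : ℝ) + s)))
      * ballLoss N z := by
  let V := EuclideanSpace ℝ (Fin (N + 2))
  have h1 : ∀ x : V, (ball (0 : V) 1).indicator (fun x => ∫⁻ y in (ball (0 : V) 1)ᶜ,
      ENNReal.ofReal (‖x - y‖ ^ (-(((N + 2 : ℕ) : ℝ) + s)))) x
      = ∫⁻ z, {p : V × V | ‖p.1‖ < 1 ∧ 1 ≤ ‖p.1 + p.2‖}.indicator
        (fun p => ENNReal.ofReal (‖p.2‖ ^ (-(((N + 2 : ℕ) : ℝ) + s)))) (x, z) := by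
    intro x
    by_cases hx : ‖x‖ < 1
    · rw [Set.indicator_of_mem (by simpa using hx), ← lintegral_indicator measurableSet_ball.compl,
        ← lintegral_add_left_eq_self _ x]
      refine lintegral_congr fun z => ?_
      by_cases hz : 1 ≤ ‖x + z‖
      · rw [Set.indicator_of_mem (by simpa using hz), Set.indicator_of_mem (by exact ⟨hx, hz⟩)]
        simp
      · rw [Set.indicator_of_notMem (by simpa using hz),
          Set.indicator_of_notMem (by simpa [hx] using hz)]
    · rw [Set.indicator_of_notMem (by simpa using hx)]
      simp [hx]
  rw [fracPer, ← lintegral_indicator measurableSet_ball, lintegral_congr h1,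
    lintegral_lintegral_swap]
  · refine lintegral_congr fun z => ?_
    have : ∀ x : V, {p : V × V | ‖p.1‖ < 1 ∧ 1 ≤ ‖p.1 + p.2‖}.indicator
        (fun p => ENNReal.ofReal (‖p.2‖ ^ (-(((N + 2 : ℕ) : ℝ) + s)))) (x, z)
        = {x : V | ‖x‖ < 1 ∧ 1 ≤ ‖x + z‖}.indicator
        (fun _ => ENNReal.ofReal (‖z‖ ^ (-(((N + 2 : ℕ) : ℝ) + s)))) x := fun x => by
      simp [Set.indicator_apply]
    simp only [this]
    rw [lintegral_indicator_const, ballLoss]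
    exact measurableSet_ballLoss_slice z
  · refine (Measurable.indicator ?_ measurableSet_ballLoss).aemeasurable
    fun_prop

theorem volume_chord_loss {r t : ℝ} (hr : 0 < r) (ht : 0 < t) :
    volume {a : ℝ | a ^ 2 + t ^ 2 < 1 ∧ 1 ≤ (a + r) ^ 2 + t ^ 2}
      = (Set.Ioo 0 1).indicator (fun t => ENNReal.ofReal (min r (2 * √(1 - t ^ 2)))) t := by
  by_cases h : t < 1
  · have h0 : 0 < 1 - t ^ 2 := by nlinarith
    have h1 := sqrt_pos.2 h0
    have h2 := sq_sqrt h0.le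
    set b := √(1 - t ^ 2)
    rw [Set.indicator_of_mem (Set.mem_Ioo.2 ⟨ht, h⟩)]
    have : {a : ℝ | a ^ 2 + t ^ 2 < 1 ∧ 1 ≤ (a + r) ^ 2 + t ^ 2} \ {b - r}
        = Set.Ioo (max (-b) (b - r)) b := by
      ext a
      simp only [Set.mem_sdiff, Set.mem_ofPred_eq, Set.mem_singleton_iff, Set.mem_Ioo, max_lt_iff]
      constructor
      · rintro ⟨⟨ha, hb⟩, hc⟩
        have ha' : |a| < b := by rw [← sq_lt_sq₀ (abs_nonneg _) h1.le, sq_abs]; linarith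
        obtain ⟨h3, h4⟩ := abs_lt.1 ha'
        have : b ≤ a + r := by
          by_contra! hlt
          nlinarith
        exact ⟨⟨h3, lt_of_le_of_ne (by linarith) (Ne.symm hc)⟩, h4⟩
      · rintro ⟨⟨h3, h4⟩, h5⟩
        exact ⟨⟨by nlinarith, by nlinarith⟩, h4.ne'⟩
    rw [← measure_sdiff_null (measure_singleton (b - r)), this, volume_Ioo]
    congr 1
    rcases le_total r (2 * b) with h3 | h3
    · rw [min_eq_left h3, max_eq_right (by linarith)]; ring
    · rw [min_eq_right h3, max_eq_left (by linarith)]; ring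
  · rw [Set.indicator_of_notMem (fun h' => h h'.2)]
    convert measure_empty (μ := (volume : Measure ℝ))
    ext a
    simp only [Set.mem_ofPred_eq, Set.mem_empty_iff_false, iff_false]
    rintro ⟨ha, -⟩
    nlinarith [sq_nonneg a]

theorem ballLoss_smul {r : ℝ} (hr : 0 < r) (ω : USphere N) :
    ballLoss N (r • ω.1) = sphereArea N * ∫⁻ t in Set.Ioo (0 : ℝ) 1,
      ENNReal.ofReal (t ^ N) * ENNReal.ofReal (min r (2 * √(1 - t ^ 2))) := by
  obtain ⟨T, hT, -⟩ := exists_linearIsometryEquiv_map_pair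
    (x := (EuclideanSpace.single 0 1 : EuclideanSpace ℝ (Fin (N + 2))))
    (y := (EuclideanSpace.single 0 1 : EuclideanSpace ℝ (Fin (N + 2)))) (x' := ω.1) (y' := ω.1)
    (by simp) (by simp) (by simp)
  rw [← hT, ← map_smul, ballLoss_map]
  have hm : MeasurableSet {p : ℝ × ℝ | p.1 ^ 2 + p.2 ^ 2 < 1 ∧ 1 ≤ (p.1 + r) ^ 2 + p.2 ^ 2} := by
    have h1 : MeasurableSet {p : ℝ × ℝ | p.1 ^ 2 + p.2 ^ 2 < 1} :=
      measurableSet_lt (by fun_prop) (by fun_prop)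
    have h2 : MeasurableSet {p : ℝ × ℝ | 1 ≤ (p.1 + r) ^ 2 + p.2 ^ 2} :=
      measurableSet_le (by fun_prop) (by fun_prop)
    exact h1.inter h2
  have hf : Measurable (Function.uncurry fun a t : ℝ =>
      {p : ℝ × ℝ | p.1 ^ 2 + p.2 ^ 2 < 1 ∧ 1 ≤ (p.1 + r) ^ 2 + p.2 ^ 2}.indicator
        (fun _ => (1 : ℝ≥0∞)) (a, t)) := measurable_const.indicator hm
  have h := lintegral_axial N hf
  have h3 : ∀ x : EuclideanSpace ℝ (Fin (N + 2)), ‖x‖ ^ 2 = x 0 ^ 2 +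
      ‖(WithLp.toLp 2 (Fin.tail x.ofLp) : EuclideanSpace ℝ (Fin (N + 1)))‖ ^ 2 := by
    intro x
    simp [EuclideanSpace.norm_sq_eq, Fin.sum_univ_succ, Fin.tail]
  have h4 : ∀ x : EuclideanSpace ℝ (Fin (N + 2)),
      {p : ℝ × ℝ | p.1 ^ 2 + p.2 ^ 2 < 1 ∧ 1 ≤ (p.1 + r) ^ 2 + p.2 ^ 2}.indicator
        (fun _ => (1 : ℝ≥0∞))
        (x 0, ‖(WithLp.toLp 2 (Fin.tail x.ofLp) : EuclideanSpace ℝ (Fin (N + 1)))‖)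
      = {x : EuclideanSpace ℝ (Fin (N + 2)) | ‖x‖ < 1 ∧
        1 ≤ ‖x + r • (EuclideanSpace.single 0 1 : EuclideanSpace ℝ (Fin (N + 2)))‖}.indicator
          (fun _ => 1) x := by
    intro x
    have e1 := h3 x
    have e2 := h3 (x + r • (EuclideanSpace.single 0 1 : EuclideanSpace ℝ (Fin (N + 2))))
    have e3 : (WithLp.toLp 2 (Fin.tail
        (x + r • (EuclideanSpace.single 0 1 : EuclideanSpace ℝ (Fin (N + 2)))).ofLp) :
        EuclideanSpace ℝ (Fin (N + 1))) = WithLp.toLp 2 (Fin.tail x.ofLp) := by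
      ext i
      simp [Fin.tail]
    rw [e3] at e2
    simp only [PiLp.add_apply, PiLp.smul_apply, PiLp.single_apply, if_true, smul_eq_mul,
      mul_one] at e2
    simp only [Set.indicator_apply, Set.mem_ofPred_eq, ← e1, ← e2,
      sq_lt_one_iff₀ (norm_nonneg _), one_le_sq_iff₀ (norm_nonneg _)]
  simp only [h4] at h
  rw [lintegral_indicator_const (measurableSet_ballLoss_slice _), one_mul] at h
  rw [ballLoss, h]
  congr 1
  rw [lintegral_lintegral_swap ((by fun_prop : Measurable fun p : ℝ × ℝ =>
    ENNReal.ofReal (p.2 ^ N)).mul hf).aemeasurable]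
  have h5 : ∀ t ∈ Set.Ioi (0 : ℝ), ∫⁻ a : ℝ, ENNReal.ofReal (t ^ N) *
      {p : ℝ × ℝ | p.1 ^ 2 + p.2 ^ 2 < 1 ∧ 1 ≤ (p.1 + r) ^ 2 + p.2 ^ 2}.indicator
        (fun _ => (1 : ℝ≥0∞)) (a, t) = (Set.Ioo 0 1).indicator (fun t =>
          ENNReal.ofReal (t ^ N) * ENNReal.ofReal (min r (2 * √(1 - t ^ 2)))) t := by
    intro t ht
    have hmt : Measurable fun a : ℝ => (a, t) := by fun_prop
    have e1 : ∀ a : ℝ, {p : ℝ × ℝ | p.1 ^ 2 + p.2 ^ 2 < 1 ∧ 1 ≤ (p.1 + r) ^ 2 + p.2 ^ 2}.indicator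
        (fun _ => (1 : ℝ≥0∞)) (a, t)
        = {a : ℝ | a ^ 2 + t ^ 2 < 1 ∧ 1 ≤ (a + r) ^ 2 + t ^ 2}.indicator (fun _ => 1) a :=
      fun a => by simp [Set.indicator_apply]
    have e2 : MeasurableSet {a : ℝ | a ^ 2 + t ^ 2 < 1 ∧ 1 ≤ (a + r) ^ 2 + t ^ 2} := hmt hm
    simp only [e1]
    rw [lintegral_const_mul _ (measurable_const.indicator e2), lintegral_indicator_const e2,
      one_mul, volume_chord_loss hr ht]
    by_cases h : t ∈ Set.Ioo (0 : ℝ) 1 <;> simp [h]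
  rw [setLIntegral_congr_fun measurableSet_Ioi h5, lintegral_indicator measurableSet_Ioo,
    Measure.restrict_restrict measurableSet_Ioo]
  congr 2
  exact Set.inter_eq_left.2 Set.Ioo_subset_Ioi_self

theorem lintegral_Ioi_rpow_mul_min (hs : s ∈ Set.Ioo 0 1) {b : ℝ} (hb : 0 < b) :
    ∫⁻ r in Set.Ioi (0 : ℝ), ENNReal.ofReal (r ^ (-1 - s)) * ENNReal.ofReal (min r b)
      = ENNReal.ofReal (b ^ (1 - s) / (s * (1 - s))) := by
  obtain ⟨hs0, hs1⟩ := hs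
  have hs2 : 0 < 1 - s := by linarith
  rw [← Set.Ioc_union_Ioi_eq_Ioi hb.le, lintegral_union measurableSet_Ioi
    (Set.Ioc_disjoint_Ioi le_rfl)]
  have e1 : ∫⁻ r in Set.Ioc 0 b, ENNReal.ofReal (r ^ (-1 - s)) * ENNReal.ofReal (min r b)
      = ENNReal.ofReal (b ^ (1 - s) / (1 - s)) := by
    have h1 : ∫ r in (0 : ℝ)..b, r ^ (-s) = b ^ (1 - s) / (1 - s) := by
      rw [integral_rpow (Or.inl (by linarith)), zero_rpow (by linarith)]
      ring_nf
    rw [← h1, intervalIntegral.integral_of_le hb.le, ofReal_integral_eq_lintegral_ofReal]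
    · refine setLIntegral_congr_fun measurableSet_Ioc fun r hr => ?_
      rw [min_eq_left hr.2, ← ENNReal.ofReal_mul (rpow_nonneg hr.1.le _)]
      congr 1
      rw [← rpow_add_one hr.1.ne']
      ring_nf
    · exact (intervalIntegrable_iff_integrableOn_Ioc_of_le hb.le).1
        (intervalIntegral.intervalIntegrable_rpow' (by linarith))
    · exact (ae_restrict_iff' measurableSet_Ioc).2 (.of_forall fun r hr => rpow_nonneg hr.1.le _)
  have e2 : ∫⁻ r in Set.Ioi b, ENNReal.ofReal (r ^ (-1 - s)) * ENNReal.ofReal (min r b)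
      = ENNReal.ofReal (b ^ (1 - s) / s) := by
    have h1 := integral_Ioi_rpow_of_lt (a := -1 - s) (by linarith) hb
    have h2 : b ^ (1 - s) / s = (∫ r in Set.Ioi b, r ^ (-1 - s)) * b := by
      rw [h1, show 1 - s = (-1 - s + 1) + 1 by ring, rpow_add_one hb.ne']
      have : -1 - s + 1 ≠ 0 := by linarith
      field_simp
      ring
    rw [h2, ENNReal.ofReal_mul' hb.le, ofReal_integral_eq_lintegral_ofReal,
      ← lintegral_mul_const _ (by fun_prop)]
    · refine setLIntegral_congr_fun measurableSet_Ioi fun r hr => ?_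
      rw [min_eq_right (le_of_lt hr)]
    · exact integrableOn_Ioi_rpow_of_lt (by linarith) hb
    · exact (ae_restrict_iff' measurableSet_Ioi).2
        (.of_forall fun r hr => rpow_nonneg (hb.trans hr).le _)
  rw [e1, e2, ← ENNReal.ofReal_add (by positivity) (by positivity)]
  congr 1
  field_simp
  ring

theorem integral_sin_half_rpow_two_sub (hs : s ∈ Set.Ioo 0 1) :
    ∫ θ in 0..π, (2 * sin (θ / 2)) ^ (2 - s) * cos (θ / 2) ^ N
      = 4 * (1 - s) / (N + 2 - s) * chordMass N s := by
  obtain ⟨hs0, hs1⟩ := hs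
  have h0 : (0 : ℝ) < N + 2 - s := by linarith [(Nat.cast_nonneg N : (0 : ℝ) ≤ N)]
  have hc : Continuous fun θ : ℝ => (2 * sin (θ / 2)) ^ (2 - s) * cos (θ / 2) ^ N :=
    ((by fun_prop : Continuous fun θ : ℝ => 2 * sin (θ / 2)).rpow_const
      fun θ => Or.inr (by linarith)).mul (by fun_prop)
  have i1 : IntervalIntegrable (chordKernel N s) volume 0 π :=
    intervalIntegrable_chordKernel ⟨hs0, hs1⟩
  have key := intervalIntegral.integral_eq_sub_of_hasDerivAt_of_le
    (f := fun θ => (2 * sin (θ / 2)) ^ (1 - s) * cos (θ / 2) ^ (N + 1))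
    (f' := fun θ => (1 - s) * chordKernel N s θ
      - (N + 2 - s) / 4 * ((2 * sin (θ / 2)) ^ (2 - s) * cos (θ / 2) ^ N)) pi_pos.le
    (((by fun_prop : Continuous fun θ : ℝ => 2 * sin (θ / 2)).rpow_const
      fun θ => Or.inr (by linarith)).mul (by fun_prop)).continuousOn ?_
    ((i1.const_mul _).sub ((hc.intervalIntegrable _ _).const_mul _))
  · rw [intervalIntegral.integral_sub (i1.const_mul _) ((hc.intervalIntegrable _ _).const_mul _),
      intervalIntegral.integral_const_mul, intervalIntegral.integral_const_mul] at key
    have : (0 : ℝ) ^ (1 - s) = 0 := zero_rpow (by linarith)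
    simp [this] at key
    rw [chordMass]
    field_simp
    linarith
  · intro θ hθ
    have hS : 0 < 2 * sin (θ / 2) := by have := sin_half_pos hθ; positivity
    have hd : HasDerivAt (fun θ : ℝ => θ / 2) (1 / 2) θ := (hasDerivAt_id θ).div_const 2
    refine (((hd.sin.const_mul 2).rpow_const (p := 1 - s) (Or.inl hS.ne')).mul
      (hd.cos.pow (N + 1))).congr_deriv ?_
    have e1 : (2 * sin (θ / 2)) ^ (2 - s) = (2 * sin (θ / 2)) ^ 2 * (2 * sin (θ / 2)) ^ (-s) := by
      rw [sub_eq_add_neg, rpow_add hS]; norm_num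
    have e2 : (2 * sin (θ / 2)) ^ (1 - s) = (2 * sin (θ / 2)) * (2 * sin (θ / 2)) ^ (-s) := by
      rw [sub_eq_add_neg, rpow_add hS, rpow_one]
    have e3 : (1 - s - 1) = -s := by ring
    simp only [Pi.pow_apply, chordKernel, e1, e2, e3, Nat.add_sub_cancel]
    have := sin_sq_add_cos_sq (θ / 2)
    push_cast
    linear_combination ((1 - s) * (2 * sin (θ / 2)) ^ (-s) * cos (θ / 2) ^ N) * this

theorem lintegral_chord_profile (hs : s ∈ Set.Ioo 0 1) :
    ∫⁻ t in Set.Ioo (0 : ℝ) 1, ENNReal.ofReal (t ^ N) *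
        ENNReal.ofReal ((2 * √(1 - t ^ 2)) ^ (1 - s) / (s * (1 - s)))
      = ENNReal.ofReal (chordMass N s / (s * (N + 2 - s))) := by
  obtain ⟨hs0, hs1⟩ := hs
  have hs2 : 0 < 1 - s := by linarith
  have h0 : (0 : ℝ) < N + 2 - s := by linarith [(Nat.cast_nonneg N : (0 : ℝ) ≤ N)]
  have himg : (fun θ : ℝ => cos (θ / 2)) '' Set.Ioo 0 π = Set.Ioo 0 1 := by
    ext t
    constructor
    · rintro ⟨θ, hθ, rfl⟩
      refine ⟨cos_half_pos hθ, ?_⟩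
      have := cos_lt_cos_of_nonneg_of_le_pi le_rfl (by linarith [hθ.2, hθ.1] : θ / 2 ≤ π)
        (by linarith [hθ.1])
      simpa using this
    · rintro ⟨h1, h2⟩
      refine ⟨2 * arccos t, ⟨by have := arccos_pos.2 h2; linarith, ?_⟩, ?_⟩
      · have := arccos_lt_pi_div_two.2 h1; linarith
      · simp [mul_div_cancel_left₀, cos_arccos (by linarith : -1 ≤ t) h2.le]
  have hinj : Set.InjOn (fun θ : ℝ => cos (θ / 2)) (Set.Ioo 0 π) := by
    intro a ha b hb hab
    have := injOn_cos (⟨by linarith [ha.1], by linarith [ha.2, pi_pos]⟩ : a / 2 ∈ Set.Icc 0 π)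
      (⟨by linarith [hb.1], by linarith [hb.2, pi_pos]⟩ : b / 2 ∈ Set.Icc 0 π) hab
    linarith
  have hd : ∀ θ : ℝ, HasDerivAt (fun θ : ℝ => cos (θ / 2)) (-sin (θ / 2) / 2) θ := fun θ =>
    ((hasDerivAt_id θ).div_const 2).cos.congr_deriv (by simp; ring)
  rw [← himg, lintegral_image_eq_lintegral_abs_deriv_mul measurableSet_Ioo
    (fun θ _ => (hd θ).hasDerivWithinAt) hinj]
  have e : chordMass N s / (s * (N + 2 - s)) = ∫ θ in 0..π, 1 / (4 * (s * (1 - s))) *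
      ((2 * sin (θ / 2)) ^ (2 - s) * cos (θ / 2) ^ N) := by
    rw [intervalIntegral.integral_const_mul, integral_sin_half_rpow_two_sub ⟨hs0, hs1⟩]
    field_simp
  rw [e, intervalIntegral.integral_of_le pi_pos.le, integral_Ioc_eq_integral_Ioo,
    ofReal_integral_eq_lintegral_ofReal]
  · refine setLIntegral_congr_fun measurableSet_Ioo fun θ hθ => ?_
    have hS := sin_half_pos hθ
    have hC := cos_half_pos hθ
    have e1 : √(1 - cos (θ / 2) ^ 2) = sin (θ / 2) := by
      rw [← sin_sq, sqrt_sq hS.le]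
    have e2 : (2 * sin (θ / 2)) ^ (2 - s) = (2 * sin (θ / 2)) * (2 * sin (θ / 2)) ^ (1 - s) := by
      rw [show 2 - s = 1 + (1 - s) by ring, rpow_add (by positivity), rpow_one]
    rw [e1, ← ENNReal.ofReal_mul (by positivity), ← ENNReal.ofReal_mul (by positivity), e2, neg_div,
      abs_neg, abs_of_pos (by positivity)]
    congr 1
    field_simp
    ring
  · refine (Continuous.integrableOn_Icc ?_).mono_set Set.Ioo_subset_Icc_self
    exact continuous_const.mul (((by fun_prop : Continuous fun θ : ℝ => 2 * sin (θ / 2)).rpow_const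
      fun θ => Or.inr (by linarith)).mul (by fun_prop))
  · refine (ae_restrict_iff' measurableSet_Ioo).2 (.of_forall fun θ hθ => ?_)
    have hS := sin_half_pos hθ
    have hC := cos_half_pos hθ
    simp only [Pi.zero_apply]
    positivity

/-- The fractional perimeter of the unit ball. -/
theorem fracPer_ball (hs : s ∈ Set.Ioo 0 1) :
    fracPer (N + 2) s (ball 0 1) = surf N Set.univ *
      (sphereArea N * ENNReal.ofReal (chordMass N s / (s * (N + 2 - s)))) := by
  have hw : ∀ ω : USphere N, ∫⁻ r in Set.Ioi (0 : ℝ), ENNReal.ofReal (r ^ (N + 1)) *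
      (ENNReal.ofReal (‖r • ω.1‖ ^ (-(((N + 2 : ℕ) : ℝ) + s))) * ballLoss N (r • ω.1))
      = sphereArea N * ENNReal.ofReal (chordMass N s / (s * (N + 2 - s))) := by
    intro ω
    have e : ∀ r ∈ Set.Ioi (0 : ℝ), ENNReal.ofReal (r ^ (N + 1)) *
      (ENNReal.ofReal (‖r • ω.1‖ ^ (-(((N + 2 : ℕ) : ℝ) + s))) * ballLoss N (r • ω.1))
      = sphereArea N * ∫⁻ t in Set.Ioo (0 : ℝ) 1, ENNReal.ofReal (t ^ N) *
        (ENNReal.ofReal (r ^ (-1 - s)) * ENNReal.ofReal (min r (2 * √(1 - t ^ 2)))) := by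
      intro r hr
      have hr' : 0 < r := hr
      have hn : ‖r • ω.1‖ = r := by simp [norm_smul, abs_of_pos hr']
      have hp : r ^ (N + 1) * r ^ (-(((N + 2 : ℕ) : ℝ) + s)) = r ^ (-1 - s) := by
        rw [← rpow_natCast, ← rpow_add hr']
        congr 1
        push_cast
        ring
      rw [hn, ballLoss_smul hr', ← mul_assoc, ← ENNReal.ofReal_mul (by positivity), hp,
        mul_left_comm, ← lintegral_const_mul _ (by fun_prop)]
      congr 2 with t
      ring
    have hm : Measurable fun p : ℝ × ℝ => ENNReal.ofReal (p.2 ^ N) *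
        (ENNReal.ofReal (p.1 ^ (-1 - s)) * ENNReal.ofReal (min p.1 (2 * √(1 - p.2 ^ 2)))) := by
      fun_prop
    rw [setLIntegral_congr_fun measurableSet_Ioi e, lintegral_const_mul _
      (Measurable.lintegral_prod_right hm), lintegral_lintegral_swap hm.aemeasurable,
      ← lintegral_chord_profile hs]
    congr 1
    refine setLIntegral_congr_fun measurableSet_Ioo fun t ht => ?_
    have hb : 0 < 2 * √(1 - t ^ 2) := by
      have := sqrt_pos.2 (by nlinarith [ht.1, ht.2] : 0 < 1 - t ^ 2)
      positivity
    rw [lintegral_const_mul _ (by fun_prop), lintegral_Ioi_rpow_mul_min hs hb]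
  have hm : Measurable fun z : EuclideanSpace ℝ (Fin (N + 2)) =>
      ENNReal.ofReal (‖z‖ ^ (-(((N + 2 : ℕ) : ℝ) + s))) * ballLoss N z :=
    (by fun_prop : Measurable fun z : EuclideanSpace ℝ (Fin (N + 2)) =>
      ENNReal.ofReal (‖z‖ ^ (-(((N + 2 : ℕ) : ℝ) + s)))).mul measurable_ballLoss
  rw [fracPer_ball_eq_ballLoss, lintegral_polar volume hm]
  have hd : Module.finrank ℝ (EuclideanSpace ℝ (Fin (N + 2))) - 1 = N + 1 := by simp
  simp only [hd, hw, lintegral_const]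
  ring

end BallPerimeter

section RadialGraph

theorem IsPreconnected.subset_of_disjoint_frontier {X : Type*} [TopologicalSpace X] {C E : Set X}
    (hC : IsPreconnected C) (hE : IsOpen E) (h : Disjoint (frontier E) C) {x : X} (hx : x ∈ C)
    (hxE : x ∈ E) : C ⊆ E := by
  by_contra hne
  obtain ⟨y, hyC, hyE⟩ := Set.not_subset.1 hne
  have hcov : C ⊆ E ∪ (closure E)ᶜ := by
    intro z hz
    by_cases hzE : z ∈ E
    · exact Or.inl hzE
    · refine Or.inr fun hzc => Set.disjoint_left.1 h ?_ hz
      rw [hE.frontier_eq]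
      exact ⟨hzc, hzE⟩
  obtain ⟨z, -, hz1, hz2⟩ := hC E (closure E)ᶜ hE isClosed_closure.isOpen_compl hcov ⟨x, hx, hxE⟩
    ⟨y, hyC, (hcov hyC).resolve_left hyE⟩
  exact hz2 (subset_closure hz1)

variable {V : Type*} [NormedAddCommGroup V] [NormedSpace ℝ V]

/-- A nonempty bounded open set whose boundary is a radial graph over the unit sphere is the
region below that graph. -/
theorem smul_mem_iff_of_frontier_eq {E : Set V} {R : V → ℝ} (hE : IsOpen E) (hb : IsBounded E)
    (hne : E.Nonempty) (hf : frontier E = (fun x => R x • x) '' sphere (0 : V) 1)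
    (hR : ∀ x ∈ sphere (0 : V) 1, 0 < R x) {x : V} (hx : x ∈ sphere (0 : V) 1) {r : ℝ}
    (hr : 0 < r) : r • x ∈ E ↔ r < R x := by
  have hfr : ∀ y ∈ sphere (0 : V) 1, ∀ t : ℝ, 0 ≤ t → t • y ∈ frontier E → t = R y := by
    intro y hy t ht hty
    rw [hf] at hty
    obtain ⟨z, hz, hzy⟩ := hty
    have hy1 : ‖y‖ = 1 := by simpa using hy
    have hz1 : ‖z‖ = 1 := by simpa using hz
    have hn := congrArg norm hzy
    simp only [norm_smul, hy1, hz1, Real.norm_eq_abs, abs_of_nonneg ht, abs_of_pos (hR z hz),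
      mul_one] at hn
    simp only [hn] at hzy
    have ht0 : t ≠ 0 := hn ▸ (hR z hz).ne'
    rw [← smul_right_injective V ht0 hzy, hn]
  have hout : ∀ y ∈ sphere (0 : V) 1, ∀ t : ℝ, R y ≤ t → t • y ∉ E := by
    intro y hy t ht htE
    have hy1 : ‖y‖ = 1 := by simpa using hy
    have ht0 : 0 < t := (hR y hy).trans_le ht
    have hne' : ∀ t', t ≤ t' → t' ≠ R y := by
      rintro t' ht' rfl
      have : t = R y := le_antisymm ht' ht
      have hmem : t • y ∈ frontier E := by rw [hf, this]; exact ⟨y, hy, rfl⟩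
      rw [hE.frontier_eq] at hmem
      exact hmem.2 htE
    have hsub := ((isPreconnected_Ici (a := t)).image (fun t : ℝ => t • y)
      (by fun_prop)).subset_of_disjoint_frontier hE (Set.disjoint_left.2 ?_)
      ⟨t, Set.self_mem_Ici, rfl⟩ htE
    · obtain ⟨C, hC⟩ := hb.exists_norm_le
      have h1 := hC _ (hsub ⟨max t (C + 1), Set.mem_Ici.2 (le_max_left _ _), rfl⟩)
      rw [norm_smul, hy1, mul_one, Real.norm_eq_abs, abs_of_pos (ht0.trans_le (le_max_left _ _))]
        at h1
      linarith [le_max_right t (C + 1)]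
    · rintro _ hz ⟨t', ht', rfl⟩
      exact hne' t' ht' (hfr y hy t' (ht0.le.trans ht') hz)
  have hseg : ∀ y ∈ sphere (0 : V) 1, ∀ t ∈ Set.Ico 0 (R y), t • y ∈ E →
      (fun t : ℝ => t • y) '' Set.Ico 0 (R y) ⊆ E := by
    intro y hy t ht htE
    refine (isPreconnected_Ico.image (fun t : ℝ => t • y)
      (by fun_prop)).subset_of_disjoint_frontier hE (Set.disjoint_left.2 ?_) ⟨t, ht, rfl⟩ htE
    rintro _ hz ⟨t', ht', rfl⟩
    exact ht'.2.ne (hfr y hy t' ht'.1 hz)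
  have h0 : (0 : V) ∈ E := by
    obtain ⟨e, he⟩ := hne
    by_cases he0 : e = 0
    · exact he0 ▸ he
    have hn : 0 < ‖e‖ := norm_pos_iff.2 he0
    have hy : ‖e‖⁻¹ • e ∈ sphere (0 : V) 1 := by
      simp [norm_smul, hn.ne']
    have hee : ‖e‖ • ‖e‖⁻¹ • e = e := by rw [smul_smul, mul_inv_cancel₀ hn.ne', one_smul]
    have hlt : ‖e‖ < R (‖e‖⁻¹ • e) := by
      by_contra! hle
      exact hout _ hy _ hle (hee.symm ▸ he)
    refine hseg _ hy ‖e‖ ⟨hn.le, hlt⟩ (hee.symm ▸ he) ⟨0, ⟨le_rfl, hR _ hy⟩, by simp⟩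
  refine ⟨fun h => not_le.1 fun hle => hout x hx r hle h, fun h => ?_⟩
  exact hseg x hx 0 ⟨le_rfl, hR x hx⟩ (by simpa using h0) ⟨r, ⟨hr.le, h⟩, rfl⟩

end RadialGraph

section PolarPerimeter

open Real

theorem Measurable.setLIntegral_of_param {α β : Type*} [MeasurableSpace α] [MeasurableSpace β]
    {μ : Measure β} [SFinite μ] {F : α → β → ℝ≥0∞} (hF : Measurable F.uncurry) {A : Set (α × β)}
    (hA : MeasurableSet A) : Measurable fun a => ∫⁻ b in {b | (a, b) ∈ A}, F a b ∂μ := by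
  have h : ∀ a, ∫⁻ b in {b | (a, b) ∈ A}, F a b ∂μ = ∫⁻ b, A.indicator F.uncurry (a, b) ∂μ := by
    intro a
    have hm : MeasurableSet {b | (a, b) ∈ A} := measurable_prodMk_left hA
    rw [← lintegral_indicator hm]
    rfl
  simp only [h]
  exact (hF.indicator hA).lintegral_prod_right'

variable {N : ℕ} {s : ℝ}

/-- The kernel `|z - w|^(-(n+s))` in polar coordinates `z = r x`, `w = ρ y`. -/
noncomputable def polarKernel (N : ℕ) (s : ℝ) (x y : USphere N) (r ρ : ℝ) : ℝ≥0∞ :=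
  ENNReal.ofReal (r ^ (N + 1)) * (ENNReal.ofReal (ρ ^ (N + 1)) *
    ENNReal.ofReal (‖r • x.1 - ρ • y.1‖ ^ (-(((N + 2 : ℕ) : ℝ) + s))))

/-- The interaction of the points of the ray through `x` below `a` and the points of the ray
through `y` above `b`. -/
noncomputable def rayEnergy (N : ℕ) (s : ℝ) (x y : USphere N) (a b : ℝ) : ℝ≥0∞ :=
  ∫⁻ r in Set.Ioo 0 a, ∫⁻ ρ in Set.Ici b, polarKernel N s x y r ρ

/-- The interaction of the points of the rays through `x` and `y` with modulus between `a`
and `b`. -/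
noncomputable def bandEnergy (N : ℕ) (s : ℝ) (x y : USphere N) (a b : ℝ) : ℝ≥0∞ :=
  ∫⁻ r in Set.Ico (min a b) (max a b), ∫⁻ ρ in Set.Ico (min a b) (max a b),
    polarKernel N s x y r ρ

theorem measurable_polarKernel : Measurable fun p : ((USphere N × USphere N) × ℝ) × ℝ =>
    polarKernel N s p.1.1.1 p.1.1.2 p.1.2 p.2 := by
  unfold polarKernel; fun_prop

theorem measurable_polarKernel_radial (x y : USphere N) : Measurable fun p : ℝ × ℝ =>
    polarKernel N s x y p.1 p.2 := by
  unfold polarKernel; fun_prop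

theorem norm_smul_sub_smul_sq {V : Type*} [NormedAddCommGroup V] [InnerProductSpace ℝ V] {x y : V}
    (hx : ‖x‖ = 1) (hy : ‖y‖ = 1) (r ρ : ℝ) :
    ‖r • x - ρ • y‖ ^ 2 = (r - ρ) ^ 2 + r * ρ * ‖x - y‖ ^ 2 := by
  rw [norm_sub_sq_real, norm_sub_sq_real, norm_smul, norm_smul, inner_smul_left, inner_smul_right,
    hx, hy, mul_one, mul_one, Real.norm_eq_abs, Real.norm_eq_abs, sq_abs, sq_abs]
  simp
  ring

theorem norm_smul_sub_smul_comm {V : Type*} [NormedAddCommGroup V] [InnerProductSpace ℝ V]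
    {x y : V} (hx : ‖x‖ = 1) (hy : ‖y‖ = 1) (r ρ : ℝ) : ‖r • x - ρ • y‖ = ‖r • y - ρ • x‖ := by
  rw [← sq_eq_sq₀ (norm_nonneg _) (norm_nonneg _), norm_smul_sub_smul_sq hx hy,
    norm_smul_sub_smul_sq hy hx, norm_sub_rev x y]

theorem polarKernel_comm (x y : USphere N) : polarKernel N s x y = polarKernel N s y x := by
  ext r ρ
  rw [polarKernel, polarKernel, norm_smul_sub_smul_comm (by simp) (by simp)]

theorem rayEnergy_comm (x y : USphere N) : rayEnergy N s x y = rayEnergy N s y x := by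
  ext a b
  rw [rayEnergy, rayEnergy, polarKernel_comm]

theorem measurable_rayEnergy {α : Type*} [MeasurableSpace α] {x y : α → USphere N} {f g : α → ℝ}
    (hx : Measurable x) (hy : Measurable y) (hf : Measurable f) (hg : Measurable g) :
    Measurable fun p => rayEnergy N s (x p) (y p) (f p) (g p) := by
  have hB : MeasurableSet {q : (α × ℝ) × ℝ | g q.1.1 ≤ q.2} :=
    measurableSet_le (by fun_prop) (by fun_prop)
  have hA : MeasurableSet {q : α × ℝ | 0 < q.2 ∧ q.2 < f q.1} := by
    have h1 : MeasurableSet {q : α × ℝ | 0 < q.2} := measurableSet_lt (by fun_prop) (by fun_prop)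
    have h2 : MeasurableSet {q : α × ℝ | q.2 < f q.1} :=
      measurableSet_lt (by fun_prop) (by fun_prop)
    exact h1.inter h2
  have hk : Measurable (Function.uncurry fun (p : α × ℝ) ρ =>
      polarKernel N s (x p.1) (y p.1) p.2 ρ) :=
    measurable_polarKernel.comp (by fun_prop : Measurable fun q : (α × ℝ) × ℝ =>
      (((x q.1.1, y q.1.1), q.1.2), q.2))
  exact (hk.setLIntegral_of_param (μ := volume) hB).setLIntegral_of_param (μ := volume)
    (F := fun a r => ∫⁻ ρ in Set.Ici (g a), polarKernel N s (x a) (y a) r ρ) hA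

theorem measurable_bandEnergy {R : USphere N → ℝ} (hR : Measurable R) :
    Measurable fun p : USphere N × USphere N => bandEnergy N s p.1 p.2 (R p.1) (R p.2) := by
  have hB : MeasurableSet {q : ((USphere N × USphere N) × ℝ) × ℝ |
      min (R q.1.1.1) (R q.1.1.2) ≤ q.2 ∧ q.2 < max (R q.1.1.1) (R q.1.1.2)} := by
    have h1 : MeasurableSet {q : ((USphere N × USphere N) × ℝ) × ℝ |
      min (R q.1.1.1) (R q.1.1.2) ≤ q.2} := measurableSet_le (by fun_prop) (by fun_prop)
    have h2 : MeasurableSet {q : ((USphere N × USphere N) × ℝ) × ℝ |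
      q.2 < max (R q.1.1.1) (R q.1.1.2)} := measurableSet_lt (by fun_prop) (by fun_prop)
    exact h1.inter h2
  have hA : MeasurableSet {q : (USphere N × USphere N) × ℝ |
      min (R q.1.1) (R q.1.2) ≤ q.2 ∧ q.2 < max (R q.1.1) (R q.1.2)} := by
    have h1 : MeasurableSet {q : (USphere N × USphere N) × ℝ |
      min (R q.1.1) (R q.1.2) ≤ q.2} := measurableSet_le (by fun_prop) (by fun_prop)
    have h2 : MeasurableSet {q : (USphere N × USphere N) × ℝ |
      q.2 < max (R q.1.1) (R q.1.2)} := measurableSet_lt (by fun_prop) (by fun_prop)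
    exact h1.inter h2
  have hk : Measurable (Function.uncurry fun (p : (USphere N × USphere N) × ℝ) ρ =>
      polarKernel N s p.1.1 p.1.2 p.2 ρ) := measurable_polarKernel
  exact (hk.setLIntegral_of_param (μ := volume) hB).setLIntegral_of_param (μ := volume)
    (F := fun (a : USphere N × USphere N) r => ∫⁻ ρ in Set.Ico (min (R a.1) (R a.2))
      (max (R a.1) (R a.2)), polarKernel N s a.1 a.2 r ρ) hA

theorem rayEnergy_add_rayEnergy_of_le (x y : USphere N) {a b : ℝ} (ha : 0 < a) (hab : a ≤ b) :
    rayEnergy N s x y a b + rayEnergy N s x y b a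
      = rayEnergy N s x y a a + rayEnergy N s x y b b + bandEnergy N s x y a b := by
  have hK := measurable_polarKernel_radial (s := s) x y
  have hm : ∀ A : Set ℝ, Measurable fun r => ∫⁻ ρ in A, polarKernel N s x y r ρ :=
    fun A => hK.lintegral_prod_right
  have h1 : ∀ f : ℝ → ℝ≥0∞, ∫⁻ r in Set.Ioo 0 b, f r
      = (∫⁻ r in Set.Ioo 0 a, f r) + ∫⁻ r in Set.Ico a b, f r := by
    intro f
    rw [← Set.Ioo_union_Ico_eq_Ioo ha hab, lintegral_union measurableSet_Ico]
    exact Set.disjoint_left.2 fun z hz hz' => not_le.2 hz.2 hz'.1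
  have h2 : ∀ f : ℝ → ℝ≥0∞, ∫⁻ r in Set.Ici a, f r
      = (∫⁻ r in Set.Ico a b, f r) + ∫⁻ r in Set.Ici b, f r := by
    intro f
    rw [← Set.Ico_union_Ici_eq_Ici hab, lintegral_union measurableSet_Ici]
    exact Set.disjoint_left.2 fun z hz hz' => not_le.2 hz.2 hz'
  have h3 : rayEnergy N s x y b a = rayEnergy N s x y a a + (bandEnergy N s x y a b
      + ∫⁻ r in Set.Ico a b, ∫⁻ ρ in Set.Ici b, polarKernel N s x y r ρ) := by
    rw [rayEnergy, rayEnergy, bandEnergy, h1, min_eq_left hab, max_eq_right hab,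
      ← lintegral_add_left (hm _)]
    congr 1
    exact lintegral_congr fun r => h2 _
  have h4 : rayEnergy N s x y b b = rayEnergy N s x y a b
      + ∫⁻ r in Set.Ico a b, ∫⁻ ρ in Set.Ici b, polarKernel N s x y r ρ := by
    rw [rayEnergy, rayEnergy, h1]
  rw [h3, h4]
  ring

theorem rayEnergy_add_rayEnergy (x y : USphere N) {a b : ℝ} (ha : 0 < a) (hb : 0 < b) :
    rayEnergy N s x y a b + rayEnergy N s x y b a
      = rayEnergy N s x y a a + rayEnergy N s x y b b + bandEnergy N s x y a b := by
  rcases le_total a b with h | h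
  · exact rayEnergy_add_rayEnergy_of_le x y ha h
  · have : bandEnergy N s x y a b = bandEnergy N s x y b a := by
      rw [bandEnergy, bandEnergy, min_comm, max_comm]
    rw [this, add_comm, rayEnergy_add_rayEnergy_of_le x y hb h, add_comm (rayEnergy N s x y b b)]

theorem rayEnergy_self (x y : USphere N) {a : ℝ} (ha : 0 < a) :
    rayEnergy N s x y a a = ENNReal.ofReal (a ^ (N + 2 - s)) * rayEnergy N s x y 1 1 := by
  have hd : ∀ r : ℝ, HasDerivAt (fun r : ℝ => a * r) a r := fun r =>
    ((hasDerivAt_id r).const_mul a).congr_deriv (by simp)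
  have hinj : ∀ A : Set ℝ, Set.InjOn (fun r : ℝ => a * r) A :=
    fun A => (mul_right_injective₀ ha.ne').injOn
  have himg1 : (fun r : ℝ => a * r) '' Set.Ioo 0 1 = Set.Ioo 0 a := by
    rw [Set.image_mul_left_Ioo ha]; simp
  have himg2 : (fun r : ℝ => a * r) '' Set.Ici 1 = Set.Ici a := by
    rw [Set.image_mul_left_Ici ha, mul_one]
  have hk : ∀ r ρ : ℝ, 0 < r → 0 < ρ → ENNReal.ofReal |a| * (ENNReal.ofReal |a| *
      polarKernel N s x y (a * r) (a * ρ))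
      = ENNReal.ofReal (a ^ (N + 2 - s)) * polarKernel N s x y r ρ := by
    intro r ρ hr hρ
    simp only [polarKernel]
    rw [mul_smul, mul_smul, ← smul_sub, norm_smul, mul_rpow (norm_nonneg _) (norm_nonneg _),
      Real.norm_eq_abs, abs_of_pos ha]
    have hp : (0 : ℝ) ≤ ‖r • x.1 - ρ • y.1‖ ^ (-(((N + 2 : ℕ) : ℝ) + s)) :=
      rpow_nonneg (norm_nonneg _) _
    have hpa : (0 : ℝ) ≤ a ^ (-(((N + 2 : ℕ) : ℝ) + s)) := rpow_nonneg ha.le _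
    have hpb : (0 : ℝ) ≤ a ^ (N + 2 - s) := rpow_nonneg ha.le _
    repeat rw [← ENNReal.ofReal_mul (by positivity)]
    congr 1
    have e : a ^ (N + 2 - s)
        = a * (a * (a ^ (N + 1) * (a ^ (N + 1) * a ^ (-(((N + 2 : ℕ) : ℝ) + s))))) := by
      rw [show (N : ℝ) + 2 - s = 1 + (1 + (((N + 1 : ℕ) : ℝ) + (((N + 1 : ℕ) : ℝ)
        + -(((N + 2 : ℕ) : ℝ) + s)))) by push_cast; ring, rpow_add ha, rpow_add ha, rpow_add ha,
        rpow_add ha, rpow_one, rpow_natCast]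
    rw [e, mul_pow, mul_pow]
    ring
  rw [rayEnergy, ← himg1, lintegral_image_eq_lintegral_abs_deriv_mul measurableSet_Ioo
    (fun r _ => (hd r).hasDerivWithinAt) (hinj _), rayEnergy,
    ← lintegral_const_mul' _ _ ENNReal.ofReal_ne_top]
  refine setLIntegral_congr_fun measurableSet_Ioo fun r hr => ?_
  rw [← himg2, lintegral_image_eq_lintegral_abs_deriv_mul measurableSet_Ici
    (fun r _ => (hd r).hasDerivWithinAt) (hinj _), ← lintegral_const_mul' _ _ ENNReal.ofReal_ne_top,
    ← lintegral_const_mul' _ _ ENNReal.ofReal_ne_top]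
  refine setLIntegral_congr_fun measurableSet_Ici fun ρ hρ => ?_
  exact hk r ρ hr.1 (zero_lt_one.trans_le hρ)

theorem lintegral_rayEnergy_one_eq (x x' : USphere N) :
    ∫⁻ y, rayEnergy N s x y 1 1 ∂(surf N) = ∫⁻ y, rayEnergy N s x' y 1 1 ∂(surf N) := by
  obtain ⟨T, hT, -⟩ := exists_linearIsometryEquiv_map_pair (x := x.1) (y := x.1) (x' := x'.1)
    (y' := x'.1) (by simp) (by simp) (by simp)
  have hTx : sphereMap T x = x' := Subtype.ext hT
  have hm : Measurable fun y => rayEnergy N s x' y 1 1 :=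
    measurable_rayEnergy (by fun_prop) (by fun_prop) (by fun_prop) (by fun_prop)
  rw [← (measurePreserving_sphereMap T).lintegral_comp hm]
  refine lintegral_congr fun y => ?_
  simp only [rayEnergy, polarKernel, ← hTx, coe_sphereMap, ← map_smul, ← map_sub, T.norm_map]

end PolarPerimeter

section PolarDecomposition

open Real

variable {N : ℕ} {s : ℝ}

theorem fracPer_eq_rayEnergy {E : Set (EuclideanSpace ℝ (Fin (N + 2)))} {R : USphere N → ℝ}
    (hE : MeasurableSet E) (hR : Measurable R) (hR0 : ∀ x, 0 < R x)
    (hER : ∀ (x : USphere N) (r : ℝ), 0 < r → (r • x.1 ∈ E ↔ r < R x)) :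
    fracPer (N + 2) s E = ∫⁻ x, ∫⁻ y, rayEnergy N s x y (R x) (R y) ∂(surf N) ∂(surf N) := by
  let V := EuclideanSpace ℝ (Fin (N + 2))
  have hd : Module.finrank ℝ V - 1 = N + 1 := by simp [V]
  let k : V → V → ℝ≥0∞ := fun x y => ENNReal.ofReal (‖x - y‖ ^ (-(((N + 2 : ℕ) : ℝ) + s)))
  have hk : Measurable k.uncurry := by unfold k Function.uncurry; fun_prop
  have hin : ∀ z : V, ∫⁻ w in Eᶜ, k z w = ∫⁻ y : USphere N, ∫⁻ ρ in Set.Ici (R y),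
      ENNReal.ofReal (ρ ^ (N + 1)) * k z (ρ • y.1) ∂volume ∂(surf N) := by
    intro z
    have hkz : Measurable (k z) := hk.of_uncurry_left
    rw [← lintegral_indicator hE.compl, lintegral_polar volume (hkz.indicator hE.compl), hd]
    refine lintegral_congr fun y => ?_
    rw [← lintegral_indicator measurableSet_Ioi, ← lintegral_indicator measurableSet_Ici]
    refine lintegral_congr fun ρ => ?_
    by_cases h : R y ≤ ρ
    · have h0 := (hR0 y).trans_le h
      rw [Set.indicator_of_mem (Set.mem_Ioi.2 h0), Set.indicator_of_mem (Set.mem_Ici.2 h),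
        Set.indicator_of_mem (by simpa [hER y ρ h0] using h)]
    · rw [Set.indicator_of_notMem (s := Set.Ici (R y)) (by simpa using h)]
      by_cases h0 : 0 < ρ
      · rw [Set.indicator_of_mem (Set.mem_Ioi.2 h0),
          Set.indicator_of_notMem (by simpa [hER y ρ h0] using h), mul_zero]
      · rw [Set.indicator_of_notMem (by simpa using h0)]
  have hout : Measurable fun z : V => ∫⁻ w in Eᶜ, k z w := hk.lintegral_prod_right
  rw [fracPer, ← lintegral_indicator hE, lintegral_polar volume (hout.indicator hE), hd]
  refine lintegral_congr fun x => ?_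
  have h1 : ∫⁻ r in Set.Ioi (0 : ℝ), ENNReal.ofReal (r ^ (N + 1)) *
      E.indicator (fun z : V => ∫⁻ w in Eᶜ, k z w) (r • x.1)
      = ∫⁻ r in Set.Ioo 0 (R x), ∫⁻ y : USphere N, ∫⁻ ρ in Set.Ici (R y),
        polarKernel N s x y r ρ ∂volume ∂(surf N) := by
    rw [← lintegral_indicator measurableSet_Ioi, ← lintegral_indicator measurableSet_Ioo]
    refine lintegral_congr fun r => ?_
    by_cases h0 : 0 < r
    · by_cases h : r < R x
      · rw [Set.indicator_of_mem (Set.mem_Ioi.2 h0), Set.indicator_of_mem (Set.mem_Ioo.2 ⟨h0, h⟩),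
          Set.indicator_of_mem ((hER x r h0).2 h), hin,
          ← lintegral_const_mul' _ _ ENNReal.ofReal_ne_top]
        refine lintegral_congr fun y => ?_
        rw [← lintegral_const_mul' _ _ ENNReal.ofReal_ne_top]
        rfl
      · rw [Set.indicator_of_mem (Set.mem_Ioi.2 h0),
          Set.indicator_of_notMem (fun h' => h ((hER x r h0).1 h')), mul_zero,
          Set.indicator_of_notMem (s := Set.Ioo 0 (R x)) (fun h' => h h'.2)]
    · rw [Set.indicator_of_notMem (by simpa using h0), Set.indicator_of_notMem (fun h' => h0 h'.1)]
  refine h1.trans ?_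
  have hB : MeasurableSet {q : (ℝ × USphere N) × ℝ | R q.1.2 ≤ q.2} :=
    measurableSet_le (by fun_prop) (by fun_prop)
  have hK : Measurable (Function.uncurry fun (p : ℝ × USphere N) ρ =>
      polarKernel N s x p.2 p.1 ρ) :=
    measurable_polarKernel.comp (by fun_prop : Measurable fun q : (ℝ × USphere N) × ℝ =>
      (((x, q.1.2), q.1.1), q.2))
  rw [lintegral_lintegral_swap
    (hK.setLIntegral_of_param (μ := volume) hB).aemeasurable]
  rfl

theorem surf_univ_ne_zero : surf N Set.univ ≠ 0 := by
  simp [surf, Measure.toSphere_apply_univ, (measure_ball_pos volume _ one_pos).ne']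

theorem lintegral_rayEnergy_one (hs : s ∈ Set.Ioo 0 1) (x : USphere N) :
    ∫⁻ y, rayEnergy N s x y 1 1 ∂(surf N)
      = sphereArea N * ENNReal.ofReal (chordMass N s / (s * (N + 2 - s))) := by
  have h := fracPer_eq_rayEnergy (N := N) (s := s) (E := ball 0 1) (R := fun _ => 1)
    measurableSet_ball measurable_const (fun _ => one_pos) fun x r hr => by
      simp [norm_smul, abs_of_pos hr]
  rw [fracPer_ball hs, lintegral_congr fun x' => lintegral_rayEnergy_one_eq x' x,
    lintegral_const, mul_comm] at h
  exact ((ENNReal.mul_left_inj surf_univ_ne_zero (measure_ne_top _ _)).1 h).symm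

/-- The fractional perimeter of a starshaped set, up to a factor two, is a multiple of an integral
of a power of the radial function plus an interaction term. -/
theorem two_mul_fracPer (hs : s ∈ Set.Ioo 0 1) {E : Set (EuclideanSpace ℝ (Fin (N + 2)))}
    {R : USphere N → ℝ} (hE : MeasurableSet E) (hR : Measurable R) (hR0 : ∀ x, 0 < R x)
    (hER : ∀ (x : USphere N) (r : ℝ), 0 < r → (r • x.1 ∈ E ↔ r < R x)) :
    2 * fracPer (N + 2) s E
      = 2 * (sphereArea N * ENNReal.ofReal (chordMass N s / (s * (N + 2 - s))) *
          ∫⁻ x, ENNReal.ofReal (R x ^ (N + 2 - s)) ∂(surf N))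
        + ∫⁻ x, ∫⁻ y, bandEnergy N s x y (R x) (R y) ∂(surf N) ∂(surf N) := by
  have m1 : Measurable fun p : USphere N × USphere N => rayEnergy N s p.1 p.2 (R p.1) (R p.2) :=
    measurable_rayEnergy (by fun_prop) (by fun_prop) (by fun_prop) (by fun_prop)
  have m2 : Measurable fun p : USphere N × USphere N => rayEnergy N s p.1 p.2 (R p.1) (R p.1) :=
    measurable_rayEnergy (by fun_prop) (by fun_prop) (by fun_prop) (by fun_prop)
  have m3 : Measurable fun p : USphere N × USphere N => rayEnergy N s p.1 p.2 (R p.2) (R p.2) :=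
    measurable_rayEnergy (by fun_prop) (by fun_prop) (by fun_prop) (by fun_prop)
  have hswap : fracPer (N + 2) s E
      = ∫⁻ x, ∫⁻ y, rayEnergy N s x y (R y) (R x) ∂(surf N) ∂(surf N) := by
    rw [fracPer_eq_rayEnergy hE hR hR0 hER, lintegral_lintegral_swap m1.aemeasurable]
    simp only [rayEnergy_comm]
  have hdiag : ∫⁻ x, ∫⁻ y, rayEnergy N s x y (R x) (R x) ∂(surf N) ∂(surf N)
      = sphereArea N * ENNReal.ofReal (chordMass N s / (s * (N + 2 - s))) *
          ∫⁻ x, ENNReal.ofReal (R x ^ (N + 2 - s)) ∂(surf N) := by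
    rw [← lintegral_const_mul _ (by fun_prop)]
    refine lintegral_congr fun x => ?_
    simp only [rayEnergy_self x _ (hR0 x)]
    rw [lintegral_const_mul' _ _ ENNReal.ofReal_ne_top, lintegral_rayEnergy_one hs, mul_comm]
  have hdiag' : ∫⁻ x, ∫⁻ y, rayEnergy N s x y (R y) (R y) ∂(surf N) ∂(surf N)
      = ∫⁻ x, ∫⁻ y, rayEnergy N s x y (R x) (R x) ∂(surf N) ∂(surf N) := by
    rw [lintegral_lintegral_swap m3.aemeasurable]
    simp only [rayEnergy_comm]
  rw [two_mul, two_mul, ← hdiag]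
  nth_rw 2 [← hdiag']
  nth_rw 2 [hswap]
  rw [fracPer_eq_rayEnergy hE hR hR0 hER, ← lintegral_add_left m1.lintegral_prod_right',
    ← lintegral_add_left m2.lintegral_prod_right',
    ← lintegral_add_right _ (measurable_bandEnergy hR).lintegral_prod_right']
  refine lintegral_congr fun x => ?_
  have mx : Measurable fun y : USphere N => (x, y) := by fun_prop
  have n1 : Measurable fun y => rayEnergy N s x y (R x) (R y) := m1.comp mx
  have n2 : Measurable fun y => rayEnergy N s x y (R x) (R x) := m2.comp mx
  have n4 : Measurable fun y => bandEnergy N s x y (R x) (R y) := (measurable_bandEnergy hR).comp mx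
  rw [← lintegral_add_left n1, ← lintegral_add_left n2, ← lintegral_add_right _ n4]
  exact lintegral_congr fun y => rayEnergy_add_rayEnergy x y (hR0 x) (hR0 y)

end PolarDecomposition

section BandEstimates

open Real
open scoped RealInnerProductSpace

variable {N : ℕ} {s ε : ℝ}

/-- The constant in the lower bound of `bandEnergy` by the kernel `rieszKernel`. -/
noncomputable def bandConst (N : ℕ) (ε : ℝ) : ℝ :=
  (1 - ε) ^ (2 * N + 2) * (ε ^ 2 + (1 + ε) ^ 2) ^ (-((N : ℝ) + 3) / 2)

theorem lintegral_band_const (a b : ℝ) (c : ℝ≥0∞) :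
    ∫⁻ _ in Set.Ico (min a b) (max a b), ∫⁻ _ in Set.Ico (min a b) (max a b), c
      = c * ENNReal.ofReal ((b - a) ^ 2) := by
  rw [setLIntegral_const, setLIntegral_const, Real.volume_Ico, max_sub_min_eq_abs, ← sq_abs,
    pow_two, ENNReal.ofReal_mul (abs_nonneg _), mul_assoc]

theorem le_bandEnergy (hs : s ∈ Set.Ioo 0 1) (hε : ε ∈ Set.Ioo 0 1) (x y : USphere N) {a b : ℝ}
    (ha : a ∈ Set.Icc (1 - ε) (1 + ε)) (hb : b ∈ Set.Icc (1 - ε) (1 + ε))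
    (hab : |b - a| ≤ ε * ‖x.1 - y.1‖) :
    ENNReal.ofReal (bandConst N ε) * (ENNReal.ofReal (rieszKernel N s x y) *
      ENNReal.ofReal ((b - a) ^ 2)) ≤ bandEnergy N s x y a b := by
  obtain ⟨hε0, hε1⟩ := hε
  obtain ⟨hs0, hs1⟩ := hs
  have hN : (0 : ℝ) ≤ N := Nat.cast_nonneg N
  have hA : 1 ≤ ε ^ 2 + (1 + ε) ^ 2 := by nlinarith
  have hA0 : 0 < ε ^ 2 + (1 + ε) ^ 2 := by linarith
  have hκ : 0 ≤ bandConst N ε :=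
    mul_nonneg (pow_nonneg (by linarith) _) (rpow_nonneg (by positivity) _)
  rcases eq_or_ne x y with rfl | hxy
  · have : rieszKernel N s x x = 0 := by
      rw [rieszKernel, sub_self, norm_zero, zero_rpow]
      push_cast
      linarith
    simp [this]
  have hD : 0 < ‖x.1 - y.1‖ := norm_pos_iff.2 (sub_ne_zero.2 (Subtype.coe_injective.ne hxy))
  rw [← mul_assoc, ← ENNReal.ofReal_mul hκ, ← lintegral_band_const a b, bandEnergy]
  have hmin : 1 - ε ≤ min a b := le_min ha.1 hb.1
  have hmax : max a b ≤ 1 + ε := max_le ha.2 hb.2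
  refine setLIntegral_mono' measurableSet_Ico fun r hr => setLIntegral_mono' measurableSet_Ico
    fun ρ hρ => ?_
  have hr1 : 1 - ε ≤ r := hmin.trans hr.1
  have hρ1 : 1 - ε ≤ ρ := hmin.trans hρ.1
  have hr2 : r ≤ 1 + ε := hr.2.le.trans hmax
  have hρ2 : ρ ≤ 1 + ε := hρ.2.le.trans hmax
  have hr0 : 0 < r := by linarith
  have hρ0 : 0 < ρ := by linarith
  have hrρ : |r - ρ| ≤ ε * ‖x.1 - y.1‖ := by
    refine le_trans ?_ hab
    rw [← max_sub_min_eq_abs a b]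
    exact abs_sub_le_iff.2 ⟨by linarith [hr.2, hρ.1], by linarith [hρ.2, hr.1]⟩
  have hsq : ‖r • x.1 - ρ • y.1‖ ^ 2 ≤ (ε ^ 2 + (1 + ε) ^ 2) * ‖x.1 - y.1‖ ^ 2 := by
    rw [norm_smul_sub_smul_sq (by simp) (by simp), add_mul]
    refine add_le_add ?_ ?_
    · rw [← mul_pow, ← sq_abs]
      exact pow_le_pow_left₀ (abs_nonneg _) hrρ 2
    · refine mul_le_mul_of_nonneg_right ?_ (by positivity)
      rw [pow_two]
      exact mul_le_mul hr2 hρ2 hρ0.le (by linarith)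
  have hpos : 0 < ‖r • x.1 - ρ • y.1‖ ^ 2 := by
    rw [norm_smul_sub_smul_sq (by simp) (by simp)]
    positivity
  have hp : ∀ t : ℝ, 0 ≤ t → t ^ (-(((N + 2 : ℕ) : ℝ) + s))
      = (t ^ 2) ^ (-(((N + 2 : ℕ) : ℝ) + s) / 2) := fun t ht => by
    rw [← rpow_natCast, ← rpow_mul ht]
    congr 1
    push_cast
    ring
  have hexp : -(((N + 2 : ℕ) : ℝ) + s) / 2 ≤ 0 := by push_cast; linarith
  have h1 : (ε ^ 2 + (1 + ε) ^ 2) ^ (-((N : ℝ) + 3) / 2) * rieszKernel N s x y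
      ≤ ‖r • x.1 - ρ • y.1‖ ^ (-(((N + 2 : ℕ) : ℝ) + s)) := by
    rw [rieszKernel, hp _ (norm_nonneg _), hp _ (norm_nonneg _)]
    refine le_trans ?_ (rpow_le_rpow_of_nonpos hpos hsq hexp)
    rw [mul_rpow hA0.le (by positivity)]
    refine mul_le_mul_of_nonneg_right (rpow_le_rpow_of_exponent_le hA ?_)
      (rpow_nonneg (by positivity) _)
    push_cast
    linarith
  have h2 : (1 - ε) ^ (2 * N + 2) ≤ r ^ (N + 1) * ρ ^ (N + 1) := by
    rw [show 2 * N + 2 = (N + 1) + (N + 1) by ring, pow_add]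
    have h0 : 0 ≤ 1 - ε := by linarith
    exact mul_le_mul (pow_le_pow_left₀ h0 hr1 _) (pow_le_pow_left₀ h0 hρ1 _) (by positivity)
      (by positivity)
  rw [polarKernel, ← ENNReal.ofReal_mul (by positivity), ← ENNReal.ofReal_mul (by positivity),
    bandConst, mul_assoc, ← mul_assoc (r ^ (N + 1))]
  refine ENNReal.ofReal_le_ofReal (mul_le_mul h2 h1 ?_ (by positivity))
  exact mul_nonneg (by positivity) (rpow_nonneg (norm_nonneg _) _)

theorem bandEnergy_le (hs : s ∈ Set.Ioo 0 1) (hε : ε ∈ Set.Ioo 0 1) (x y : USphere N) {a b : ℝ}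
    (ha : a ∈ Set.Icc (1 - ε) (1 + ε)) (hb : b ∈ Set.Icc (1 - ε) (1 + ε))
    (hab : |b - a| ≤ ε * ‖x.1 - y.1‖) :
    bandEnergy N s x y a b ≤
      ENNReal.ofReal ((1 + ε) ^ (2 * N + 2) * (1 - ε) ^ (-(((N + 2 : ℕ) : ℝ) + s)) * ε ^ 2) *
        (ENNReal.ofReal (rieszKernel N s x y) * ENNReal.ofReal (‖x.1 - y.1‖ ^ 2)) := by
  obtain ⟨hε0, hε1⟩ := hε
  obtain ⟨hs0, hs1⟩ := hs
  have hN : (0 : ℝ) ≤ N := Nat.cast_nonneg N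
  have hε2 : 0 < 1 - ε := by linarith
  rcases eq_or_ne x y with rfl | hxy
  · have : b - a = 0 := by simpa using hab
    have : a = b := by linarith
    simp [bandEnergy, this]
  have hD : 0 < ‖x.1 - y.1‖ := norm_pos_iff.2 (sub_ne_zero.2 (Subtype.coe_injective.ne hxy))
  have hmin : 1 - ε ≤ min a b := le_min ha.1 hb.1
  have hmax : max a b ≤ 1 + ε := max_le ha.2 hb.2
  have hk : 0 ≤ rieszKernel N s x y := rpow_nonneg (norm_nonneg _) _
  have hC : 0 ≤ (1 - ε) ^ (-(((N + 2 : ℕ) : ℝ) + s)) := rpow_nonneg hε2.le _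
  have hstep : bandEnergy N s x y a b ≤ ENNReal.ofReal ((1 + ε) ^ (2 * N + 2) *
      ((1 - ε) ^ (-(((N + 2 : ℕ) : ℝ) + s)) * rieszKernel N s x y)) *
        ENNReal.ofReal ((b - a) ^ 2) := by
    rw [← lintegral_band_const a b, bandEnergy]
    refine setLIntegral_mono' measurableSet_Ico fun r hr => setLIntegral_mono' measurableSet_Ico
      fun ρ hρ => ?_
    have hr1 : 1 - ε ≤ r := hmin.trans hr.1
    have hρ1 : 1 - ε ≤ ρ := hmin.trans hρ.1
    have hr2 : r ≤ 1 + ε := hr.2.le.trans hmax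
    have hρ2 : ρ ≤ 1 + ε := hρ.2.le.trans hmax
    have hr0 : 0 < r := by linarith
    have hρ0 : 0 < ρ := by linarith
    have hlow : (1 - ε) * ‖x.1 - y.1‖ ≤ ‖r • x.1 - ρ • y.1‖ := by
      rw [← sq_le_sq₀ (by positivity) (norm_nonneg _), norm_smul_sub_smul_sq (by simp) (by simp),
        mul_pow]
      have : (1 - ε) ^ 2 ≤ r * ρ := by
        rw [pow_two]; exact mul_le_mul hr1 hρ1 hε2.le hr0.le
      nlinarith [sq_nonneg (r - ρ), mul_le_mul_of_nonneg_right this (sq_nonneg ‖x.1 - y.1‖)]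
    have h1 : ‖r • x.1 - ρ • y.1‖ ^ (-(((N + 2 : ℕ) : ℝ) + s))
        ≤ (1 - ε) ^ (-(((N + 2 : ℕ) : ℝ) + s)) * rieszKernel N s x y := by
      rw [rieszKernel, ← mul_rpow hε2.le hD.le]
      refine rpow_le_rpow_of_nonpos (by positivity) hlow ?_
      push_cast
      linarith
    have h2 : r ^ (N + 1) * ρ ^ (N + 1) ≤ (1 + ε) ^ (2 * N + 2) := by
      rw [show 2 * N + 2 = (N + 1) + (N + 1) by ring, pow_add _ (N + 1) (N + 1)]
      exact mul_le_mul (pow_le_pow_left₀ hr0.le hr2 _) (pow_le_pow_left₀ hρ0.le hρ2 _)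
        (by positivity) (by positivity)
    rw [polarKernel, ← ENNReal.ofReal_mul (by positivity), ← ENNReal.ofReal_mul (by positivity),
      ← mul_assoc (r ^ (N + 1))]
    exact ENNReal.ofReal_le_ofReal (mul_le_mul h2 h1 (rpow_nonneg (norm_nonneg _) _)
      (by positivity))
  refine hstep.trans ?_
  have hsq : (b - a) ^ 2 ≤ ε ^ 2 * ‖x.1 - y.1‖ ^ 2 := by
    rw [← mul_pow, ← sq_abs]
    exact pow_le_pow_left₀ (abs_nonneg _) hab 2
  rw [← ENNReal.ofReal_mul (by positivity), ← ENNReal.ofReal_mul (by positivity),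
    ← ENNReal.ofReal_mul (by positivity)]
  refine ENNReal.ofReal_le_ofReal ?_
  calc _ ≤ (1 + ε) ^ (2 * N + 2) * ((1 - ε) ^ (-(((N + 2 : ℕ) : ℝ) + s)) * rieszKernel N s x y) *
      (ε ^ 2 * ‖x.1 - y.1‖ ^ 2) := mul_le_mul_of_nonneg_left hsq (by positivity)
    _ = _ := by ring

theorem lintegral_rieszKernel_mul_sq (hs : s ∈ Set.Ioo 0 1) (x : USphere N) :
    ∫⁻ y, ENNReal.ofReal (rieszKernel N s x y) * ENNReal.ofReal (‖x.1 - y.1‖ ^ 2) ∂(surf N)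
      = sphereArea N * ENNReal.ofReal (chordMass N s) := by
  let e : EuclideanSpace ℝ (Fin (N + 2)) := EuclideanSpace.single 0 1
  have he : ‖e‖ = 1 := by simp [e]
  obtain ⟨T, hT, -⟩ := exists_linearIsometryEquiv_map_pair (x := e) (y := e) (x' := x.1)
    (y' := x.1) (by simp [he]) (by simp [he]) (by simp [he])
  let ψ : ℝ → ℝ≥0∞ := fun t => ENNReal.ofReal (√(2 - 2 * t) ^ (-(((N + 2 : ℕ) : ℝ) + s))) *
    ENNReal.ofReal (√(2 - 2 * t) ^ 2)
  have hψ : Measurable ψ := by unfold ψ; fun_prop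
  have hm : Measurable fun y => ENNReal.ofReal (rieszKernel N s x y) *
      ENNReal.ofReal (‖x.1 - y.1‖ ^ 2) := by
    unfold rieszKernel; fun_prop
  rw [← (measurePreserving_sphereMap T).lintegral_comp hm]
  have h1 : ∀ y : USphere N, ENNReal.ofReal (rieszKernel N s x (sphereMap T y)) *
      ENNReal.ofReal (‖x.1 - (sphereMap T y).1‖ ^ 2) = ψ (y.1 0) := by
    intro y
    have hn : ‖x.1 - T y.1‖ = √(2 - 2 * y.1 0) := by
      rw [← hT, ← map_sub, T.norm_map, ← sqrt_sq (norm_nonneg (e - y.1)), norm_sub_sq_real, he]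
      congr 1
      simp [e, EuclideanSpace.inner_single_left]
      ring
    simp only [rieszKernel, coe_sphereMap, hn, ψ]
  rw [lintegral_congr h1, lintegral_zonal N hψ, chordMass,
    intervalIntegral.integral_of_le pi_pos.le, integral_Ioc_eq_integral_Ioo,
    ofReal_integral_eq_lintegral_ofReal]
  · congr 1
    refine setLIntegral_congr_fun measurableSet_Ioo fun θ hθ => ?_
    have hS := sin_half_pos hθ
    have hC := cos_half_pos hθ
    have e1 : √(2 - 2 * cos θ) = 2 * sin (θ / 2) := by
      rw [two_sub_two_cos, sqrt_sq (by positivity)]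
    have e2 : sin θ = 2 * sin (θ / 2) * cos (θ / 2) := by
      rw [← sin_two_mul]; ring_nf
    have e3 : (2 * sin (θ / 2)) ^ (-s) = (2 * sin (θ / 2)) ^ N * ((2 * sin (θ / 2)) ^ 2 *
        (2 * sin (θ / 2)) ^ (-(((N + 2 : ℕ) : ℝ) + s))) := by
      rw [← mul_assoc, ← pow_add, ← rpow_natCast, ← rpow_add (by positivity)]
      congr 1
      ring
    simp only [ψ]
    rw [e1, e2, ← ENNReal.ofReal_mul (rpow_nonneg (by positivity) _),
      ← ENNReal.ofReal_mul (by positivity), chordKernel, e3, mul_pow]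
    congr 1
    ring
  · have := (intervalIntegrable_chordKernel (N := N) hs)
    exact ((intervalIntegrable_iff_integrableOn_Ioc_of_le pi_pos.le).1 this).mono_set
      Set.Ioo_subset_Ioc_self
  · refine (ae_restrict_iff' measurableSet_Ioo).2 (.of_forall fun θ hθ => ?_)
    have hS := sin_half_pos hθ
    have hC := cos_half_pos hθ
    simp only [Pi.zero_apply, chordKernel]
    positivity

end BandEstimates

section NearlySphericalPerimeter

open Real

variable {N : ℕ} {s ε : ℝ}

/-- The first nonzero eigenvalue of the quadratic form `sphereEnergy (rieszKernel N s)`, relative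
to the squared `L²` norm. -/
noncomputable def rieszGap (N : ℕ) (s : ℝ) : ℝ := (sphereArea N).toReal * chordMass N s

theorem sphereArea_ne_top : sphereArea N ≠ ∞ := by
  intro h
  have := surf_univ (N := N)
  rw [h, ENNReal.top_mul (by simpa using cosMoment_zero_pos)] at this
  exact measure_ne_top _ _ this

theorem surf_real_univ : (surf N).real Set.univ = (sphereArea N).toReal * cosMoment N 0 := by
  rw [measureReal_def, surf_univ, ENNReal.toReal_mul, ENNReal.toReal_ofReal cosMoment_zero_pos.le]

theorem surf_real_univ_pos : 0 < (surf N).real Set.univ :=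
  ENNReal.toReal_pos surf_univ_ne_zero (measure_ne_top _ _)

theorem sphereArea_toReal_pos : 0 < (sphereArea N).toReal := by
  have h := surf_real_univ_pos (N := N)
  rw [surf_real_univ] at h
  exact pos_of_mul_pos_left h cosMoment_zero_pos.le

theorem rieszGap_pos (hs : s ∈ Set.Ioo 0 1) : 0 < rieszGap N s :=
  mul_pos sphereArea_toReal_pos (chordMass_pos hs)

theorem fracPer_ball_toReal (hs : s ∈ Set.Ioo 0 1) :
    (fracPer (N + 2) s (ball 0 1)).toReal
      = (surf N).real Set.univ * (rieszGap N s / (s * (N + 2 - s))) := by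
  have h0 : (0 : ℝ) < N + 2 - s := by linarith [(Nat.cast_nonneg N : (0 : ℝ) ≤ N), hs.2]
  rw [fracPer_ball hs, ENNReal.toReal_mul, ENNReal.toReal_mul, ENNReal.toReal_ofReal, rieszGap,
    measureReal_def]
  · ring
  · exact div_nonneg (chordMass_pos hs).le (mul_nonneg hs.1.le h0.le)

/-- A lower bound for the fractional perimeter of a nearly spherical set. -/
theorem fracPer_ne_top_and_le (hs : s ∈ Set.Ioo 0 1) (hε : ε ∈ Set.Ioo 0 1) {u : USphere N → ℝ}
    (hu : Continuous u) (huε : ∀ x, |u x| ≤ ε) (hul : ∀ x y, |u y - u x| ≤ ε * ‖x.1 - y.1‖)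
    {E : Set (EuclideanSpace ℝ (Fin (N + 2)))} (hE : MeasurableSet E)
    (hER : ∀ (x : USphere N) (r : ℝ), 0 < r → (r • x.1 ∈ E ↔ r < 1 + u x)) :
    fracPer (N + 2) s E ≠ ∞ ∧
      2 * (rieszGap N s / (s * (N + 2 - s)) * ∫ x, (1 + u x) ^ (N + 2 - s) ∂(surf N))
        + bandConst N ε * (rieszGap N s / (surf N).real Set.univ * ((1 + spectralGain N) *
          ((surf N).real Set.univ * (∫ x, u x ^ 2 ∂(surf N)) - (∫ x, u x ∂(surf N)) ^ 2)
            - spectralGain N * (N + 2) * ‖∫ x, u x • x.1 ∂(surf N)‖ ^ 2))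
      ≤ 2 * (fracPer (N + 2) s E).toReal := by
  have hI : ∀ x, 1 + u x ∈ Set.Icc (1 - ε) (1 + ε) := fun x =>
    ⟨by linarith [(abs_le.1 (huε x)).1], by linarith [(abs_le.1 (huε x)).2]⟩
  have hR0 : ∀ x, 0 < 1 + u x := fun x => by linarith [(hI x).1, hε.2]
  have hsub : ∀ x y, |1 + u y - (1 + u x)| ≤ ε * ‖x.1 - y.1‖ := fun x y => by
    rw [add_sub_add_left_eq_sub]; exact hul x y
  have h0 : (0 : ℝ) < N + 2 - s := by linarith [(Nat.cast_nonneg N : (0 : ℝ) ≤ N), hs.2]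
  have hΛ := chordMass_pos (N := N) hs
  have hgap := rieszGap_pos (N := N) hs
  have hdec := two_mul_fracPer hs hE (by fun_prop : Measurable fun x => 1 + u x) hR0 hER
  have hp : Continuous fun x => (1 + u x) ^ (N + 2 - s) :=
    (by fun_prop : Continuous fun x => 1 + u x).rpow_const fun x => Or.inl (hR0 x).ne'
  have hpow : ∫⁻ x, ENNReal.ofReal ((1 + u x) ^ (N + 2 - s)) ∂(surf N)
      = ENNReal.ofReal (∫ x, (1 + u x) ^ (N + 2 - s) ∂(surf N)) :=
    (ofReal_integral_eq_lintegral_ofReal (integrable_surf hp)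
      (.of_forall fun x => rpow_nonneg (hR0 x).le _)).symm
  have hJ : 0 ≤ ∫ x, (1 + u x) ^ (N + 2 - s) ∂(surf N) :=
    integral_nonneg fun x => rpow_nonneg (hR0 x).le _
  have hS : sphereArea N * ENNReal.ofReal (chordMass N s / (s * (N + 2 - s)))
      = ENNReal.ofReal (rieszGap N s / (s * (N + 2 - s))) := by
    rw [rieszGap, mul_div_assoc, ENNReal.ofReal_mul ENNReal.toReal_nonneg,
      ENNReal.ofReal_toReal sphereArea_ne_top]
  rw [hpow, hS, ← ENNReal.ofReal_mul (div_nonneg hgap.le (mul_nonneg hs.1.le h0.le))] at hdec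
  set J := ∫ x, (1 + u x) ^ (N + 2 - s) ∂(surf N)
  have hQtop : ∫⁻ x, ∫⁻ y, bandEnergy N s x y (1 + u x) (1 + u y) ∂(surf N) ∂(surf N) ≠ ∞ := by
    refine ne_top_of_le_ne_top ?_ (lintegral_mono fun x => lintegral_mono fun y =>
      bandEnergy_le hs hε x y (hI x) (hI y) (hsub x y))
    simp only [lintegral_const_mul' _ _ ENNReal.ofReal_ne_top, lintegral_rieszKernel_mul_sq hs,
      lintegral_const]
    exact ENNReal.mul_ne_top ENNReal.ofReal_ne_top (ENNReal.mul_ne_top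
      (ENNReal.mul_ne_top sphereArea_ne_top ENNReal.ofReal_ne_top) (measure_ne_top _ _))
  have hQlow : ENNReal.ofReal (bandConst N ε) * sphereEnergy (rieszKernel N s) u
      ≤ ∫⁻ x, ∫⁻ y, bandEnergy N s x y (1 + u x) (1 + u y) ∂(surf N) ∂(surf N) := by
    rw [sphereEnergy, ← lintegral_const_mul' _ _ ENNReal.ofReal_ne_top]
    refine lintegral_mono fun x => ?_
    simp only
    rw [← lintegral_const_mul' _ _ ENNReal.ofReal_ne_top]
    refine lintegral_mono fun y => ?_
    have := le_bandEnergy hs hε x y (hI x) (hI y) (hsub x y)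
    rwa [add_sub_add_left_eq_sub] at this
  have hfin : 2 * fracPer (N + 2) s E ≠ ∞ := by
    rw [hdec]
    exact ENNReal.add_ne_top.2 ⟨ENNReal.mul_ne_top ENNReal.ofNat_ne_top ENNReal.ofReal_ne_top,
      hQtop⟩
  have hκ : 0 ≤ bandConst N ε :=
    mul_nonneg (pow_nonneg (by linarith [hε.2]) _) (rpow_nonneg (by positivity) _)
  refine ⟨fun h => hfin (by simp [h]), ?_⟩
  have hred : rieszGap N s / (surf N).real Set.univ = chordMass N s / cosMoment N 0 := by
    rw [surf_real_univ, rieszGap, mul_div_mul_left _ _ sphereArea_toReal_pos.ne']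
  have hlow := (mul_le_mul_right (le_sphereEnergy_rieszKernel hs hu)
    (ENNReal.ofReal (bandConst N ε))).trans hQlow
  rw [← ENNReal.ofReal_mul hκ, ENNReal.ofReal_le_iff_le_toReal hQtop] at hlow
  have h2 : 2 * (fracPer (N + 2) s E).toReal = (2 * fracPer (N + 2) s E).toReal := by
    simp
  rw [h2, hdec, ENNReal.toReal_add (ENNReal.mul_ne_top ENNReal.ofNat_ne_top ENNReal.ofReal_ne_top)
    hQtop, ENNReal.toReal_mul, ENNReal.toReal_ofReal
      (mul_nonneg (div_nonneg hgap.le (mul_nonneg hs.1.le h0.le)) hJ), hred]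
  simpa using hlow

end NearlySphericalPerimeter

section RadialSets

open Real

variable {N : ℕ} {E : Set (EuclideanSpace ℝ (Fin (N + 2)))} {R : USphere N → ℝ}

theorem volume_eq_lintegral_radius (hE : MeasurableSet E) (hR0 : ∀ x, 0 < R x)
    (hER : ∀ (x : USphere N) (r : ℝ), 0 < r → (r • x.1 ∈ E ↔ r < R x)) :
    volume E = ∫⁻ x, ENNReal.ofReal (R x ^ (N + 2) / (N + 2)) ∂(surf N) := by
  have hd : Module.finrank ℝ (EuclideanSpace ℝ (Fin (N + 2))) - 1 = N + 1 := by simp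
  rw [← lintegral_indicator_one hE, lintegral_polar volume (measurable_one.indicator hE), hd]
  refine lintegral_congr fun x => ?_
  have h := setLIntegral_Ioo_pow (N + 1) (hR0 x).le
  push_cast at h
  rw [show ((N : ℝ) + 2) = N + 1 + 1 by ring, ← h, ← lintegral_indicator measurableSet_Ioi,
    ← lintegral_indicator measurableSet_Ioo]
  refine lintegral_congr fun r => ?_
  by_cases h0 : 0 < r
  · by_cases h1 : r < R x
    · rw [Set.indicator_of_mem (Set.mem_Ioi.2 h0), Set.indicator_of_mem (Set.mem_Ioo.2 ⟨h0, h1⟩),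
        Set.indicator_of_mem ((hER x r h0).2 h1), Pi.one_apply, mul_one]
    · rw [Set.indicator_of_mem (Set.mem_Ioi.2 h0),
        Set.indicator_of_notMem (s := Set.Ioo 0 (R x)) fun h => h1 h.2,
        Set.indicator_of_notMem fun h => h1 ((hER x r h0).1 h), mul_zero]
  · rw [Set.indicator_of_notMem (by simpa using h0), Set.indicator_of_notMem fun h => h0 h.1]

theorem integral_id_eq_integral_radius (hE : MeasurableSet E) (hb : IsBounded E)
    (hR0 : ∀ x, 0 < R x)
    (hER : ∀ (x : USphere N) (r : ℝ), 0 < r → (r • x.1 ∈ E ↔ r < R x)) :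
    ∫ x in E, x = ∫ x, (R x ^ (N + 3) / (N + 3)) • x.1 ∂(surf N) := by
  have hd : Module.finrank ℝ (EuclideanSpace ℝ (Fin (N + 2))) - 1 = N + 1 := by simp
  have hint : Integrable (E.indicator fun x => x) := by
    obtain ⟨C, hC⟩ := hb.exists_norm_le
    rw [integrable_indicator_iff hE]
    exact Measure.integrableOn_of_bounded (M := C) hb.measure_lt_top.ne
      aestronglyMeasurable_id ((ae_restrict_mem hE).mono hC)
  rw [← integral_indicator hE, integral_polar volume hint, hd]
  refine integral_congr_ae (.of_forall fun x => ?_)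
  have h : ∫ r in Set.Ioo 0 (R x), r ^ (N + 2) = R x ^ (N + 3) / (N + 3) := by
    rw [← integral_Ioc_eq_integral_Ioo, ← intervalIntegral.integral_of_le (hR0 x).le, integral_pow]
    push_cast
    ring_nf
  simp only
  rw [← h, ← integral_smul_const, ← integral_indicator measurableSet_Ioi,
    ← integral_indicator measurableSet_Ioo]
  refine integral_congr_ae (.of_forall fun r => ?_)
  by_cases h0 : 0 < r
  · by_cases h1 : r < R x
    · rw [Set.indicator_of_mem (Set.mem_Ioi.2 h0), Set.indicator_of_mem (Set.mem_Ioo.2 ⟨h0, h1⟩),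
        Set.indicator_of_mem ((hER x r h0).2 h1), smul_smul, ← pow_succ]
    · rw [Set.indicator_of_mem (Set.mem_Ioi.2 h0),
        Set.indicator_of_notMem (s := Set.Ioo 0 (R x)) fun h => h1 h.2,
        Set.indicator_of_notMem fun h => h1 ((hER x r h0).1 h), smul_zero]
  · rw [Set.indicator_of_notMem (by simpa using h0), Set.indicator_of_notMem fun h => h0 h.1]

theorem volume_symmDiff_ball_le {u : USphere N → ℝ} (hu : Continuous u) (hE : MeasurableSet E)
    (hu1 : ∀ x, |u x| ≤ 1)
    (hER : ∀ (x : USphere N) (r : ℝ), 0 < r → (r • x.1 ∈ E ↔ r < 1 + u x)) :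
    volume (E ∆ ball 0 1) ≤ ENNReal.ofReal (2 ^ (N + 1) * ∫ x, |u x| ∂(surf N)) := by
  have hd : Module.finrank ℝ (EuclideanSpace ℝ (Fin (N + 2))) - 1 = N + 1 := by simp
  have hD : MeasurableSet (E ∆ ball 0 1) := hE.symmDiff measurableSet_ball
  rw [ENNReal.ofReal_mul (by positivity), ofReal_integral_eq_lintegral_ofReal
    (integrable_surf hu.abs) (.of_forall fun x => abs_nonneg _),
    ← lintegral_const_mul' _ _ ENNReal.ofReal_ne_top, ← lintegral_indicator_one hD,
    lintegral_polar volume (measurable_one.indicator hD), hd]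
  refine lintegral_mono fun x => ?_
  have hB : ∀ r : ℝ, 0 < r → (r • x.1 ∈ ball (0 : EuclideanSpace ℝ (Fin (N + 2))) 1 ↔ r < 1) := by
    intro r hr
    rw [mem_ball_zero_iff, norm_smul, norm_eq_of_mem_sphere, mul_one, norm_of_nonneg hr.le]
  have hI : ∫⁻ r in Set.Icc (min 1 (1 + u x)) (max 1 (1 + u x)), ENNReal.ofReal (2 ^ (N + 1))
      = ENNReal.ofReal (2 ^ (N + 1)) * ENNReal.ofReal |u x| := by
    rw [setLIntegral_const, volume_Icc, max_sub_min_eq_abs]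
    simp
  simp only
  rw [← hI, ← lintegral_indicator measurableSet_Ioi, ← lintegral_indicator measurableSet_Icc]
  refine lintegral_mono fun r => ?_
  by_cases h0 : 0 < r
  · rw [Set.indicator_of_mem (Set.mem_Ioi.2 h0)]
    by_cases h1 : r • x.1 ∈ E ∆ ball 0 1
    · have h2 : r ∈ Set.Icc (min 1 (1 + u x)) (max 1 (1 + u x)) := by
        rw [Set.mem_symmDiff, hER x r h0, hB r h0] at h1
        simp only [Set.mem_Icc, min_le_iff, le_max_iff]
        grind
      have h3 : r ≤ 2 := h2.2.trans (max_le (by norm_num) (by linarith [(abs_le.1 (hu1 x)).2]))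
      rw [Set.indicator_of_mem h1, Set.indicator_of_mem h2, Pi.one_apply, mul_one]
      exact ENNReal.ofReal_le_ofReal (pow_le_pow_left₀ h0.le h3 _)
    · rw [Set.indicator_of_notMem h1, mul_zero]
      exact zero_le
  · rw [Set.indicator_of_notMem (by simpa using h0)]
    exact zero_le

theorem sq_integral_abs_le {u : USphere N → ℝ} (hu : Continuous u) :
    (∫ x, |u x| ∂(surf N)) ^ 2 ≤ (surf N).real Set.univ * ∫ x, u x ^ 2 ∂(surf N) := by
  set m := ∫ x, |u x| ∂(surf N)
  set S := (surf N).real Set.univ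
  have hS : 0 < S := surf_real_univ_pos
  have h : 0 ≤ ∫ x, (S * |u x| - m) ^ 2 ∂(surf N) := integral_nonneg fun x => sq_nonneg _
  have h1 : ∀ x, (S * |u x| - m) ^ 2 = S ^ 2 * u x ^ 2 - 2 * S * m * |u x| + m ^ 2 := fun x => by
    rw [← sq_abs (u x)]; ring
  simp only [h1] at h
  rw [integral_add (integrable_surf (by fun_prop)) (integrable_surf (by fun_prop)),
    integral_sub (integrable_surf (by fun_prop)) (integrable_surf (by fun_prop)),
    integral_const_mul, integral_const_mul, integral_const, smul_eq_mul] at h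
  change 0 ≤ S ^ 2 * _ - 2 * S * m * m + S * m ^ 2 at h
  refine le_of_mul_le_mul_left ?_ hS
  linarith

end RadialSets

section PowerInequalities

open Real

theorem abs_one_add_pow_sub_le {u : ℝ} (hu : |u| ≤ 1) (m : ℕ) :
    |(1 + u) ^ m - 1 - m * u| ≤ 4 ^ m * u ^ 2 := by
  induction m with
  | zero => simp; positivity
  | succ m ih =>
    have h1 : |1 + u| ≤ 2 := (abs_add_le _ _).trans (by rw [abs_one]; linarith)
    have h2 : (m : ℝ) ≤ 4 ^ m := by
      exact_mod_cast (Nat.lt_pow_self (by norm_num : 1 < 4)).le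
    have h3 : (1 + u) ^ (m + 1) - 1 - ((m + 1 : ℕ) : ℝ) * u
        = (1 + u) * ((1 + u) ^ m - 1 - m * u) + m * u ^ 2 := by
      push_cast; ring
    calc |(1 + u) ^ (m + 1) - 1 - ((m + 1 : ℕ) : ℝ) * u|
        ≤ |1 + u| * |(1 + u) ^ m - 1 - m * u| + m * u ^ 2 := by
          rw [h3, ← abs_mul]
          refine (abs_add_le _ _).trans_eq ?_
          rw [abs_of_nonneg (by positivity : 0 ≤ m * u ^ 2)]
      _ ≤ 2 * (4 ^ m * u ^ 2) + 4 ^ m * u ^ 2 := by gcongr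
      _ ≤ 4 ^ (m + 1) * u ^ 2 := by
          have : 0 ≤ 4 ^ m * u ^ 2 := by positivity
          rw [pow_succ (4 : ℝ) m]
          linarith

theorem rpow_one_sub_le {s t : ℝ} (hs : s ∈ Set.Ioo 0 1) (ht : 0 < t) :
    t ^ (1 - s) - t ≤ s * (1 - t) := by
  have h := rpow_one_add_le_one_add_mul_self (s := t - 1) (p := 1 - s) (by linarith)
    (by linarith [hs.2]) (by linarith [hs.1])
  rw [add_sub_cancel] at h
  linarith

theorem le_rpow_one_sub {s t : ℝ} (hs : s ∈ Set.Ioo 0 1) (ht : 0 < t) :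
    t * (1 - s * (t - 1)) ≤ t ^ (1 - s) := by
  have h := rpow_one_add_le_one_add_mul_self (s := t - 1) (p := s) (by linarith) hs.1.le hs.2.le
  rw [add_sub_cancel] at h
  have hp : 0 < t ^ s := rpow_pos_of_pos ht s
  rw [rpow_sub ht, rpow_one, le_div_iff₀ hp]
  rcases le_or_gt (1 - s * (t - 1)) 0 with h0 | h0
  · exact (mul_nonpos_of_nonpos_of_nonneg (mul_nonpos_of_nonneg_of_nonpos ht.le h0) hp.le).trans
      ht.le
  · have : (1 - s * (t - 1)) * t ^ s ≤ 1 :=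
      (mul_le_mul_of_nonneg_left h h0.le).trans (by nlinarith [sq_nonneg (s * (t - 1))])
    nlinarith

theorem rpow_sub_ge_of_near_one {s ε t : ℝ} (N : ℕ) (hs : s ∈ Set.Ioo 0 1) (hε : ε ∈ Set.Ioo 0 1)
    (ht : t ∈ Set.Icc (1 - ε) (1 + ε)) :
    1 + (N + 2 - s) / (N + 2) * (t ^ (N + 2) - 1)
      - s * (N + 2 - s) / 2 * (1 + ε) ^ (N + 2) * (t - 1) ^ 2 ≤ t ^ (N + 2 - s) := by
  have h0 : (0 : ℝ) < N + 2 - s := by linarith [(Nat.cast_nonneg N : (0 : ℝ) ≤ N), hs.2]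
  set C := (1 + ε) ^ (N + 2)
  have hC : 1 ≤ C := one_le_pow₀ (by linarith [hε.1])
  let h : ℝ → ℝ := fun t => t ^ (N + 2 - s) - (N + 2 - s) / (N + 2) * t ^ (N + 2)
    + s * (N + 2 - s) / 2 * C * (t - 1) ^ 2
  have hd : ∀ t, 0 < t → HasDerivAt h ((N + 2 - s) * (t ^ N * (t ^ (1 - s) - t)
      + s * C * (t - 1))) t := by
    intro t ht
    have h1 := Real.hasDerivAt_rpow_const (x := t) (p := N + 2 - s) (Or.inl ht.ne')
    have h2 := ((hasDerivAt_pow (N + 2) t).const_mul ((N + 2 - s) / (N + 2 : ℝ)))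
    have h3 := ((((hasDerivAt_id t).sub_const 1).pow 2).const_mul (s * (N + 2 - s) / 2 * C))
    refine ((h1.sub h2).add h3).congr_deriv ?_
    rw [show (N : ℝ) + 2 - s - 1 = N + (1 - s) by ring, rpow_add ht, rpow_natCast]
    have : (N : ℝ) + 2 ≠ 0 := by positivity
    simp
    field_simp
    ring
  have h1 : h 1 ≤ h t := by
    have hpos : ∀ r ∈ Set.Icc (1 - ε) (1 + ε), 0 < r := fun r hr => by linarith [hr.1, hε.2]
    rcases le_total t 1 with h2 | h2
    · have : AntitoneOn h (Set.Icc (1 - ε) 1) := by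
        have hp : ∀ r ∈ Set.Icc (1 - ε) 1, 0 < r := fun r hr => by linarith [hr.1, hε.2]
        refine antitoneOn_of_deriv_nonpos (convex_Icc _ _)
          (fun r hr => (hd r (hp r hr)).continuousAt.continuousWithinAt)
          (fun r hr => (hd r (hp r (interior_subset hr))).differentiableAt.differentiableWithinAt)
          fun r hr => ?_
        have hr' := interior_subset hr
        have hr0 := hp r hr'
        rw [(hd r hr0).deriv]
        refine mul_nonpos_of_nonneg_of_nonpos h0.le ?_
        have e1 := mul_le_mul_of_nonneg_left (rpow_one_sub_le hs hr0) (pow_nonneg hr0.le N)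
        have e2 : r ^ N ≤ C := (pow_le_one₀ hr0.le hr'.2).trans hC
        have e3 := mul_le_mul_of_nonneg_right e2 (mul_nonneg hs.1.le (sub_nonneg.2 hr'.2))
        linarith
      exact this ⟨ht.1, h2⟩ ⟨by linarith [hε.1], le_rfl⟩ h2
    · have : MonotoneOn h (Set.Icc 1 (1 + ε)) := by
        have hp : ∀ r ∈ Set.Icc 1 (1 + ε), 0 < r := fun r hr => by linarith [hr.1]
        refine monotoneOn_of_deriv_nonneg (convex_Icc _ _)
          (fun r hr => (hd r (hp r hr)).continuousAt.continuousWithinAt)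
          (fun r hr => (hd r (hp r (interior_subset hr))).differentiableAt.differentiableWithinAt)
          fun r hr => ?_
        have hr' := interior_subset hr
        have hr0 := hp r hr'
        rw [(hd r hr0).deriv]
        refine mul_nonneg h0.le ?_
        have e1 := mul_le_mul_of_nonneg_left (le_rpow_one_sub hs hr0) (pow_nonneg hr0.le N)
        have e2 : r ^ (N + 1) ≤ C := (pow_le_pow_left₀ hr0.le hr'.2 _).trans
          (pow_le_pow_right₀ (by linarith [hε.1]) (by lia))
        have e3 := mul_le_mul_of_nonneg_right e2 (mul_nonneg hs.1.le (sub_nonneg.2 hr'.1))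
        rw [pow_succ] at e3
        linarith
      exact this ⟨le_rfl, by linarith [hε.1]⟩ ⟨h2, ht.2⟩ h2
  simp only [h, one_rpow, one_pow, sub_self] at h1
  linarith

end PowerInequalities

section Stability

open Real

variable {N : ℕ} {s ε : ℝ} {u : USphere N → ℝ}

theorem abs_integral_le_of_integral_pow (hu : Continuous u) (hu1 : ∀ x, |u x| ≤ 1)
    (h : ∫ x, (1 + u x) ^ (N + 2) ∂(surf N) = (surf N).real Set.univ) :
    |∫ x, u x ∂(surf N)| ≤ 4 ^ (N + 2) * ∫ x, u x ^ 2 ∂(surf N) := by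
  have h1 : ∫ x, ((1 + u x) ^ (N + 2) - 1 - ((N + 2 : ℕ) : ℝ) * u x) ∂(surf N)
      = - (((N + 2 : ℕ) : ℝ) * ∫ x, u x ∂(surf N)) := by
    rw [integral_sub (integrable_surf (by fun_prop)) (integrable_surf (by fun_prop)),
      integral_sub (integrable_surf (by fun_prop)) (integrable_surf (by fun_prop)), h,
      integral_const_mul]
    simp
  have h2 := norm_integral_le_of_norm_le (μ := surf N)
    (f := fun x => (1 + u x) ^ (N + 2) - 1 - ((N + 2 : ℕ) : ℝ) * u x)
    (integrable_surf (by fun_prop : Continuous fun x => 4 ^ (N + 2) * u x ^ 2))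
    (.of_forall fun x => abs_one_add_pow_sub_le (hu1 x) (N + 2))
  rw [h1, integral_const_mul, norm_neg, norm_mul, RCLike.norm_natCast, norm_eq_abs] at h2
  refine le_trans (le_mul_of_one_le_left (abs_nonneg _) ?_) h2
  push_cast
  linarith [(Nat.cast_nonneg N : (0 : ℝ) ≤ N)]

theorem norm_integral_smul_le_of_integral_pow (hu : Continuous u) (hu1 : ∀ x, |u x| ≤ 1)
    (h : ∫ x, (1 + u x) ^ (N + 3) • x.1 ∂(surf N) = 0) :
    ‖∫ x, u x • x.1 ∂(surf N)‖ ≤ 4 ^ (N + 3) * ∫ x, u x ^ 2 ∂(surf N) := by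
  have h1 : ∫ x, ((1 + u x) ^ (N + 3) - 1 - ((N + 3 : ℕ) : ℝ) * u x) • x.1 ∂(surf N)
      = - (((N + 3 : ℕ) : ℝ) • ∫ x, u x • x.1 ∂(surf N)) := by
    simp only [sub_smul, one_smul, mul_smul]
    rw [integral_sub (integrable_surf (by fun_prop)) (integrable_surf (by fun_prop)),
      integral_sub (integrable_surf (by fun_prop)) (integrable_surf (by fun_prop)), h,
      integral_surf_coe, integral_smul]
    simp
  have h2 := norm_integral_le_of_norm_le (μ := surf N)
    (f := fun x => ((1 + u x) ^ (N + 3) - 1 - ((N + 3 : ℕ) : ℝ) * u x) • x.1)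
    (integrable_surf (by fun_prop : Continuous fun x => 4 ^ (N + 3) * u x ^ 2))
    (.of_forall fun x => by
      rw [norm_smul, norm_eq_of_mem_sphere, mul_one]
      exact abs_one_add_pow_sub_le (hu1 x) (N + 3))
  rw [h1, integral_const_mul, norm_neg, norm_smul, RCLike.norm_natCast] at h2
  refine le_trans (le_mul_of_one_le_left (norm_nonneg _) ?_) h2
  push_cast
  linarith [(Nat.cast_nonneg N : (0 : ℝ) ≤ N)]

theorem le_integral_rpow (hs : s ∈ Set.Ioo 0 1) (hε : ε ∈ Set.Ioo 0 1) (hu : Continuous u)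
    (huε : ∀ x, |u x| ≤ ε)
    (h : ∫ x, (1 + u x) ^ (N + 2) ∂(surf N) = (surf N).real Set.univ) :
    (surf N).real Set.univ - s * (N + 2 - s) / 2 * (1 + ε) ^ (N + 2) * ∫ x, u x ^ 2 ∂(surf N)
      ≤ ∫ x, (1 + u x) ^ (N + 2 - s) ∂(surf N) := by
  have hI : ∀ x, 1 + u x ∈ Set.Icc (1 - ε) (1 + ε) := fun x =>
    ⟨by linarith [(abs_le.1 (huε x)).1], by linarith [(abs_le.1 (huε x)).2]⟩
  have hp : Continuous fun x => (1 + u x) ^ (N + 2 - s) :=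
    (by fun_prop : Continuous fun x => 1 + u x).rpow_const
      fun x => Or.inl (by linarith [(hI x).1, hε.2] : 0 < 1 + u x).ne'
  have key := integral_mono (μ := surf N) (integrable_surf (by fun_prop)) (integrable_surf hp)
    fun x => rpow_sub_ge_of_near_one N hs hε (hI x)
  rw [integral_sub (integrable_surf (by fun_prop)) (integrable_surf (by fun_prop)),
    integral_add (integrable_surf (by fun_prop)) (integrable_surf (by fun_prop)),
    integral_const_mul, integral_const_mul,
    integral_sub (integrable_surf (by fun_prop)) (integrable_surf (by fun_prop)), h] at key
  simpa using key

theorem le_spectral_bracket (hε : ε ∈ Set.Ioo 0 1) (hu : Continuous u) (huε : ∀ x, |u x| ≤ ε)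
    (h : ∫ x, (1 + u x) ^ (N + 2) ∂(surf N) = (surf N).real Set.univ)
    (h' : ∫ x, (1 + u x) ^ (N + 3) • x.1 ∂(surf N) = 0) :
    (surf N).real Set.univ * ((∫ x, u x ^ 2 ∂(surf N))
        * (1 + spectralGain N - 2 * 16 ^ (N + 3) * ε ^ 2))
      ≤ (1 + spectralGain N) *
          ((surf N).real Set.univ * (∫ x, u x ^ 2 ∂(surf N)) - (∫ x, u x ∂(surf N)) ^ 2)
            - spectralGain N * (N + 2) * ‖∫ x, u x • x.1 ∂(surf N)‖ ^ 2 := by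
  have hu1 : ∀ x, |u x| ≤ 1 := fun x => (huε x).trans hε.2.le
  have h1 := abs_integral_le_of_integral_pow hu hu1 h
  have h2 := norm_integral_smul_le_of_integral_pow hu hu1 h'
  have hA : 0 ≤ ∫ x, u x ^ 2 ∂(surf N) := integral_nonneg fun x => sq_nonneg _
  have hAε : ∫ x, u x ^ 2 ∂(surf N) ≤ (surf N).real Set.univ * ε ^ 2 := by
    have := integral_mono (μ := surf N) (integrable_surf
      (by fun_prop : Continuous fun x => u x ^ 2))
      (integrable_surf continuous_const)
      fun x => (sq_abs (u x)).symm.trans_le (pow_le_pow_left₀ (abs_nonneg _) (huε x) 2)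
    simpa using this
  set A := ∫ x, u x ^ 2 ∂(surf N)
  set S := (surf N).real Set.univ
  have h3 : (∫ x, u x ∂(surf N)) ^ 2 ≤ 16 ^ (N + 2) * A ^ 2 := by
    rw [← sq_abs]
    refine (pow_le_pow_left₀ (abs_nonneg _) h1 2).trans_eq ?_
    rw [mul_pow, ← pow_mul, mul_comm (N + 2) 2, pow_mul]
    norm_num
  have h4 : ‖∫ x, u x • x.1 ∂(surf N)‖ ^ 2 ≤ 16 ^ (N + 3) * A ^ 2 := by
    refine (pow_le_pow_left₀ (norm_nonneg _) h2 2).trans_eq ?_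
    rw [mul_pow, ← pow_mul, mul_comm (N + 3) 2, pow_mul]
    norm_num
  have hη := spectralGain_pos (N := N)
  have hη2 := spectralGain_mul_le (N := N)
  have hη1 : spectralGain N ≤ 1 := by
    nlinarith [(Nat.cast_nonneg N : (0 : ℝ) ≤ N)]
  have h5 : (1 + spectralGain N) * (∫ x, u x ∂(surf N)) ^ 2 ≤ 2 * (16 ^ (N + 2) * A ^ 2) :=
    mul_le_mul (by linarith) h3 (sq_nonneg _) (by norm_num)
  have h6 : spectralGain N * (N + 2) * ‖∫ x, u x • x.1 ∂(surf N)‖ ^ 2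
      ≤ 1 * (16 ^ (N + 3) * A ^ 2) :=
    mul_le_mul hη2 h4 (sq_nonneg _) (by norm_num)
  have h7 : A ^ 2 ≤ S * ε ^ 2 * A := by
    rw [sq]; exact mul_le_mul_of_nonneg_right hAε hA
  have h8 := mul_le_mul_of_nonneg_left h7 (by positivity : (0 : ℝ) ≤ 2 * 16 ^ (N + 3))
  have h9 : (16 : ℝ) ^ (N + 3) = 16 * 16 ^ (N + 2) := by ring
  have h10 : 0 ≤ 16 ^ (N + 2) * A ^ 2 := by positivity
  rw [h9] at h6 h8 ⊢
  linarith

/-- The quantitative isoperimetric inequality for nearly spherical sets, in terms of `∫ u²`. -/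
theorem integral_sq_le_fracPer_sub (hs : s ∈ Set.Ioo 0 1) (hε : ε ∈ Set.Ioo 0 1)
    (hgap : spectralGain N / 2 ≤ bandConst N ε * (1 + spectralGain N - 2 * 16 ^ (N + 3) * ε ^ 2)
      - (1 + ε) ^ (N + 2))
    (hu : Continuous u) (huε : ∀ x, |u x| ≤ ε) (hul : ∀ x y, |u y - u x| ≤ ε * ‖x.1 - y.1‖)
    {E : Set (EuclideanSpace ℝ (Fin (N + 2)))} (hE : MeasurableSet E)
    (hER : ∀ (x : USphere N) (r : ℝ), 0 < r → (r • x.1 ∈ E ↔ r < 1 + u x))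
    (h : ∫ x, (1 + u x) ^ (N + 2) ∂(surf N) = (surf N).real Set.univ)
    (h' : ∫ x, (1 + u x) ^ (N + 3) • x.1 ∂(surf N) = 0) :
    rieszGap N s * (spectralGain N / 4) * ∫ x, u x ^ 2 ∂(surf N)
      ≤ (fracPer (N + 2) s E).toReal - (fracPer (N + 2) s (ball 0 1)).toReal := by
  have hP := (fracPer_ne_top_and_le hs hε hu huε hul hE hER).2
  have hJ := le_integral_rpow hs hε hu huε h
  have hb := le_spectral_bracket hε hu huε h h'
  have hA : 0 ≤ ∫ x, u x ^ 2 ∂(surf N) := integral_nonneg fun x => sq_nonneg _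
  have h0 : (0 : ℝ) < N + 2 - s := by linarith [(Nat.cast_nonneg N : (0 : ℝ) ≤ N), hs.2]
  have hlam := rieszGap_pos (N := N) hs
  have hS := surf_real_univ_pos (N := N)
  have hs0 := hs.1
  have hκ : 0 ≤ bandConst N ε :=
    mul_nonneg (pow_nonneg (by linarith [hε.2]) _) (rpow_nonneg (by positivity) _)
  rw [fracPer_ball_toReal hs]
  set A := ∫ x, u x ^ 2 ∂(surf N)
  set S := (surf N).real Set.univ
  have h1 := mul_le_mul_of_nonneg_left hJ (div_nonneg hlam.le (mul_pos hs0 h0).le)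
  have h2 := mul_le_mul_of_nonneg_left (mul_le_mul_of_nonneg_left hb (div_nonneg hlam.le hS.le)) hκ
  have h3 : rieszGap N s / (s * (N + 2 - s))
      * (S - s * (N + 2 - s) / 2 * (1 + ε) ^ (N + 2) * A)
      = S * (rieszGap N s / (s * (N + 2 - s))) - rieszGap N s * ((1 + ε) ^ (N + 2) * A / 2) := by
    field_simp
  have h4 : rieszGap N s / S * (S * (A * (1 + spectralGain N - 2 * 16 ^ (N + 3) * ε ^ 2)))
      = rieszGap N s * (A * (1 + spectralGain N - 2 * 16 ^ (N + 3) * ε ^ 2)) := by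
    field_simp
  rw [h3] at h1
  rw [h4] at h2
  have h5 := mul_le_mul_of_nonneg_left hgap (mul_nonneg hlam.le hA)
  linarith

theorem exists_radius_gap (N : ℕ) : ∃ ε ∈ Set.Ioo (0 : ℝ) (1 / 2),
    spectralGain N / 2 ≤ bandConst N ε * (1 + spectralGain N - 2 * 16 ^ (N + 3) * ε ^ 2)
      - (1 + ε) ^ (N + 2) := by
  have hc : ContinuousAt (fun ε => bandConst N ε *
      (1 + spectralGain N - 2 * 16 ^ (N + 3) * ε ^ 2) - (1 + ε) ^ (N + 2)) 0 := by
    unfold bandConst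
    have : ContinuousAt (fun ε : ℝ => (ε ^ 2 + (1 + ε) ^ 2) ^ (-((N : ℝ) + 3) / 2)) 0 :=
      ContinuousAt.rpow_const (by fun_prop) (Or.inl (by norm_num))
    fun_prop
  have h := hc.eventually (lt_mem_nhds (a := spectralGain N / 2) (by
    have := spectralGain_pos (N := N)
    simp [bandConst]
    linarith))
  obtain ⟨ε, h1, h2⟩ := ((h.filter_mono nhdsWithin_le_nhds).and
    (Ioo_mem_nhdsGT (by norm_num : (0 : ℝ) < 1 / 2))).exists
  exact ⟨ε, h2, h1.le⟩

end Stability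

section NearlySpherical

open Real

variable {N : ℕ} {E : Set (EuclideanSpace ℝ (Fin (N + 2)))} {u : USphere N → ℝ}

theorem matchRad_eq_one {n : ℕ} {E : Set (EuclideanSpace ℝ (Fin n))}
    (h : volume E = volume (ball (0 : EuclideanSpace ℝ (Fin n)) 1)) : matchRad n E = 1 := by
  have h0 : (volume (ball (0 : EuclideanSpace ℝ (Fin n)) 1)).toReal ≠ 0 :=
    (ENNReal.toReal_pos (measure_ball_pos volume _ one_pos).ne' measure_ball_lt_top.ne).ne'
  rw [matchRad, h, div_self h0, one_rpow]

theorem integral_pow_eq_of_volume_eq (hE : MeasurableSet E) (hu : Continuous u)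
    (hu0 : ∀ x, 0 < 1 + u x)
    (hER : ∀ (x : USphere N) (r : ℝ), 0 < r → (r • x.1 ∈ E ↔ r < 1 + u x))
    (h : volume E = volume (ball (0 : EuclideanSpace ℝ (Fin (N + 2))) 1)) :
    ∫ x, (1 + u x) ^ (N + 2) ∂(surf N) = (surf N).real Set.univ := by
  have hvol : ∀ {F : Set (EuclideanSpace ℝ (Fin (N + 2)))} {R : USphere N → ℝ}, MeasurableSet F →
      Continuous R → (∀ x, 0 < R x) →
      (∀ (x : USphere N) (r : ℝ), 0 < r → (r • x.1 ∈ F ↔ r < R x)) →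
      (volume F).toReal = (∫ x, R x ^ (N + 2) ∂(surf N)) / (N + 2) := by
    intro F R hF hR hR0 hFR
    rw [volume_eq_lintegral_radius hF hR0 hFR, ← integral_div,
      integral_eq_lintegral_of_nonneg_ae
        (.of_forall fun x => div_nonneg (pow_nonneg (hR0 x).le _) (by positivity))
        (by fun_prop : Continuous fun x => R x ^ (N + 2) / ((N : ℝ) + 2)).aestronglyMeasurable]
  have h1 := hvol hE (by fun_prop : Continuous fun x => 1 + u x) hu0 hER
  have h2 := hvol measurableSet_ball continuous_const (fun _ => one_pos)
    (F := ball 0 1) (R := fun _ => 1) fun x r hr => by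
      rw [mem_ball_zero_iff, norm_smul, norm_eq_of_mem_sphere, mul_one, norm_of_nonneg hr.le]
  rw [h, h2] at h1
  have h3 : (N : ℝ) + 2 ≠ 0 := by positivity
  rw [div_left_inj' h3] at h1
  simpa using h1.symm

theorem integral_pow_smul_eq_zero_of_barycenter_eq_zero (hE : MeasurableSet E)
    (hb : IsBounded E) (hvol : volume E ≠ 0) (hu0 : ∀ x, 0 < 1 + u x)
    (hER : ∀ (x : USphere N) (r : ℝ), 0 < r → (r • x.1 ∈ E ↔ r < 1 + u x))
    (h : barycenter (N + 2) E = 0) :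
    ∫ x, (1 + u x) ^ (N + 3) • x.1 ∂(surf N) = 0 := by
  have h1 : (volume E).toReal⁻¹ ≠ 0 :=
    inv_ne_zero (ENNReal.toReal_pos hvol hb.measure_lt_top.ne).ne'
  have h2 := (smul_eq_zero.1 h).resolve_left h1
  have h3 : (N : ℝ) + 3 ≠ 0 := by positivity
  rw [integral_id_eq_integral_radius hE hb hu0 hER] at h2
  simp only [div_eq_inv_mul, mul_smul] at h2
  rw [integral_smul] at h2
  exact (smul_eq_zero.1 h2).resolve_left (inv_ne_zero h3)

theorem barAsym_sq_le (hE : MeasurableSet E) (hu : Continuous u) (hu1 : ∀ x, |u x| ≤ 1)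
    (hER : ∀ (x : USphere N) (r : ℝ), 0 < r → (r • x.1 ∈ E ↔ r < 1 + u x))
    (h : volume E = volume (ball (0 : EuclideanSpace ℝ (Fin (N + 2))) 1))
    (h' : barycenter (N + 2) E = 0) :
    barAsym (N + 2) E ^ 2 ≤ 4 ^ (N + 1) * (surf N).real Set.univ * (∫ x, u x ^ 2 ∂(surf N))
      / (volume (ball (0 : EuclideanSpace ℝ (Fin (N + 2))) 1)).toReal ^ 2 := by
  have h1 := ENNReal.toReal_mono ENNReal.ofReal_ne_top (volume_symmDiff_ball_le hu hE hu1 hER)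
  rw [ENNReal.toReal_ofReal (mul_nonneg (by positivity) (integral_nonneg fun x => abs_nonneg _))]
    at h1
  rw [barAsym, h', matchRad_eq_one h, h, div_pow]
  refine div_le_div_of_nonneg_right ?_ (sq_nonneg _)
  refine (pow_le_pow_left₀ ENNReal.toReal_nonneg h1 2).trans ?_
  rw [mul_pow, ← pow_mul, mul_comm (N + 1) 2, pow_mul, mul_assoc, show (2 : ℝ) ^ 2 = 4 by norm_num]
  exact mul_le_mul_of_nonneg_left (sq_integral_abs_le hu) (by positivity)

end NearlySpherical

/-- For every `n ≥ 2` there are `ε₀ ∈ (0,1/2)` and `c₁ > 0`, depending only on `n`, such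
that every nearly spherical set (an open bounded `E ⊆ ℝⁿ` with `|E| = |B|`, barycenter at the
origin, and boundary `∂E = {(1 + u(x)) x : x ∈ ∂B}` for a Lipschitz `u` with
`‖u‖_{W^{1,∞}(∂B)} = ‖u‖_{L^∞} + ‖∇u‖_{L^∞} < ε₀`, the gradient bound being encoded by the
Lipschitz constant `L`) satisfies `δ_s(E) ≥ c₁ s λ₀(E)²` for all `s ∈ (0,1)`; explicitly
`c₁ = ω_n ε₀² c₀ / (n ((1+ε₀)ⁿ - 1)²)` for a constant `c₀ > 0` (the one from the fractional
Fuglede inequality). -/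
theorem deficit_ge_barAsym_sq_nearly_spherical
    (n : ℕ) (hn : 2 ≤ n) :
    ∃ ε₀ ∈ Set.Ioo (0 : ℝ) (1 / 2), ∃ c₀ c₁ : ℝ, 0 < c₀ ∧ 0 < c₁ ∧
      c₁ = (volume (ball (0 : EuclideanSpace ℝ (Fin n)) 1)).toReal * ε₀ ^ 2 * c₀
        / (n * ((1 + ε₀) ^ n - 1) ^ 2) ∧
      ∀ (E : Set (EuclideanSpace ℝ (Fin n))) (u : EuclideanSpace ℝ (Fin n) → ℝ)
        (M : ℝ) (L : NNReal),
        IsOpen E → IsBounded E →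
        volume E = volume (ball (0 : EuclideanSpace ℝ (Fin n)) 1) →
        barycenter n E = 0 →
        frontier E = (fun x => (1 + u x) • x) '' sphere (0 : EuclideanSpace ℝ (Fin n)) 1 →
        LipschitzOnWith L u (sphere (0 : EuclideanSpace ℝ (Fin n)) 1) →
        (∀ x ∈ sphere (0 : EuclideanSpace ℝ (Fin n)) 1, |u x| ≤ M) →
        M + (L : ℝ) < ε₀ →
        ∀ s ∈ Set.Ioo (0 : ℝ) 1,
          c₁ * s * barAsym n E ^ 2 ≤ sDeficit n s E := by
  obtain ⟨N, rfl⟩ := Nat.exists_eq_add_of_le' hn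
  obtain ⟨ε, hε, hgap⟩ := exists_radius_gap N
  have hε' : ε ∈ Set.Ioo (0 : ℝ) 1 := ⟨hε.1, hε.2.trans (by norm_num)⟩
  have hballpos : 0 < volume (ball (0 : EuclideanSpace ℝ (Fin (N + 2))) 1) :=
    measure_ball_pos volume _ one_pos
  have hω : 0 < (volume (ball (0 : EuclideanSpace ℝ (Fin (N + 2))) 1)).toReal :=
    ENNReal.toReal_pos hballpos.ne' measure_ball_lt_top.ne
  have hS := surf_real_univ_pos (N := N)
  have hη := spectralGain_pos (N := N)
  have hε1 : 0 < (1 + ε) ^ (N + 2) - 1 :=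
    sub_pos.2 (one_lt_pow₀ (by linarith [hε.1]) (by lia))
  set ω := (volume (ball (0 : EuclideanSpace ℝ (Fin (N + 2))) 1)).toReal
  set S := (surf N).real Set.univ
  have hε0 := hε.1
  have hN : (0 : ℝ) < (N + 2 : ℕ) := by positivity
  let c := spectralGain N * ω ^ 2 / (4 * 4 ^ (N + 1) * S ^ 2)
  have hc : 0 < c := by positivity
  refine ⟨ε, hε, c * ((N + 2 : ℕ) * ((1 + ε) ^ (N + 2) - 1) ^ 2) / (ω * ε ^ 2), c,
    by positivity, hc, ?_, ?_⟩
  · field_simp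
  intro E u M L hE hb hvol hbar hf hLip hM hML s hs
  obtain ⟨e, he⟩ : (sphere (0 : EuclideanSpace ℝ (Fin (N + 2))) 1).Nonempty :=
    NormedSpace.sphere_nonempty.2 zero_le_one
  have hM0 : 0 ≤ M := (abs_nonneg _).trans (hM e he)
  have hMε : M ≤ ε := by linarith [L.coe_nonneg]
  have hLε : (L : ℝ) ≤ ε := by linarith
  let v : USphere N → ℝ := fun x => u x
  have hv : Continuous v := continuousOn_iff_continuous_domRestrict.1 hLip.continuousOn
  have hvε : ∀ x, |v x| ≤ ε := fun x => (hM x x.2).trans hMε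
  have hv0 : ∀ x ∈ sphere (0 : EuclideanSpace ℝ (Fin (N + 2))) 1, 0 < 1 + u x := fun x hx => by
    linarith [(abs_le.1 (hM x hx)).1, hε.2]
  have hvl : ∀ x y, |v y - v x| ≤ ε * ‖x.1 - y.1‖ := fun x y => by
    have h1 := hLip.dist_le_mul y y.2 x x.2
    rw [dist_comm y.1, dist_eq_norm x.1] at h1
    exact h1.trans (mul_le_mul_of_nonneg_right hLε (norm_nonneg _))
  have hne : E.Nonempty := nonempty_of_measure_ne_zero (hvol ▸ hballpos.ne')
  have hER : ∀ (x : USphere N) (r : ℝ), 0 < r → (r • x.1 ∈ E ↔ r < 1 + v x) := fun x r hr =>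
    smul_mem_iff_of_frontier_eq hE hb hne hf hv0 x.2 hr
  have hR0 : ∀ x, 0 < 1 + v x := fun x => hv0 x x.2
  have hm := hE.measurableSet
  have h1 := integral_pow_eq_of_volume_eq hm hv hR0 hER hvol
  have h2 := integral_pow_smul_eq_zero_of_barycenter_eq_zero hm hb (hvol ▸ hballpos.ne') hR0 hER
    hbar
  have h3 := integral_sq_le_fracPer_sub hs hε' hgap hv hvε hvl hm hER h1 h2
  have h4 := barAsym_sq_le hm hv (fun x => (hvε x).trans hε'.2.le) hER hvol hbar
  have hA : 0 ≤ ∫ x, v x ^ 2 ∂(surf N) := integral_nonneg fun x => sq_nonneg _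
  have h0 : (1 : ℝ) ≤ N + 2 - s := by linarith [(Nat.cast_nonneg N : (0 : ℝ) ≤ N), hs.2]
  have hlam := rieszGap_pos (N := N) hs
  have hs0 := hs.1
  rw [sDeficit, matchRad_eq_one hvol]
  have hP := fracPer_ball_toReal (N := N) hs
  have hP0 : 0 < (fracPer (N + 2) s (ball 0 1)).toReal := by
    rw [hP]; positivity
  rw [le_div_iff₀ hP0]
  refine le_trans ?_ h3
  rw [hP]
  set A := ∫ x, v x ^ 2 ∂(surf N)
  calc c * s * barAsym (N + 2) E ^ 2 * (S * (rieszGap N s / (s * (N + 2 - s))))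
      ≤ c * s * (4 ^ (N + 1) * S * A / ω ^ 2) * (S * (rieszGap N s / (s * (N + 2 - s)))) := by
        gcongr
    _ = rieszGap N s * (spectralGain N / 4) * A * (1 / (N + 2 - s)) := by
        simp only [c]
        field_simp
    _ ≤ rieszGap N s * (spectralGain N / 4) * A * 1 := by
        gcongr
        exact (div_le_one (by linarith)).2 h0
    _ = rieszGap N s * (spectralGain N / 4) * A := mul_one _
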